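/- Let p,q > 1 satisfy 1/p + 1/q < 2/d if d ≥ 2. Then for every ω ∈ Ω* ∩ Ω_{p,q}, one has π(0) ∈ L¹(P_ω) (so that Q_ω is well defined), and for every bounded continuous f: Ω → ℝ, (1/n) Σ_{k=0}^{n−1} f(τ_{X_k}(ω)) converges to E_{Q_ω}(f) in L¹(P_ω^0) as n → ∞. -/

import Mathlib

open MeasureTheory Filter Topology Matrix
open scoped ENNReal NNReal

noncomputable section

namespace DetCond

/-- Vertices of `ℤ^d`. -/
abbrev Vert (d : ℕ) := Fin d → ℤ

/-- Index of the (unordered) nearest-neighbour edge `(x, x + e i)` of `ℤ^d`;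
the set of these indices is in natural bijection with `E(ℤ^d)` modulo orientation. -/
abbrev EdgeIx (d : ℕ) := Vert d × Fin d

/-- The space `Ω = (0,∞)^{E(ℤ^d)}` of (symmetric) conductance configurations, with
its product topology and product σ-algebra. -/
abbrev EnvSp (d : ℕ) := {ω : EdgeIx d → ℝ // ∀ e, 0 < ω e}

/-- The `i`-th coordinate unit vector of `ℤ^d`. -/
def unitv (d : ℕ) (i : Fin d) : Vert d := fun j => if j = i then 1 else 0

/-- The translation `τ_x` acting on environments: `c_{τ_x ω}(y,z) = c_ω(y+x,z+x)`. -/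
def shift (d : ℕ) (x : Vert d) (ω : EnvSp d) : EnvSp d :=
  ⟨fun e => ω.1 (e.1 + x, e.2), fun e => ω.2 (e.1 + x, e.2)⟩

/-- The conductance `c_ω(x,y)`; it vanishes when `x,y` are not nearest neighbours
and is symmetric in `x,y` by construction. -/
def cnd (d : ℕ) (ω : EnvSp d) (x y : Vert d) : ℝ :=
  ∑ i, ((if y = x + unitv d i then ω.1 (x, i) else 0) +
        (if x = y + unitv d i then ω.1 (y, i) else 0))

/-- `π_ω(x) = Σ_{z : (x,z) ∈ E(ℤ^d)} c_ω(x,z)`. -/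
def piOf (d : ℕ) (ω : EnvSp d) (x : Vert d) : ℝ :=
  ∑ i, (ω.1 (x, i) + ω.1 (x - unitv d i, i))

/-- The box `Λ_r = [-r,r]^d ∩ ℤ^d`. -/
def box (d : ℕ) (r : ℝ) : Finset (Vert d) :=
  Fintype.piFinset fun _ : Fin d => Finset.Icc ⌈-r⌉ ⌊r⌋

/-- The nearest neighbours of `x` in `ℤ^d`. -/
def nbrs (d : ℕ) (x : Vert d) : Finset (Vert d) :=
  (Finset.univ.image fun i => x + unitv d i) ∪ (Finset.univ.image fun i => x - unitv d i)

/-- The set `E(Λ)` of edges incident with at least one vertex of `Λ`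
(one index per unordered edge). -/
def edgesIn (d : ℕ) (Λ : Finset (Vert d)) : Finset (EdgeIx d) :=
  Λ.biUnion fun x =>
    (Finset.univ.image fun i => (x, i)) ∪ (Finset.univ.image fun i => (x - unitv d i, i))

/-- Bounded functions on `Ω`. -/
def IsBdd (d : ℕ) (f : EnvSp d → ℝ) : Prop := ∃ M, ∀ ω, |f ω| ≤ M

/-- Local functions: `f` depends only on the coordinates in some finite set `B` of edges
and, viewed as a function of those coordinates, has compact support in `(0,∞)^B`. -/
def IsLocalFn (d : ℕ) (f : EnvSp d → ℝ) : Prop :=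
  ∃ B : Finset (EdgeIx d),
    (∀ ω₁ ω₂ : EnvSp d, (∀ e ∈ B, ω₁.1 e = ω₂.1 e) → f ω₁ = f ω₂) ∧
    ∃ a b : ℝ, 0 < a ∧ ∀ ω : EnvSp d, (∃ e ∈ B, ω.1 e < a ∨ b < ω.1 e) → f ω = 0

/-- `ℓ_ω(f) = L`, i.e. the block averages of the translates of `f` converge to `L`. -/
def avgTo (d : ℕ) (ω : EnvSp d) (f : EnvSp d → ℝ) (L : ℝ) : Prop :=
  Tendsto (fun n : ℕ => (∑ x ∈ box d (n : ℝ), f (shift d x ω)) / ((box d (n : ℝ)).card : ℝ))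
    atTop (𝓝 L)

/-- `ω` is averaging: `ℓ_ω(f)` exists for every continuous local `f`. -/
def Averaging (d : ℕ) (ω : EnvSp d) : Prop :=
  ∀ f : EnvSp d → ℝ, Continuous f → IsLocalFn d f → ∃ L, avgTo d ω f L

/-- `ω` is tempered, i.e. `ω ∈ Ω'`. -/
def Tempered (d : ℕ) (ω : EnvSp d) : Prop :=
  Tendsto (fun ε : ℝ =>
      limsup (fun n : ℕ =>
        (∑ e ∈ edgesIn d (box d (n : ℝ)),
            (if ε ≤ ω.1 e ∧ ω.1 e ≤ ε⁻¹ then (0:ℝ) else 1)) / (n : ℝ) ^ d) atTop)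
    (𝓝[>] 0) (𝓝 0)

/-- `P` is the measure `ℙ_ω` associated with an averaging tempered `ω`:
the unique probability measure whose expectation of every bounded continuous function
is the corresponding block-average limit `ℓ_ω(f)`. -/
def IsEnvLaw (d : ℕ) (ω : EnvSp d) (P : Measure (EnvSp d)) : Prop :=
  IsProbabilityMeasure P ∧
    ∀ f : EnvSp d → ℝ, Continuous f → IsBdd d f → avgTo d ω f (∫ ω', f ω' ∂P)

/-- Ergodicity of a measure on `Ω` with respect to the translations of `ℤ^d`. -/
def ErgodicEnv (d : ℕ) (P : Measure (EnvSp d)) : Prop :=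
  ∀ A : Set (EnvSp d), MeasurableSet A → (∀ x : Vert d, shift d x ⁻¹' A = A) →
    P A = 0 ∨ P A = 1

/-- `ω ∈ Ω⋆`: tempered, averaging, and the associated measure `ℙ_ω` is ergodic. -/
def InOmegaStar (d : ℕ) (ω : EnvSp d) : Prop :=
  Tempered d ω ∧ Averaging d ω ∧
    ∀ P : Measure (EnvSp d), IsEnvLaw d ω P → ErgodicEnv d P

/-- `ω ∈ Ω_{p,q}`. -/
def InOmegaPQ (d : ℕ) (p q : ℝ) (ω : EnvSp d) : Prop :=
  (∃ C : ℝ, ∀ n : ℕ, 1 ≤ n →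
      (∑ e ∈ edgesIn d (box d (n : ℝ)), ω.1 e ^ p) / (n : ℝ) ^ d ≤ C) ∧
  (∃ C : ℝ, ∀ n : ℕ, 1 ≤ n →
      (∑ e ∈ edgesIn d (box d (n : ℝ)), ω.1 e ^ (-q)) / (n : ℝ) ^ d ≤ C)

/-- The path space of the discrete-time walk. -/
abbrev Path (d : ℕ) := ℕ → Vert d

/-- One-step transition probabilities `𝖯_ω(x,y) = c_ω(x,y)/π_ω(x)`. -/
def transP (d : ℕ) (ω : EnvSp d) (x y : Vert d) : ℝ := cnd d ω x y / piOf d ω x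

/-- `μ` is the law `P_ω^{x₀}` of the random walk among the conductances `ω`
started at `x₀`: a probability measure on the path space with the prescribed
finite-dimensional (cylinder) probabilities. -/
def IsWalkLaw (d : ℕ) (ω : EnvSp d) (x₀ : Vert d) (μ : Measure (Path d)) : Prop :=
  IsProbabilityMeasure μ ∧
    ∀ (n : ℕ) (γ : ℕ → Vert d),
      μ {w | ∀ k ≤ n, w k = γ k} =
        (if γ 0 = x₀ then 1 else 0) *
          ∏ k ∈ Finset.range n, ENNReal.ofReal (transP d ω (γ k) (γ (k+1)))

/-- `n`-step transition probabilities of the discrete-time walk. -/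
def stepP (d : ℕ) (ω : EnvSp d) : ℕ → Vert d → Vert d → ℝ
  | 0, x, y => if x = y then 1 else 0
  | n+1, x, y => ∑ z ∈ nbrs d x, transP d ω x z * stepP d ω n z y

/-- `P_ω^x(Y_t = y)` for the constant-speed continuous-time walk `Y_t = X_{N(t)}`,
where `N` is an independent rate-1 Poisson process. -/
def ctP (d : ℕ) (ω : EnvSp d) (t : ℝ) (x y : Vert d) : ℝ :=
  ∑' k : ℕ, Real.exp (-t) * t ^ k / (Nat.factorial k : ℝ) * stepP d ω k x y

/-- The `ℓ¹`-norm of a vertex of `ℤ^d`. -/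
def l1 (d : ℕ) (x : Vert d) : ℝ := ∑ i, |(x i : ℝ)|

/-- A vertex of `ℤ^d` regarded as a point of `ℝ^d`. -/
def ivert (d : ℕ) (x : Vert d) : Fin d → ℝ := fun i => (x i : ℝ)

/-- The linearly interpolated diffusively rescaled walk `B^{(n)}`. -/
def BnProc (d : ℕ) (n : ℕ) (w : Path d) (t : ℝ) : Fin d → ℝ :=
  (Real.sqrt n)⁻¹ •
    (ivert d (w ⌊t * n⌋₊) +
      (t * n - (⌊t * n⌋₊ : ℝ)) • (ivert d (w (⌊t * n⌋₊ + 1)) - ivert d (w ⌊t * n⌋₊)))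


/-- The measure `ℚ_ω` obtained from `ℙ_ω` by tilting with `π(0)`. -/
def Qmeas (d : ℕ) (P : Measure (EnvSp d)) : Measure (EnvSp d) :=
  P.withDensity fun ω' => ENNReal.ofReal (piOf d ω' 0 / ∫ ω'', piOf d ω'' 0 ∂P)

/-- The inner product `⟨f,g⟩_{L²(πμ)}`. -/
def innerP (d : ℕ) (P : Measure (EnvSp d)) (f g : EnvSp d → ℝ) : ℝ :=
  ∫ ω', f ω' * g ω' * piOf d ω' 0 ∂P

/-- The Dirichlet pairing `⟨h, (−L)h⟩_{L²(πμ)}`. -/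
def quadL (d : ℕ) (P : Measure (EnvSp d)) (h : EnvSp d → ℝ) : ℝ :=
  ∫ ω', (∑ z ∈ nbrs d 0, cnd d ω' 0 z * (h ω' - h (shift d z ω'))) * h ω' ∂P

/-- The inner product of `L²(ν)`. -/
def innerQ (d : ℕ) (ν : Measure (EnvSp d)) (f g : EnvSp d → ℝ) : ℝ :=
  ∫ ω', f ω' * g ω' ∂ν

/-- The Dirichlet pairing `⟨h, (−L)h⟩_{L²(ν)}`. -/
def quadQ (d : ℕ) (ν : Measure (EnvSp d)) (h : EnvSp d → ℝ) : ℝ :=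
  ∫ ω', ((piOf d ω' 0)⁻¹ *
      ∑ z ∈ nbrs d 0, cnd d ω' 0 z * (h ω' - h (shift d z ω'))) * h ω' ∂ν

/-- The set whose supremum is the variational characterization
`⟨f,(−L)⁻¹f⟩_{L²(ν)} = sup_h [2⟨h,f⟩ − ⟨h,(−L)h⟩]` (over bounded continuous `h`);
`⟨f,(−L)⁻¹f⟩_{L²(ν)} < ∞` means this set is bounded above. -/
def invPairSet (d : ℕ) (ν : Measure (EnvSp d)) (f : EnvSp d → ℝ) : Set ℝ :=
  {r | ∃ h : EnvSp d → ℝ, Continuous h ∧ IsBdd d h ∧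
        r = 2 * innerQ d ν h f - quadQ d ν h}

/-- The function `f(ω) = π_ω(0)⁻¹ ∇⋆(c v)(ω)` built from a vector field `v`. -/
def fDiv (d : ℕ) (v : EnvSp d → Fin d → ℝ) (ω : EnvSp d) : ℝ :=
  (piOf d ω 0)⁻¹ *
    ∑ i, (cnd d ω 0 (unitv d i) * v ω i -
          cnd d ω (-(unitv d i)) 0 * v (shift d (-(unitv d i)) ω) i)

/-- The inner product of `ℓ²(Λ,π_ω)`. -/
def innerF (d : ℕ) (ω : EnvSp d) (Λ : Finset (Vert d)) (f g : Vert d → ℝ) : ℝ :=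
  ∑ x ∈ Λ, f x * g x * piOf d ω x

/-- The pairing `⟨h, (−𝖫_ω)h⟩_{ℓ²(Λ,π_ω)}` for `h` vanishing outside `Λ`. -/
def quadF (d : ℕ) (ω : EnvSp d) (Λ : Finset (Vert d)) (h : Vert d → ℝ) : ℝ :=
  ∑ x ∈ Λ, (∑ z ∈ nbrs d x, cnd d ω x z * (h x - h z)) * h x

/-- `⟨f, (−𝖫_ω)⁻¹_Λ f⟩_{ℓ²(Λ,π_ω)}` via its variational characterization
`sup_h [2⟨h,f⟩ − ⟨h,(−𝖫_ω)h⟩]` over `h ∈ ℓ²(Λ,π_ω)`. -/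
def invPairF (d : ℕ) (ω : EnvSp d) (Λ : Finset (Vert d)) (f : Vert d → ℝ) : ℝ :=
  sSup {r | ∃ h : Vert d → ℝ, (∀ x ∉ Λ, h x = 0) ∧
      r = 2 * innerF d ω Λ h f - quadF d ω Λ h}

/-- The antisymmetric edge function `v∘τ(ω)`: the value assigned to the
edge `(x, x+e_i)` is `v_i(τ_x(ω))`. -/
def efield (d : ℕ) (v : EnvSp d → Fin d → ℝ) (ω : EnvSp d) : Vert d → Fin d → ℝ :=
  fun x i => v (shift d x ω) i

/-- The discrete gradient `∇h` of `h : ℤ^d → ℝ` as an edge function. -/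
def dgradE (d : ℕ) (h : Vert d → ℝ) : Vert d → Fin d → ℝ :=
  fun x i => h (x + unitv d i) - h x

/-- The inner product `⟨u,w⟩_{ℓ²(E(Λ), c_ω)}` of (antisymmetric) edge functions;
each unordered edge is counted once, which agrees with the paper's sum over
ordered edges carrying the factor ½. -/
def einner (d : ℕ) (ω : EnvSp d) (Λ : Finset (Vert d)) (u w : Vert d → Fin d → ℝ) : ℝ :=
  ∑ e ∈ edgesIn d Λ, u e.1 e.2 * w e.1 e.2 * ω.1 e

/-- The Dirichlet energy `𝓔_Λ^ω(v)`. -/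
def direnergy (d : ℕ) (ω : EnvSp d) (Λ : Finset (Vert d)) (v : EnvSp d → Fin d → ℝ) : ℝ :=
  sInf {r | ∃ h : Vert d → ℝ, (∀ x ∉ Λ, h x = 0) ∧
      r = einner d ω Λ (fun x i => efield d v ω x i - dgradE d h x i)
            (fun x i => efield d v ω x i - dgradE d h x i)}

/-- The gradient `∇h` of a function on `Ω`. -/
def gradOmega (d : ℕ) (h : EnvSp d → ℝ) : EnvSp d → Fin d → ℝ :=
  fun ω i => h (shift d (unitv d i) ω) - h ω

/-- The inner product `⟨u, c w⟩_{L²(P,ℝ^d)}`. -/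
def cinnerP (d : ℕ) (P : Measure (EnvSp d)) (u w : EnvSp d → Fin d → ℝ) : ℝ :=
  ∑ i, ∫ ω', cnd d ω' 0 (unitv d i) * u ω' i * w ω' i ∂P

/-- Bounded vector fields on `Ω`. -/
def IsBddV (d : ℕ) (v : EnvSp d → Fin d → ℝ) : Prop := ∃ M, ∀ ω i, |v ω i| ≤ M

/-- The space `𝒱 = (ℝ^d)^{ℤ^d}` of vector fields on `ℤ^d`. -/
abbrev VS (d : ℕ) := Vert d → Fin d → ℝ

/-- The empirical measures `μ_r^{ω,v}` built from the minimizers `h_r` of the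
finite-volume Dirichlet energies. -/
def muR (d : ℕ) (ω : EnvSp d) (hr : ℕ → Vert d → ℝ) (r : ℕ) :
    Measure (EnvSp d × VS d) :=
  (((box d ((r : ℝ) + Real.sqrt r)).card : ℝ≥0∞) *
      ((box d (Real.sqrt r)).card : ℝ≥0∞))⁻¹ •
    ∑ z ∈ box d (Real.sqrt r), ∑ x ∈ box d ((r : ℝ) + Real.sqrt r),
      Measure.dirac (shift d (x + z) ω, fun y => dgradE d (hr r) (x + z + y))

/-- The localized conductances `c_ω^R`. -/
def cR (d : ℕ) (ω : EnvSp d) (R : ℝ) (e : EdgeIx d) : ℝ :=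
  if e ∈ edgesIn d (box d (2 * R)) then ω.1 e else 1

/-- The localized measure `π_ω^R`. -/
def piRloc (d : ℕ) (ω : EnvSp d) (R : ℝ) (x : Vert d) : ℝ :=
  if x ∈ box d (2 * R) then piOf d ω x
  else if x ∈ box d (4 * R) then 1 + piOf d ω x else 1

/-- The localized Dirichlet form `D_ω^R(f,f)` (each unordered edge counted once). -/
def DR (d : ℕ) (ω : EnvSp d) (R : ℝ) (f : Vert d → ℝ) : ℝ≥0∞ :=
  ∑' e : EdgeIx d, ENNReal.ofReal (cR d ω R e * (f (e.1 + unitv d e.2) - f e.1) ^ 2)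

/-- The norm `‖f‖_{ℓ^s(μ)}`. -/
def lpN (d : ℕ) (μw : Vert d → ℝ) (s : ℝ) (f : Vert d → ℝ) : ℝ≥0∞ :=
  (∑' x : Vert d, ENNReal.ofReal (|f x| ^ s * μw x)) ^ (1 / s)

/-- The exponent `ε = 2(2/d − 1/p − 1/q)((d−2)/d + 1/q)⁻¹`. -/
def epsPQ (d : ℕ) (p q : ℝ) : ℝ :=
  2 * (2 / (d : ℝ) - 1 / p - 1 / q) / (((d : ℝ) - 2) / (d : ℝ) + 1 / q)

/-- Jump rates of the localized constant-speed chain `Y^R`: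
rate `c_ω^R(x,y)/π_ω^R(x)` from `x` to `y`. -/
def rateR (d : ℕ) (ω : EnvSp d) (R : ℝ) (x y : Vert d) : ℝ :=
  (∑ i, ((if y = x + unitv d i then cR d ω R (x, i) else 0) +
         (if x = y + unitv d i then cR d ω R (y, i) else 0))) / piRloc d ω R x

/-- The generator matrix of `Y^R`. -/
def qmatR (d : ℕ) (ω : EnvSp d) (R : ℝ) (x y : Vert d) : ℝ :=
  if x = y then -(∑ z ∈ nbrs d x, rateR d ω R x z) else rateR d ω R x y

/-- Iterates of the generator matrix of `Y^R`. -/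
def qiter (d : ℕ) (ω : EnvSp d) (R : ℝ) : ℕ → Vert d → Vert d → ℝ
  | 0, x, y => if x = y then 1 else 0
  | n+1, x, y => ∑ z ∈ insert x (nbrs d x), qmatR d ω R x z * qiter d ω R n z y

/-- The heat kernel `P_ω^x(Y_t^R = y) = (e^{tQ})(x,y)` of the localized chain `Y^R`. -/
def hkR (d : ℕ) (ω : EnvSp d) (R : ℝ) (t : ℝ) (x y : Vert d) : ℝ :=
  ∑' k : ℕ, t ^ k / (Nat.factorial k : ℝ) * qiter d ω R k x y

section

/-! ### Conductances, the Markov operator and boxes -/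

/-- The sum of `g` over the neighbours of `x`, weighted by the conductances. -/
def csum (d : ℕ) (ω : EnvSp d) (x : Vert d) (g : Vert d → ℝ) : ℝ :=
  ∑ i, (ω.1 (x, i) * g (x + unitv d i) + ω.1 (x - unitv d i, i) * g (x - unitv d i))

/-- The Markov operator of the random walk among the conductances `ω`. -/
def Pop (d : ℕ) (ω : EnvSp d) (g : Vert d → ℝ) (x : Vert d) : ℝ :=
  csum d ω x g / piOf d ω x

variable {d : ℕ}

lemma csum_one (ω : EnvSp d) (x : Vert d) : csum d ω x (fun _ => 1) = piOf d ω x := by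
  simp [csum, piOf]

lemma csum_const (ω : EnvSp d) (x : Vert d) (a : ℝ) :
    csum d ω x (fun _ => a) = piOf d ω x * a := by
  simp [csum, piOf, Finset.sum_mul, add_mul]

lemma csum_mono (ω : EnvSp d) (x : Vert d) {g h : Vert d → ℝ}
    (hgh : ∀ i, g (x + unitv d i) ≤ h (x + unitv d i) ∧ g (x - unitv d i) ≤ h (x - unitv d i)) :
    csum d ω x g ≤ csum d ω x h := by
  unfold csum
  refine Finset.sum_le_sum fun i _ => add_le_add ?_ ?_
  · exact mul_le_mul_of_nonneg_left (hgh i).1 (ω.2 _).le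
  · exact mul_le_mul_of_nonneg_left (hgh i).2 (ω.2 _).le

lemma csum_add (ω : EnvSp d) (x : Vert d) (g h : Vert d → ℝ) :
    csum d ω x (fun y => g y + h y) = csum d ω x g + csum d ω x h := by
  simp only [csum, ← Finset.sum_add_distrib]
  exact Finset.sum_congr rfl fun i _ => by ring

lemma csum_sub (ω : EnvSp d) (x : Vert d) (g h : Vert d → ℝ) :
    csum d ω x (fun y => g y - h y) = csum d ω x g - csum d ω x h := by
  simp only [csum, ← Finset.sum_sub_distrib]
  exact Finset.sum_congr rfl fun i _ => by ring

lemma csum_mul_left (ω : EnvSp d) (x : Vert d) (a : ℝ) (g : Vert d → ℝ) :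
    csum d ω x (fun y => a * g y) = a * csum d ω x g := by
  simp only [csum, Finset.mul_sum]
  exact Finset.sum_congr rfl fun i _ => by ring

lemma piOf_pos (hd : 1 ≤ d) (ω : EnvSp d) (x : Vert d) : 0 < piOf d ω x := by
  unfold piOf
  have : Nonempty (Fin d) := ⟨⟨0, hd⟩⟩
  exact Finset.sum_pos (fun i _ => add_pos (ω.2 _) (ω.2 _)) Finset.univ_nonempty

lemma cond_le_piOf (ω : EnvSp d) (x : Vert d) (i : Fin d) : ω.1 (x, i) ≤ piOf d ω x := by
  unfold piOf
  calc ω.1 (x, i) ≤ ω.1 (x, i) + ω.1 (x - unitv d i, i) := by linarith [ω.2 (x - unitv d i, i)]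
    _ ≤ _ := Finset.single_le_sum (f := fun i => ω.1 (x, i) + ω.1 (x - unitv d i, i))
        (fun j _ => (add_pos (ω.2 _) (ω.2 _)).le) (Finset.mem_univ i)

lemma cnd_nonneg (ω : EnvSp d) (x y : Vert d) : 0 ≤ cnd d ω x y := by
  unfold cnd
  refine Finset.sum_nonneg fun i _ => add_nonneg ?_ ?_ <;> split_ifs
  · exact (ω.2 _).le
  · exact le_rfl
  · exact (ω.2 _).le
  · exact le_rfl

lemma sum_cnd (ω : EnvSp d) (S : Finset (Vert d)) (x : Vert d) (g : Vert d → ℝ)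
    (hS : ∀ i, x + unitv d i ∈ S ∧ x - unitv d i ∈ S) :
    ∑ y ∈ S, cnd d ω x y * g y = csum d ω x g := by
  unfold cnd csum
  simp only [Finset.sum_mul]
  rw [Finset.sum_comm]
  refine Finset.sum_congr rfl fun i _ => ?_
  simp only [add_mul, Finset.sum_add_distrib]
  congr 1
  · simp only [ite_mul, zero_mul]
    rw [Finset.sum_ite_eq' S (x + unitv d i), if_pos (hS i).1]
  · have : ∀ y : Vert d, (x = y + unitv d i) ↔ (y = x - unitv d i) := fun y =>
      ⟨fun h => by rw [h]; abel, fun h => by rw [h]; abel⟩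
    simp only [this, ite_mul, zero_mul]
    rw [Finset.sum_ite_eq' S (x - unitv d i), if_pos (hS i).2]

lemma cnd_eq_zero (ω : EnvSp d) {x y : Vert d}
    (h : ∀ i, y ≠ x + unitv d i ∧ y ≠ x - unitv d i) : cnd d ω x y = 0 := by
  unfold cnd
  refine Finset.sum_eq_zero fun i _ => ?_
  rw [if_neg (h i).1, if_neg, add_zero]
  intro h'
  exact (h i).2 (by rw [h']; abel)

lemma mem_box {n : ℕ} {x : Vert d} : x ∈ box d (n : ℝ) ↔ ∀ i, |x i| ≤ (n : ℤ) := by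
  have : ⌈-(n : ℝ)⌉ = -(n : ℤ) := by rw [Int.ceil_neg, Int.floor_natCast]
  simp only [box, Fintype.mem_piFinset, Finset.mem_Icc, abs_le, this, Int.floor_natCast]

lemma card_box (n : ℕ) : (box d (n : ℝ)).card = (2 * n + 1) ^ d := by
  have : ⌈-(n : ℝ)⌉ = -(n : ℤ) := by rw [Int.ceil_neg, Int.floor_natCast]
  simp only [box, Fintype.card_piFinset, this, Int.floor_natCast, Int.card_Icc, Finset.prod_const,
    Finset.card_univ, Fintype.card_fin]
  congr 1
  omega

lemma card_box_pos (n : ℕ) : 0 < (box d (n : ℝ)).card := by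
  rw [card_box]; positivity

lemma card_box_le {n : ℕ} (hn : 1 ≤ n) : ((box d (n : ℝ)).card : ℝ) ≤ 3 ^ d * (n : ℝ) ^ d := by
  rw [card_box, ← mul_pow]
  push_cast
  have : (1 : ℝ) ≤ n := by exact_mod_cast hn
  gcongr
  linarith

lemma box_mono {m n : ℕ} (h : m ≤ n) : box d (m : ℝ) ⊆ box d (n : ℝ) := by
  intro x hx
  rw [mem_box] at *
  exact fun i => (hx i).trans (by exact_mod_cast h)

lemma abs_unitv_le (i j : Fin d) : |unitv d i j| ≤ 1 := by
  unfold unitv; split_ifs <;> simp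

lemma add_unitv_mem_box {n : ℕ} {x : Vert d} (hx : x ∈ box d (n : ℝ)) (i : Fin d) :
    x + unitv d i ∈ box d ((n + 1 : ℕ) : ℝ) := by
  rw [mem_box] at *
  intro j
  have h1 := hx j
  have h2 := abs_unitv_le i j
  push_cast
  exact (abs_add_le _ _).trans (add_le_add h1 h2)

lemma sub_unitv_mem_box {n : ℕ} {x : Vert d} (hx : x ∈ box d (n : ℝ)) (i : Fin d) :
    x - unitv d i ∈ box d ((n + 1 : ℕ) : ℝ) := by
  rw [mem_box] at *
  intro j
  have h1 := hx j
  have h2 := abs_unitv_le i j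
  push_cast
  exact (abs_sub _ _).trans (add_le_add h1 h2)

lemma zero_mem_box (n : ℕ) : (0 : Vert d) ∈ box d (n : ℝ) := by
  rw [mem_box]; intro i; simp

/-- The sup-norm of a vertex. -/
def supN (d : ℕ) (x : Vert d) : ℕ := Finset.univ.sup fun i => (x i).natAbs

lemma supN_le_iff {x : Vert d} {n : ℕ} : supN d x ≤ n ↔ x ∈ box d (n : ℝ) := by
  rw [mem_box, supN, Finset.sup_le_iff]
  simp only [Finset.mem_univ, true_imp_iff]
  exact forall_congr' fun i => by rw [Int.abs_eq_natAbs]; omega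

lemma supN_add_unitv_le (x : Vert d) (i : Fin d) : supN d (x + unitv d i) ≤ supN d x + 1 :=
  supN_le_iff.2 (add_unitv_mem_box (supN_le_iff.1 le_rfl) i)

lemma supN_sub_unitv_le (x : Vert d) (i : Fin d) : supN d (x - unitv d i) ≤ supN d x + 1 :=
  supN_le_iff.2 (sub_unitv_mem_box (supN_le_iff.1 le_rfl) i)

lemma supN_le_add_unitv (x : Vert d) (i : Fin d) : supN d x ≤ supN d (x + unitv d i) + 1 := by
  simpa using supN_sub_unitv_le (x + unitv d i) i

lemma mem_edgesIn_left {Λ : Finset (Vert d)} {x : Vert d} (hx : x ∈ Λ) (i : Fin d) :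
    (x, i) ∈ edgesIn d Λ := by
  unfold edgesIn
  rw [Finset.mem_biUnion]
  exact ⟨x, hx, by simp⟩

lemma sum_box_edges_le {g : EdgeIx d → ℝ} (hg : ∀ e, 0 ≤ g e) (Λ : Finset (Vert d)) :
    ∑ x ∈ Λ, ∑ i, g (x, i) ≤ ∑ e ∈ edgesIn d Λ, g e := by
  rw [← Finset.sum_product' (f := fun x i => g (x, i))]
  refine Finset.sum_le_sum_of_subset_of_nonneg ?_ fun e _ _ => hg e
  rintro ⟨x, i⟩ h
  exact mem_edgesIn_left (Finset.mem_product.1 h).1 i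

lemma sum_box_edges_sub_le {g : EdgeIx d → ℝ} (hg : ∀ e, 0 ≤ g e) (Λ : Finset (Vert d)) :
    ∑ x ∈ Λ, ∑ i, g (x - unitv d i, i) ≤ ∑ e ∈ edgesIn d Λ, g e := by
  rw [← Finset.sum_product' (f := fun x i => g (x - unitv d i, i))]
  have hinj : Set.InjOn (fun e : Vert d × Fin d => (e.1 - unitv d e.2, e.2))
      (Λ ×ˢ (Finset.univ : Finset (Fin d)) : Finset _) := by
    rintro ⟨x, i⟩ _ ⟨y, j⟩ _ h
    simp only [Prod.mk.injEq] at h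
    obtain ⟨h1, h2⟩ := h
    subst h2
    simpa using h1
  rw [← Finset.sum_image (f := g) hinj]
  refine Finset.sum_le_sum_of_subset_of_nonneg ?_ fun e _ _ => hg e
  intro e he
  obtain ⟨⟨x, i⟩, h, rfl⟩ := Finset.mem_image.1 he
  unfold edgesIn
  rw [Finset.mem_biUnion]
  exact ⟨x, (Finset.mem_product.1 h).1, by simp⟩

/-- Moment bound for `π` along boxes. -/
lemma sum_piOf_rpow_le (ω : EnvSp d) {p : ℝ} (hp : 1 ≤ p) (Λ : Finset (Vert d)) :
    ∑ x ∈ Λ, piOf d ω x ^ p ≤ 2 * (2 * d : ℝ) ^ (p - 1) * ∑ e ∈ edgesIn d Λ, ω.1 e ^ p := by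
  have key : ∀ x, piOf d ω x ^ p ≤
      (2 * d : ℝ) ^ (p - 1) * ∑ i, (ω.1 (x, i) ^ p + ω.1 (x - unitv d i, i) ^ p) := by
    intro x
    have h := Real.rpow_sum_le_const_mul_sum_rpow_of_nonneg
      (s := (Finset.univ : Finset (Fin d ⊕ Fin d)))
      (f := Sum.elim (fun i => ω.1 (x, i)) (fun i => ω.1 (x - unitv d i, i))) (p := p) hp
      (by rintro (i | i) _ <;> exact (ω.2 _).le)
    simp only [Fintype.sum_sum_type, Sum.elim_inl, Sum.elim_inr, Finset.card_univ,
      Fintype.card_sum, Fintype.card_fin] at h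
    unfold piOf
    rw [Finset.sum_add_distrib, Finset.sum_add_distrib]
    refine h.trans (le_of_eq ?_)
    push_cast
    ring_nf
  have hC : (0 : ℝ) ≤ (2 * d : ℝ) ^ (p - 1) := by positivity
  have h0 : ∀ e, 0 ≤ ω.1 e ^ p := fun e => Real.rpow_nonneg (ω.2 e).le _
  calc ∑ x ∈ Λ, piOf d ω x ^ p
      ≤ ∑ x ∈ Λ, (2 * d : ℝ) ^ (p - 1) * ∑ i, (ω.1 (x, i) ^ p + ω.1 (x - unitv d i, i) ^ p) :=
        Finset.sum_le_sum fun x _ => key x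
    _ = (2 * d : ℝ) ^ (p - 1) * (∑ x ∈ Λ, ∑ i, ω.1 (x, i) ^ p +
          ∑ x ∈ Λ, ∑ i, ω.1 (x - unitv d i, i) ^ p) := by
        rw [← Finset.mul_sum, ← Finset.sum_add_distrib]
        simp only [Finset.sum_add_distrib]
    _ ≤ (2 * d : ℝ) ^ (p - 1) * (∑ e ∈ edgesIn d Λ, ω.1 e ^ p +
          ∑ e ∈ edgesIn d Λ, ω.1 e ^ p) := by
        gcongr
        · exact sum_box_edges_le (g := fun e => ω.1 e ^ p) h0 Λ
        · exact sum_box_edges_sub_le (g := fun e => ω.1 e ^ p) h0 Λ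
    _ = _ := by ring

/-- Moment bounds on boxes, in the form used below. -/
def BoxMoments (d : ℕ) (p q : ℝ) (ω : EnvSp d) (C : ℝ) : Prop :=
  0 < C ∧ (∀ n : ℕ, 1 ≤ n → ∑ x ∈ box d (n : ℝ), piOf d ω x ^ p ≤ C * (n : ℝ) ^ d) ∧
  (∀ n : ℕ, 1 ≤ n → ∑ x ∈ box d (n : ℝ), ∑ i, ω.1 (x, i) ^ (-q) ≤ C * (n : ℝ) ^ d)

lemma InOmegaPQ.boxMoments {p q : ℝ} (hp : 1 ≤ p) {ω : EnvSp d} (h : InOmegaPQ d p q ω) :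
    ∃ C, BoxMoments d p q ω C := by
  obtain ⟨⟨C₁, h₁⟩, ⟨C₂, h₂⟩⟩ := h
  refine ⟨2 * (2 * d : ℝ) ^ (p - 1) * |C₁| + |C₂| + 1, by positivity, fun n hn => ?_,
    fun n hn => ?_⟩
  · have hn' : (0 : ℝ) < (n : ℝ) ^ d := by positivity
    have h := h₁ n hn
    rw [div_le_iff₀ hn'] at h
    have hA : (0 : ℝ) ≤ 2 * (2 * d : ℝ) ^ (p - 1) := by positivity
    calc _ ≤ _ := sum_piOf_rpow_le ω hp _
      _ ≤ 2 * (2 * d : ℝ) ^ (p - 1) * (|C₁| * (n : ℝ) ^ d) := by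
        gcongr
        exact h.trans (by gcongr; exact le_abs_self _)
      _ ≤ _ := by
        rw [← mul_assoc]; gcongr
        linarith [abs_nonneg C₂]
  · have hn' : (0 : ℝ) < (n : ℝ) ^ d := by positivity
    have h := h₂ n hn
    rw [div_le_iff₀ hn'] at h
    calc _ ≤ _ := sum_box_edges_le (g := fun e => ω.1 e ^ (-q))
          (fun e => Real.rpow_nonneg (ω.2 e).le _) _
      _ ≤ _ := h
      _ ≤ _ := by
        gcongr
        have : 0 ≤ 2 * (2 * d : ℝ) ^ (p - 1) * |C₁| := by positivity
        linarith [le_abs_self C₂]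

end

section

variable {d : ℕ}

/-! ### Discrete Sobolev inequalities -/

lemma update_add_one (x : Vert d) (i : Fin d) (t : ℤ) :
    Function.update x i (t + 1) = Function.update x i t + unitv d i := by
  funext j
  by_cases h : j = i
  · subst h; simp [unitv]
  · simp [unitv, h]

lemma abs_le_sum_abs_increments {G : ℤ → ℝ} {m : ℤ} (hm : G m = 0) {s : ℤ} (hs : m ≤ s) :
    |G s| ≤ ∑ t ∈ Finset.Ico m s, |G (t + 1) - G t| := by
  induction s, hs using Int.leInduction with
  | base => simp [hm]
  | succ s hs ih =>
    have : Finset.Ico m (s + 1) = insert s (Finset.Ico m s) := by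
      ext t; simp only [Finset.mem_Ico, Finset.mem_insert]; omega
    rw [this, Finset.sum_insert (by simp)]
    calc |G (s + 1)| = |(G (s + 1) - G s) + G s| := by ring_nf
      _ ≤ |G (s + 1) - G s| + |G s| := abs_add_le _ _
      _ ≤ _ := by gcongr

/-- The `ℓ¹` norm of the discrete gradient at a vertex. -/
def gradN (d : ℕ) (F : Vert d → ℝ) (x : Vert d) : ℝ := ∑ i, |F (x + unitv d i) - F x|

lemma gradN_nonneg (F : Vert d → ℝ) (x : Vert d) : 0 ≤ gradN d F x :=
  Finset.sum_nonneg fun _ _ => abs_nonneg _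

lemma gradN_eq_zero {F : Vert d → ℝ} {N : ℕ} (hF : ∀ x ∉ box d (N : ℝ), F x = 0) {x : Vert d}
    (hx : x ∉ box d ((N + 1 : ℕ) : ℝ)) : gradN d F x = 0 := by
  refine Finset.sum_eq_zero fun i _ => ?_
  have h1 : x ∉ box d (N : ℝ) := fun h => hx (box_mono (Nat.le_succ N) h)
  have h2 : x + unitv d i ∉ box d (N : ℝ) := fun h => hx (by
    simpa using sub_unitv_mem_box h i)
  rw [hF _ h1, hF _ h2]; simp

lemma ofReal_abs_le_lintegral_gradN {F : Vert d → ℝ} {N : ℕ}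
    (hF : ∀ x ∉ box d (N : ℝ), F x = 0) (x : Vert d) (i : Fin d) :
    ENNReal.ofReal |F x| ≤
      ∫⁻ t, ENNReal.ofReal (gradN d F (Function.update x i t)) ∂(Measure.count : Measure ℤ) := by
  rw [lintegral_count]
  set m : ℤ := min (x i) (-(N : ℤ) - 1) with hm
  set G : ℤ → ℝ := fun t => F (Function.update x i t) with hG
  have h0 : G m = 0 := by
    apply hF
    rw [mem_box]
    intro h
    have := h i
    simp only [Function.update_self] at this
    rw [abs_le] at this
    omega
  have h1 := abs_le_sum_abs_increments (G := G) h0 (s := x i) (min_le_left _ _)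
  have hx : G (x i) = F x := by simp [hG]
  rw [hx] at h1
  calc ENNReal.ofReal |F x|
      ≤ ENNReal.ofReal (∑ t ∈ Finset.Ico m (x i), |G (t + 1) - G t|) :=
        ENNReal.ofReal_le_ofReal h1
    _ = ∑ t ∈ Finset.Ico m (x i), ENNReal.ofReal |G (t + 1) - G t| :=
        ENNReal.ofReal_sum_of_nonneg fun _ _ => abs_nonneg _
    _ ≤ ∑ t ∈ Finset.Ico m (x i), ENNReal.ofReal (gradN d F (Function.update x i t)) := by
        refine Finset.sum_le_sum fun t _ => ENNReal.ofReal_le_ofReal ?_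
        simp only [hG, update_add_one]
        exact Finset.single_le_sum
          (f := fun j => |F (Function.update x i t + unitv d j) - F (Function.update x i t)|)
          (fun _ _ => abs_nonneg _) (Finset.mem_univ i)
    _ ≤ _ := ENNReal.sum_le_tsum _

lemma pi_count_eq_count :
    Measure.pi (fun _ : Fin d => (Measure.count : Measure ℤ)) = Measure.count := by
  refine Measure.ext_of_singleton fun x => ?_
  rw [Measure.pi_singleton]
  simp

lemma tsum_ofReal_eq_sum {g : Vert d → ℝ} (hg : ∀ x, 0 ≤ g x) {S : Finset (Vert d)}
    (hS : ∀ x ∉ S, g x = 0) :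
    ∑' x, ENNReal.ofReal (g x) = ENNReal.ofReal (∑ x ∈ S, g x) := by
  rw [tsum_eq_sum (s := S) (fun x hx => by rw [hS x hx, ENNReal.ofReal_zero]),
    ENNReal.ofReal_sum_of_nonneg fun x _ => hg x]

/-- The Gagliardo–Nirenberg–Sobolev inequality on `ℤ^d`, `d ≥ 2`. -/
lemma sobolev_one (hd : 2 ≤ d) {F : Vert d → ℝ} {N : ℕ}
    (hF : ∀ x ∉ box d (N : ℝ), F x = 0) :
    ∑ x ∈ box d (N : ℝ), |F x| ^ ((d : ℝ) / (d - 1)) ≤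
      (∑ x ∈ box d ((N + 1 : ℕ) : ℝ), gradN d F x) ^ ((d : ℝ) / (d - 1)) := by
  have hd' : (2 : ℝ) ≤ d := by exact_mod_cast hd
  have hd1 : (0 : ℝ) < d - 1 := by linarith
  set P : ℝ := (d : ℝ) / (d - 1) with hP
  have hP0 : 0 < P := by positivity
  have hconj : Real.HolderConjugate (Fintype.card (Fin d)) P := by
    rw [Fintype.card_fin]
    exact Real.HolderConjugate.conjExponent (by linarith)
  have key := lintegral_prod_lintegral_pow_le (μ := fun _ : Fin d => (Measure.count : Measure ℤ))
    hconj (f := fun x => ENNReal.ofReal (gradN d F x)) (measurable_of_countable _)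
  rw [pi_count_eq_count, lintegral_count, lintegral_count] at key
  rw [tsum_ofReal_eq_sum (gradN_nonneg F) (S := box d ((N + 1 : ℕ) : ℝ))
    (fun x hx => gradN_eq_zero hF hx)] at key
  have hG0 : 0 ≤ ∑ x ∈ box d ((N + 1 : ℕ) : ℝ), gradN d F x :=
    Finset.sum_nonneg fun _ _ => gradN_nonneg F _
  rw [ENNReal.ofReal_rpow_of_nonneg hG0 hP0.le] at key
  have hlow : ∀ x : Vert d, ENNReal.ofReal (|F x| ^ P) ≤
      ∏ i, (∫⁻ t, ENNReal.ofReal (gradN d F (Function.update x i t))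
        ∂(Measure.count : Measure ℤ)) ^ ((1 : ℝ) / ((Fintype.card (Fin d) : ℝ) - 1)) := by
    intro x
    have hpos : (0 : ℝ) ≤ 1 / ((Fintype.card (Fin d) : ℝ) - 1) := by
      rw [Fintype.card_fin]; positivity
    calc ENNReal.ofReal (|F x| ^ P)
        = ∏ _i : Fin d, (ENNReal.ofReal |F x|) ^ ((1 : ℝ) / ((Fintype.card (Fin d) : ℝ) - 1)) := by
          rw [Finset.prod_const, Finset.card_univ, ← ENNReal.rpow_natCast, ← ENNReal.rpow_mul,
            Fintype.card_fin, ENNReal.ofReal_rpow_of_nonneg (abs_nonneg _) (by positivity)]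
          congr 2
          rw [hP]; ring
      _ ≤ _ := Finset.prod_le_prod' fun i _ =>
          ENNReal.rpow_le_rpow (ofReal_abs_le_lintegral_gradN hF x i) hpos
  have h2 := (ENNReal.tsum_le_tsum hlow).trans key
  rw [tsum_ofReal_eq_sum (fun x => by positivity) (S := box d (N : ℝ))
    (fun x hx => by rw [hF x hx, abs_zero, Real.zero_rpow hP0.ne'])] at h2
  exact (ENNReal.ofReal_le_ofReal_iff (by positivity)).1 h2

/-- In dimension one a finitely supported function is bounded by the `ℓ¹` norm of its gradient. -/
lemma abs_le_sum_gradN (hd : d = 1) {F : Vert d → ℝ} {N : ℕ}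
    (hF : ∀ x ∉ box d (N : ℝ), F x = 0) (x : Vert d) :
    |F x| ≤ ∑ x ∈ box d ((N + 1 : ℕ) : ℝ), gradN d F x := by
  subst hd
  have h := ofReal_abs_le_lintegral_gradN hF x 0
  have h3 : ∫⁻ t, ENNReal.ofReal (gradN 1 F (Function.update x 0 t)) ∂(Measure.count : Measure ℤ)
      = ∑' y : Vert 1, ENNReal.ofReal (gradN 1 F y) := by
    rw [lintegral_count]
    refine (Equiv.funUnique (Fin 1) ℤ).symm.tsum_eq
      (fun y : Vert 1 => ENNReal.ofReal (gradN 1 F y)) ▸ ?_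
    refine tsum_congr fun t => ?_
    congr 2
    funext j
    rw [Subsingleton.elim j 0]
    simp
  rw [h3, tsum_ofReal_eq_sum (gradN_nonneg F) (S := box 1 ((N + 1 : ℕ) : ℝ))
    (fun x hx => gradN_eq_zero hF hx)] at h
  exact (ENNReal.ofReal_le_ofReal_iff (Finset.sum_nonneg fun _ _ => gradN_nonneg F _)).1 h

end

section

/-! ### Weighted Sobolev inequality -/

variable {d : ℕ}

/-- Tangent line bound for the convex function `t ↦ t ^ γ`. -/
lemma rpow_sub_rpow_le {a b γ : ℝ} (ha : 0 ≤ a) (hb : 0 ≤ b) (hγ : 1 ≤ γ) :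
    b ^ γ - a ^ γ ≤ γ * b ^ (γ - 1) * (b - a) := by
  rcases hb.eq_or_lt with rfl | hb
  · rcases hγ.eq_or_lt with rfl | hγ'
    · simp
    · rw [Real.zero_rpow (by linarith), Real.zero_rpow (by linarith)]
      have := Real.rpow_nonneg ha γ
      simpa using this
  · have h := one_add_mul_self_le_rpow_one_add (s := a / b - 1) (by
      have : 0 ≤ a / b := by positivity
      linarith) hγ
    rw [add_sub_cancel, Real.div_rpow ha hb.le, le_div_iff₀ (by positivity)] at h
    have e : γ * b ^ (γ - 1) * (b - a) = -(γ * (a / b - 1)) * b ^ γ := by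
      rw [Real.rpow_sub_one hb.ne']; field_simp; ring
    rw [e]; linarith

lemma abs_rpow_sub_rpow_le {a b γ : ℝ} (ha : 0 ≤ a) (hb : 0 ≤ b) (hγ : 1 ≤ γ) :
    |b ^ γ - a ^ γ| ≤ γ * (|b - a| * (a ^ (γ - 1) + b ^ (γ - 1))) := by
  have h1 := rpow_sub_rpow_le ha hb hγ
  have h2 := rpow_sub_rpow_le hb ha hγ
  have hA : 0 ≤ a ^ (γ - 1) := Real.rpow_nonneg ha _
  have hB : 0 ≤ b ^ (γ - 1) := Real.rpow_nonneg hb _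
  have h3 : γ * b ^ (γ - 1) * (b - a) ≤ γ * (|b - a| * (a ^ (γ - 1) + b ^ (γ - 1))) := by
    rw [mul_assoc]
    refine mul_le_mul_of_nonneg_left ?_ (by linarith)
    nlinarith [le_abs_self (b - a), abs_nonneg (b - a), mul_nonneg hA (abs_nonneg (b - a)),
      mul_le_mul_of_nonneg_left (le_abs_self (b - a)) hB]
  have h4 : γ * a ^ (γ - 1) * (a - b) ≤ γ * (|b - a| * (a ^ (γ - 1) + b ^ (γ - 1))) := by
    rw [mul_assoc, abs_sub_comm]
    refine mul_le_mul_of_nonneg_left ?_ (by linarith)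
    nlinarith [le_abs_self (a - b), abs_nonneg (a - b), mul_nonneg hB (abs_nonneg (a - b)),
      mul_le_mul_of_nonneg_left (le_abs_self (a - b)) hA]
  rw [abs_le]; constructor <;> linarith

/-- The Dirichlet energy of `F` over the box `Λ_N`. -/
def energy (d : ℕ) (ω : EnvSp d) (N : ℕ) (F : Vert d → ℝ) : ℝ :=
  ∑ x ∈ box d (N : ℝ), ∑ i, ω.1 (x, i) * (F (x + unitv d i) - F x) ^ 2

lemma energy_nonneg (ω : EnvSp d) (N : ℕ) (F : Vert d → ℝ) : 0 ≤ energy d ω N F :=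
  Finset.sum_nonneg fun _ _ => Finset.sum_nonneg fun _ _ =>
    mul_nonneg (ω.2 _).le (sq_nonneg _)

/-- Cauchy–Schwarz for gradients against the conductances. -/
lemma sum_grad_mul_sq_le (ω : EnvSp d) (N : ℕ) (F : Vert d → ℝ) (G : Vert d → Fin d → ℝ) :
    (∑ x ∈ box d (N : ℝ), ∑ i, |F (x + unitv d i) - F x| * G x i) ^ 2 ≤
      energy d ω N F * ∑ x ∈ box d (N : ℝ), ∑ i, (ω.1 (x, i))⁻¹ * G x i ^ 2 := by
  unfold energy
  simp only [← Finset.sum_product']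
  refine Finset.sum_sq_le_sum_mul_sum_of_sq_le_mul _ (fun e _ => ?_) (fun e _ => ?_) fun e _ => ?_
  · exact mul_nonneg (ω.2 _).le (sq_nonneg _)
  · exact mul_nonneg (inv_nonneg.2 (ω.2 _).le) (sq_nonneg _)
  · have := (ω.2 (e.1, e.2)).ne'
    refine le_of_eq ?_
    rw [mul_pow, sq_abs]
    field_simp

lemma sum_inv_mul_le {ω : EnvSp d} {p q C : ℝ} (hq : 1 < q) (hC : BoxMoments d p q ω C)
    {N : ℕ} (hN : 1 ≤ N) {h : Vert d → Fin d → ℝ} (hh : ∀ x i, 0 ≤ h x i) :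
    ∑ x ∈ box d (N : ℝ), ∑ i, (ω.1 (x, i))⁻¹ * h x i ≤
      (C * (N : ℝ) ^ d) ^ (1 / q) *
        (∑ x ∈ box d (N : ℝ), ∑ i, h x i ^ (q / (q - 1))) ^ (1 - 1 / q) := by
  have hc : q.HolderConjugate (q / (q - 1)) := Real.HolderConjugate.conjExponent hq
  have hq' : 1 / (q / (q - 1)) = 1 - 1 / q := by
    have : q ≠ 0 := by linarith
    have : q - 1 ≠ 0 := by linarith
    field_simp
  simp only [← Finset.sum_product']
  have h1 := Real.inner_le_Lp_mul_Lq_of_nonneg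
    (box d (N : ℝ) ×ˢ (Finset.univ : Finset (Fin d))) hc
    (f := fun e => (ω.1 (e.1, e.2))⁻¹) (g := fun e => h e.1 e.2)
    (fun e _ => inv_nonneg.2 (ω.2 _).le) (fun e _ => hh _ _)
  refine h1.trans ?_
  rw [hq']
  have h2 := hC.2.2 N hN
  rw [← Finset.sum_product' (f := fun x i => ω.1 (x, i) ^ (-q))] at h2
  have h3 : 0 ≤ 1 - 1 / q := by
    rw [sub_nonneg, div_le_one (by linarith)]; exact hq.le
  gcongr ?_ * ?_
  · refine Real.rpow_nonneg (Finset.sum_nonneg fun e _ => Real.rpow_nonneg (hh _ _) _) _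
  · refine Real.rpow_le_rpow (Finset.sum_nonneg fun e _ => Real.rpow_nonneg
      (inv_nonneg.2 (ω.2 _).le) _) (le_trans (le_of_eq ?_) h2) (by positivity)
    refine Finset.sum_congr rfl fun e _ => ?_
    rw [Real.rpow_neg (ω.2 _).le, Real.inv_rpow (ω.2 _).le]

lemma sum_box_add_unitv_le {N M : ℕ} {g : Vert d → ℝ} (hg : ∀ x, 0 ≤ g x)
    (h0 : ∀ x ∉ box d (N : ℝ), g x = 0) (i : Fin d) :
    ∑ x ∈ box d (M : ℝ), g (x + unitv d i) ≤ ∑ x ∈ box d (N : ℝ), g x := by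
  classical
  rw [← Finset.sum_image (f := g) (g := fun x => x + unitv d i) (fun x _ y _ h => by simpa using h)]
  rw [← Finset.sum_subset (Finset.inter_subset_left
    (s₂ := box d (N : ℝ))) (fun x hx hx' => h0 x fun h => hx' (Finset.mem_inter.2 ⟨hx, h⟩))]
  exact Finset.sum_le_sum_of_subset_of_nonneg Finset.inter_subset_right fun x _ _ => hg x

lemma sum_box_le_of_support {N M : ℕ} {g : Vert d → ℝ} (hg : ∀ x, 0 ≤ g x)
    (h0 : ∀ x ∉ box d (N : ℝ), g x = 0) :
    ∑ x ∈ box d (M : ℝ), g x ≤ ∑ x ∈ box d (N : ℝ), g x := by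
  classical
  rw [← Finset.sum_subset (Finset.inter_subset_left
    (s₂ := box d (N : ℝ))) (fun x hx hx' => h0 x fun h => hx' (Finset.mem_inter.2 ⟨hx, h⟩))]
  exact Finset.sum_le_sum_of_subset_of_nonneg Finset.inter_subset_right fun x _ _ => hg x

/-- The Sobolev inequality on boxes weighted by the conductances, with exponent `ρ` and
constant `K`. -/
def SobolevOn (d : ℕ) (ω : EnvSp d) (ρ K : ℝ) : Prop :=
  ∀ r : ℕ, 1 ≤ r → ∀ F : Vert d → ℝ, (∀ x, 0 ≤ F x) → (∀ x ∉ box d ((2 * r : ℕ) : ℝ), F x = 0) →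
    ((∑ x ∈ box d ((2 * r : ℕ) : ℝ), F x ^ ρ) / (r : ℝ) ^ d) ^ (2 / ρ) ≤
      K * ((r : ℝ) ^ 2 / (r : ℝ) ^ d) * energy d ω (2 * r + 1) F

set_option maxHeartbeats 1000000 in
lemma sobolevOn_of_one_lt (hd : 2 ≤ d) {ω : EnvSp d} {p q C ρ : ℝ} (hq : 1 < q)
    (hρ : 1 / ρ = 1 / 2 - 1 / d + 1 / (2 * q)) (hρ0 : 0 < ρ) (hC : BoxMoments d p q ω C) :
    ∃ K, 0 < K ∧ SobolevOn d ω ρ K := by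
  have hd' : (2 : ℝ) ≤ d := by exact_mod_cast hd
  have hd1 : (0 : ℝ) < d - 1 := by linarith
  have hq0 : (0 : ℝ) < q := by linarith
  have hC0 := hC.1
  set P : ℝ := (d : ℝ) / (d - 1) with hP
  set γ : ℝ := ρ * (1 - 1 / d) with hγ
  have hd0 : (0 : ℝ) < 1 - 1 / d := by
    rw [sub_pos, div_lt_one (by linarith)]; linarith
  have hγP : γ * P = ρ := by rw [hγ, hP]; field_simp
  have hγ1 : 1 ≤ γ := by
    have : 1 / ρ ≤ 1 - 1 / d := by
      rw [hρ]
      have : 1 / (2 * q) ≤ 1 / 2 := by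
        apply one_div_le_one_div_of_le <;> linarith
      linarith
    rw [div_le_iff₀ hρ0] at this
    rw [hγ]; linarith
  have hinvq : 0 < 1 - 1 / q := by
    rw [sub_pos, div_lt_one (by linarith)]; linarith
  have hexp : (2 * (γ - 1)) * (q / (q - 1)) = ρ := by
    have h1 : 2 * (γ - 1) = ρ * (1 - 1 / q) := by
      have h2 : ρ * (1 / ρ) = 1 := by field_simp
      rw [hρ] at h2
      have h3 : 1 / (2 * q) = 1 / q / 2 := by field_simp
      rw [h3] at h2
      rw [hγ]; linarith
    rw [h1]
    have : q - 1 ≠ 0 := by linarith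
    field_simp
  set A : ℝ := 4 * γ ^ 2 * (C * 3 ^ d) ^ (1 / q) * (d : ℝ) ^ (1 - 1 / q) with hA
  have hA0 : 0 < A := by positivity
  refine ⟨A, hA0, fun r hr F hF0 hF => ?_⟩
  have hr0 : (0 : ℝ) < r := by exact_mod_cast hr
  set N := 2 * r with hN
  set T : ℝ := ∑ x ∈ box d (N : ℝ), F x ^ ρ with hT
  have hFρ : ∀ x, 0 ≤ F x ^ ρ := fun x => Real.rpow_nonneg (hF0 x) _
  have hFρ0 : ∀ x ∉ box d (N : ℝ), F x ^ ρ = 0 := fun x hx => by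
    rw [hF x hx, Real.zero_rpow hρ0.ne']
  have hT0 : 0 ≤ T := Finset.sum_nonneg fun x _ => hFρ x
  set E : ℝ := energy d ω (N + 1) F with hE
  have hE0 : 0 ≤ E := energy_nonneg _ _ _
  rcases hT0.eq_or_lt with hT0' | hTpos
  · rw [← hT0', zero_div, Real.zero_rpow (by positivity)]
    positivity
  have hsob := sobolev_one hd (F := fun x => F x ^ γ) (N := N)
    (fun x hx => by simp only [hF x hx]; exact Real.zero_rpow (by linarith))
  have hlhs : ∑ x ∈ box d (N : ℝ), |F x ^ γ| ^ P = T := by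
    refine Finset.sum_congr rfl fun x _ => ?_
    rw [abs_of_nonneg (Real.rpow_nonneg (hF0 x) _), ← Real.rpow_mul (hF0 x), hγP]
  rw [← hP] at hsob
  rw [hlhs] at hsob
  set G : ℝ := ∑ x ∈ box d ((N + 1 : ℕ) : ℝ), gradN d (fun x => F x ^ γ) x with hG
  have hG0 : 0 ≤ G := Finset.sum_nonneg fun x _ => gradN_nonneg _ _
  set W : ℝ := ∑ x ∈ box d ((N + 1 : ℕ) : ℝ), ∑ i, |F (x + unitv d i) - F x| *
    (F x ^ (γ - 1) + F (x + unitv d i) ^ (γ - 1)) with hW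
  have hGW : G ≤ γ * W := by
    rw [hG, hW, Finset.mul_sum]
    refine Finset.sum_le_sum fun x _ => ?_
    rw [gradN, Finset.mul_sum]
    exact Finset.sum_le_sum fun i _ => abs_rpow_sub_rpow_le (hF0 _) (hF0 _) hγ1
  have hW2 := sum_grad_mul_sq_le ω (N + 1) F
    (fun x i => F x ^ (γ - 1) + F (x + unitv d i) ^ (γ - 1))
  rw [← hW, ← hE] at hW2
  set X : ℝ := (C * ((N + 1 : ℕ) : ℝ) ^ d) ^ (1 / q) * ((d : ℝ) * T) ^ (1 - 1 / q) with hX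
  have hpow : ∀ t : ℝ, 0 ≤ t → (t ^ (γ - 1)) ^ 2 = t ^ (2 * (γ - 1)) := fun t ht => by
    rw [← Real.rpow_natCast, ← Real.rpow_mul ht]; congr 1; push_cast; ring
  have hpow2 : ∀ t : ℝ, 0 ≤ t → (t ^ (2 * (γ - 1))) ^ (q / (q - 1)) = t ^ ρ := fun t ht => by
    rw [← Real.rpow_mul ht, hexp]
  have hI1 : ∑ x ∈ box d ((N + 1 : ℕ) : ℝ), ∑ i, (ω.1 (x, i))⁻¹ * F x ^ (2 * (γ - 1)) ≤ X := by
    refine (sum_inv_mul_le hq hC (by omega) (h := fun x _ => F x ^ (2 * (γ - 1)))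
      (fun x i => Real.rpow_nonneg (hF0 x) _)).trans ?_
    rw [hX]
    refine mul_le_mul_of_nonneg_left (Real.rpow_le_rpow (Finset.sum_nonneg fun x _ =>
      Finset.sum_nonneg fun i _ => Real.rpow_nonneg (Real.rpow_nonneg (hF0 _) _) _) ?_ hinvq.le)
      (by positivity)
    simp only [hpow2 _ (hF0 _)]
    simp only [Finset.sum_const, Finset.card_univ, Fintype.card_fin, nsmul_eq_mul,
      ← Finset.mul_sum]
    gcongr
    exact sum_box_le_of_support hFρ hFρ0
  have hI2 : ∑ x ∈ box d ((N + 1 : ℕ) : ℝ), ∑ i,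
      (ω.1 (x, i))⁻¹ * F (x + unitv d i) ^ (2 * (γ - 1)) ≤ X := by
    refine (sum_inv_mul_le hq hC (by omega) (h := fun x i => F (x + unitv d i) ^ (2 * (γ - 1)))
      (fun x i => Real.rpow_nonneg (hF0 _) _)).trans ?_
    rw [hX]
    refine mul_le_mul_of_nonneg_left (Real.rpow_le_rpow (Finset.sum_nonneg fun x _ =>
      Finset.sum_nonneg fun i _ => Real.rpow_nonneg (Real.rpow_nonneg (hF0 _) _) _) ?_ hinvq.le)
      (by positivity)
    simp only [hpow2 _ (hF0 _)]
    rw [Finset.sum_comm]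
    calc _ ≤ ∑ _i : Fin d, T := Finset.sum_le_sum fun i _ =>
          sum_box_add_unitv_le hFρ hFρ0 i
      _ = _ := by simp
  have hsum : ∑ x ∈ box d ((N + 1 : ℕ) : ℝ), ∑ i, (ω.1 (x, i))⁻¹ *
      (F x ^ (γ - 1) + F (x + unitv d i) ^ (γ - 1)) ^ 2 ≤ 4 * X := by
    calc _ ≤ ∑ x ∈ box d ((N + 1 : ℕ) : ℝ), ∑ i, (2 * ((ω.1 (x, i))⁻¹ * F x ^ (2 * (γ - 1))) +
            2 * ((ω.1 (x, i))⁻¹ * F (x + unitv d i) ^ (2 * (γ - 1)))) := by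
          refine Finset.sum_le_sum fun x _ => Finset.sum_le_sum fun i _ => ?_
          have h0 : 0 ≤ (ω.1 (x, i))⁻¹ := inv_nonneg.2 (ω.2 _).le
          rw [← hpow _ (hF0 _), ← hpow _ (hF0 _)]
          nlinarith [mul_nonneg h0 (sq_nonneg (F x ^ (γ - 1) - F (x + unitv d i) ^ (γ - 1)))]
      _ ≤ 4 * X := by
          simp only [Finset.sum_add_distrib, ← Finset.mul_sum] at hI1 hI2 ⊢
          linarith
  have hX0 : 0 ≤ X := by positivity
  have hG2 : G ^ 2 ≤ γ ^ 2 * (E * (4 * X)) := by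
    calc G ^ 2 ≤ (γ * W) ^ 2 := by gcongr
      _ = γ ^ 2 * W ^ 2 := by ring
      _ ≤ _ := by gcongr; exact hW2.trans (by gcongr)
  set R : ℝ := (r : ℝ) ^ d with hR
  have hR0 : 0 < R := by positivity
  have hXle : X ≤ (C * 3 ^ d) ^ (1 / q) * R ^ (1 / q) * ((d : ℝ) ^ (1 - 1 / q) * T ^ (1 - 1 / q)) := by
    rw [hX, ← Real.mul_rpow (by positivity) hR0.le, ← Real.mul_rpow (by positivity) hT0]
    gcongr ?_ ^ _ * _
    rw [hR, mul_assoc, ← mul_pow]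
    gcongr
    rw [hN]; push_cast
    have : (1 : ℝ) ≤ r := by exact_mod_cast hr
    linarith
  have hG3 : G ^ 2 ≤ A * E * R ^ (1 / q) * T ^ (1 - 1 / q) := by
    refine hG2.trans ?_
    calc _ ≤ γ ^ 2 * (E * (4 * ((C * 3 ^ d) ^ (1 / q) * R ^ (1 / q) *
            ((d : ℝ) ^ (1 - 1 / q) * T ^ (1 - 1 / q))))) := by gcongr
      _ = _ := by rw [hA]; ring
  have hT2 : T ^ (2 * (1 - 1 / (d : ℝ))) ≤ G ^ 2 := by
    have : T ^ (2 * (1 - 1 / (d : ℝ))) ≤ (G ^ P) ^ (2 * (1 - 1 / (d : ℝ))) := by gcongr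
    refine this.trans (le_of_eq ?_)
    rw [← Real.rpow_mul hG0, ← Real.rpow_natCast]
    congr 1
    rw [hP]; push_cast; field_simp
  have hT3 : T ^ (2 / ρ) ≤ A * E * R ^ (1 / q) := by
    have h1 := hT2.trans hG3
    have h2 : T ^ (2 / ρ) * T ^ (1 - 1 / q) = T ^ (2 * (1 - 1 / (d : ℝ))) := by
      rw [← Real.rpow_add hTpos]
      congr 1
      rw [show 2 / ρ = 2 * (1 / ρ) by ring, hρ]
      field_simp
      ring
    rw [← h2] at h1
    exact le_of_mul_le_mul_right h1 (by positivity)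
  have hRr : R ^ (1 / q) / R ^ (2 / ρ) = (r : ℝ) ^ 2 / R := by
    rw [← Real.rpow_sub hR0]
    have : 1 / q - 2 / ρ = 2 / d - 1 := by
      rw [show 2 / ρ = 2 * (1 / ρ) by ring, hρ]; field_simp; ring
    rw [this, Real.rpow_sub_one hR0.ne']
    congr 1
    rw [hR, ← Real.rpow_natCast, ← Real.rpow_mul hr0.le, ← Real.rpow_natCast]
    congr 1
    push_cast; field_simp
  rw [Real.div_rpow hT0 hR0.le]
  calc T ^ (2 / ρ) / R ^ (2 / ρ) ≤ A * E * R ^ (1 / q) / R ^ (2 / ρ) := by gcongr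
    _ = A * (R ^ (1 / q) / R ^ (2 / ρ)) * E := by ring
    _ = _ := by rw [hRr]

lemma sobolevOn_one (hd : d = 1) {ω : EnvSp d} {p q C ρ : ℝ} (hq : 1 < q)
    (hρ0 : 0 < ρ) (hC : BoxMoments d p q ω C) :
    ∃ K, 0 < K ∧ SobolevOn d ω ρ K := by
  have hC0 := hC.1
  have hinvq : 0 < 1 - 1 / q := by
    rw [sub_pos, div_lt_one (by linarith)]; linarith
  refine ⟨(5 ^ d) ^ (2 / ρ) * ((C * 3 ^ d) ^ (1 / q) * (9 ^ d : ℝ) ^ (1 - 1 / q)),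
    by positivity, fun r hr F hF0 hF => ?_⟩
  have hr0 : (0 : ℝ) < r := by exact_mod_cast hr
  have hr1 : (1 : ℝ) ≤ r := by exact_mod_cast hr
  set N := 2 * r with hN
  set E : ℝ := energy d ω (N + 1) F with hE
  have hE0 : 0 ≤ E := energy_nonneg _ _ _
  have hN1 : (((N + 1 : ℕ) : ℝ)) ≤ 3 * r := by rw [hN]; push_cast; linarith
  have hinv : ∑ x ∈ box d ((N + 1 : ℕ) : ℝ), ∑ i, (ω.1 (x, i))⁻¹ * (1 : ℝ) ^ 2 ≤
      (C * 3 ^ d) ^ (1 / q) * (9 ^ d : ℝ) ^ (1 - 1 / q) * r := by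
    have h := sum_inv_mul_le hq hC (N := N + 1) (by omega) (h := fun _ _ => (1 : ℝ) ^ 2)
      (fun _ _ => by norm_num)
    refine h.trans ?_
    have e : (r : ℝ) = (r : ℝ) ^ (1 / q) * (r : ℝ) ^ (1 - 1 / q) := by
      rw [← Real.rpow_add hr0]; simp
    calc _ ≤ (C * 3 ^ d * r) ^ (1 / q) * (9 ^ d * r : ℝ) ^ (1 - 1 / q) := by
          have hs0 : (0 : ℝ) ≤ ∑ x ∈ box d ((N + 1 : ℕ) : ℝ), ∑ _i : Fin d,
              ((1 : ℝ) ^ 2) ^ (q / (q - 1)) :=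
            Finset.sum_nonneg fun _ _ => Finset.sum_nonneg fun _ _ =>
              Real.rpow_nonneg (by norm_num) _
          refine mul_le_mul (Real.rpow_le_rpow (by positivity) ?_ (by positivity))
            (Real.rpow_le_rpow hs0 ?_ hinvq.le) (Real.rpow_nonneg hs0 _) (by positivity)
          · rw [mul_assoc]
            gcongr
            calc _ ≤ (3 * r : ℝ) ^ d := by gcongr
              _ = 3 ^ d * r := by subst hd; ring
          · simp only [one_pow, Real.one_rpow, Finset.sum_const, Finset.card_univ,
              Fintype.card_fin, nsmul_eq_mul, mul_one]
            subst hd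
            have := card_box_le (d := 1) (n := N + 1) (by omega)
            simp only [pow_one] at this ⊢
            push_cast at this hN1 ⊢
            linarith
      _ = (C * 3 ^ d) ^ (1 / q) * (9 ^ d : ℝ) ^ (1 - 1 / q) *
          ((r : ℝ) ^ (1 / q) * (r : ℝ) ^ (1 - 1 / q)) := by
          rw [Real.mul_rpow (by positivity) hr0.le, Real.mul_rpow (by positivity) hr0.le]
          ring
      _ = _ := by rw [← e]
  set B : ℝ := (C * 3 ^ d) ^ (1 / q) * (9 ^ d : ℝ) ^ (1 - 1 / q) with hB
  have hB0 : 0 ≤ B := by positivity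
  have hsup : ∀ x, F x ≤ Real.sqrt (E * (B * r)) := by
    intro x
    apply Real.le_sqrt_of_sq_le
    have h1 := abs_le_sum_gradN hd hF x
    rw [abs_of_nonneg (hF0 x)] at h1
    have h2 := sum_grad_mul_sq_le ω (N + 1) F (fun _ _ => 1)
    simp only [mul_one] at h2
    calc F x ^ 2 ≤ _ := pow_le_pow_left₀ (hF0 x) h1 2
      _ ≤ _ := h2
      _ ≤ _ := by
        rw [← hE]; gcongr
  have hS : (∑ x ∈ box d (N : ℝ), F x ^ ρ) / (r : ℝ) ^ d ≤
      5 ^ d * Real.sqrt (E * (B * r)) ^ ρ := by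
    rw [div_le_iff₀ (by positivity)]
    calc _ ≤ ∑ _x ∈ box d (N : ℝ), Real.sqrt (E * (B * r)) ^ ρ :=
          Finset.sum_le_sum fun x _ => Real.rpow_le_rpow (hF0 x) (hsup x) hρ0.le
      _ = ((box d (N : ℝ)).card : ℝ) * Real.sqrt (E * (B * r)) ^ ρ := by simp
      _ ≤ (5 ^ d * (r : ℝ) ^ d) * Real.sqrt (E * (B * r)) ^ ρ := by
          gcongr
          rw [card_box, ← mul_pow]; push_cast
          gcongr
          rw [hN]; push_cast; linarith
      _ = _ := by ring
  calc _ ≤ (5 ^ d * Real.sqrt (E * (B * r)) ^ ρ) ^ (2 / ρ) := by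
        refine Real.rpow_le_rpow ?_ hS (by positivity)
        exact div_nonneg (Finset.sum_nonneg fun x _ => Real.rpow_nonneg (hF0 x) _) (by positivity)
    _ = (5 ^ d) ^ (2 / ρ) * (E * (B * r)) := by
        rw [Real.mul_rpow (by positivity) (by positivity), ← Real.rpow_mul (Real.sqrt_nonneg _)]
        rw [show ρ * (2 / ρ) = (2 : ℕ) by field_simp; norm_num, Real.rpow_natCast,
          Real.sq_sqrt (by positivity)]
    _ = _ := by
        subst hd
        field_simp

/-- Under the integrability condition on `p, q` the weighted Sobolev exponent exceeds
twice the conjugate exponent of `p`. -/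
lemma exists_sobolevOn (hd : 1 ≤ d) {p q : ℝ} (hp : 1 < p) (hq : 1 < q)
    (hpq : 2 ≤ d → 1 / p + 1 / q < 2 / (d : ℝ)) {ω : EnvSp d} {C : ℝ}
    (hC : BoxMoments d p q ω C) :
    ∃ ρ K, 2 * (p / (p - 1)) < ρ ∧ 0 < K ∧ SobolevOn d ω ρ K := by
  have hp' : 0 < p / (p - 1) := div_pos (by linarith) (by linarith)
  rcases (by omega : d = 1 ∨ 2 ≤ d) with h1 | h2
  · obtain ⟨K, hK, hS⟩ := sobolevOn_one h1 hq (ρ := 4 * (p / (p - 1))) (by linarith) hC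
    exact ⟨_, K, by linarith, hK, hS⟩
  · have hd' : (2 : ℝ) ≤ d := by exact_mod_cast h2
    have hpos : 0 < 1 / 2 - 1 / (d : ℝ) + 1 / (2 * q) := by
      have : 1 / (d : ℝ) ≤ 1 / 2 := one_div_le_one_div_of_le (by norm_num) hd'
      have : 0 < 1 / (2 * q) := by positivity
      linarith
    set ρ := 1 / (1 / 2 - 1 / (d : ℝ) + 1 / (2 * q)) with hρ
    obtain ⟨K, hK, hS⟩ := sobolevOn_of_one_lt h2 hq (ρ := ρ) (by rw [hρ, one_div_one_div])
      (by positivity) hC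
    refine ⟨ρ, K, ?_, hK, hS⟩
    rw [hρ, lt_div_iff₀ hpos, ← lt_div_iff₀' (by linarith)]
    have h := hpq h2
    have e1 : 1 / (2 * (p / (p - 1))) = 1 / 2 - 1 / p / 2 := by
      have : p - 1 ≠ 0 := by linarith
      field_simp
    have e2 : 1 / (2 * q) = 1 / q / 2 := by field_simp
    rw [e1, e2]
    have e3 : 2 / (d : ℝ) = 2 * (1 / d) := by ring
    linarith

end

section

/-! ### Energy estimates for subsolutions -/

variable {d : ℕ}

lemma sum_box_eq_of_support {b N : ℕ} (hN : b ≤ N) {g : Vert d → ℝ}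
    (h0 : ∀ x ∉ box d (b : ℝ), g x = 0) :
    ∑ x ∈ box d (N : ℝ), g x = ∑ x ∈ box d (b : ℝ), g x :=
  (Finset.sum_subset (box_mono hN) fun x _ hx => h0 x hx).symm

lemma sum_box_add_unitv_eq {b N : ℕ} (hN : b + 1 ≤ N) {g : Vert d → ℝ}
    (h0 : ∀ x ∉ box d (b : ℝ), g x = 0) (i : Fin d) :
    ∑ x ∈ box d (N : ℝ), g (x + unitv d i) = ∑ x ∈ box d (b : ℝ), g x := by
  classical
  rw [← Finset.sum_image (f := g) (g := fun x => x + unitv d i) (fun x _ y _ h => by simpa using h)]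
  refine (Finset.sum_subset (fun x hx => ?_) fun x _ hx => h0 x hx).symm
  exact Finset.mem_image.2 ⟨x - unitv d i, box_mono hN (sub_unitv_mem_box hx i), by simp⟩

/-- Rewriting a sum over vertices and neighbours as a sum over edges. -/
lemma sum_mul_csum (ω : EnvSp d) {b N : ℕ} (hN : b + 1 ≤ N) {g : Vert d → ℝ} (h : Vert d → ℝ)
    (h0 : ∀ x ∉ box d (b : ℝ), g x = 0) :
    ∑ x ∈ box d (b : ℝ), g x * csum d ω x h =
      ∑ x ∈ box d (N : ℝ), ∑ i,
        ω.1 (x, i) * (g x * h (x + unitv d i) + g (x + unitv d i) * h x) := by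
  simp only [csum, Finset.mul_sum, mul_add]
  rw [Finset.sum_comm, Finset.sum_comm (s := box d (N : ℝ))]
  refine Finset.sum_congr rfl fun i _ => ?_
  rw [Finset.sum_add_distrib, Finset.sum_add_distrib]
  congr 1
  · rw [← sum_box_eq_of_support (show b ≤ N by omega) fun x hx => by rw [h0 x hx, zero_mul]]
    exact Finset.sum_congr rfl fun x _ => by ring
  · rw [← sum_box_add_unitv_eq hN (fun x hx => by rw [h0 x hx, zero_mul]) i]
    refine Finset.sum_congr rfl fun x _ => ?_
    rw [add_sub_cancel_right]; ring

lemma sum_mul_piOf (ω : EnvSp d) {b N : ℕ} (hN : b + 1 ≤ N) {g : Vert d → ℝ}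
    (h0 : ∀ x ∉ box d (b : ℝ), g x = 0) :
    ∑ x ∈ box d (b : ℝ), g x * piOf d ω x =
      ∑ x ∈ box d (N : ℝ), ∑ i, ω.1 (x, i) * (g x + g (x + unitv d i)) := by
  simp only [← csum_one, sum_mul_csum ω hN _ h0, mul_one]

/-- `V` is a nonnegative approximate subsolution: `(1 - P) V ≤ κ V`. -/
def SubSol (d : ℕ) (ω : EnvSp d) (κ : ℝ) (V : Vert d → ℝ) : Prop :=
  (∀ x, 0 ≤ V x) ∧ ∀ x, piOf d ω x * V x - csum d ω x V ≤ κ * (piOf d ω x * V x)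

lemma SubSol.rpow {ω : EnvSp d} {κ : ℝ} {V : Vert d → ℝ} (hV : SubSol d ω κ V) {α : ℝ}
    (hα : 1 ≤ α) : SubSol d ω (α * κ) fun x => V x ^ α := by
  refine ⟨fun x => Real.rpow_nonneg (hV.1 x) _, fun x => ?_⟩
  have hx := hV.1 x
  have hA : 0 ≤ α * V x ^ (α - 1) := mul_nonneg (by linarith) (Real.rpow_nonneg hx _)
  have hVα : V x ^ (α - 1) * V x = V x ^ α := by
    rcases hx.eq_or_lt with h | h
    · rw [← h, mul_zero, Real.zero_rpow (by linarith)]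
    · rw [Real.rpow_sub_one h.ne']; field_simp
  calc piOf d ω x * V x ^ α - csum d ω x (fun x => V x ^ α)
      = csum d ω x fun y => V x ^ α - V y ^ α := by rw [csum_sub, csum_const]
    _ ≤ csum d ω x fun y => α * V x ^ (α - 1) * (V x - V y) :=
        csum_mono ω x fun i => ⟨rpow_sub_rpow_le (hV.1 _) hx hα, rpow_sub_rpow_le (hV.1 _) hx hα⟩
    _ = α * V x ^ (α - 1) * (piOf d ω x * V x - csum d ω x V) := by
        rw [csum_mul_left, csum_sub, csum_const]
    _ ≤ α * V x ^ (α - 1) * (κ * (piOf d ω x * V x)) := by gcongr; exact hV.2 x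
    _ = α * κ * (piOf d ω x * (V x ^ (α - 1) * V x)) := by ring
    _ = _ := by rw [hVα]

/-- Caccioppoli's inequality for approximate subsolutions. -/
lemma SubSol.energy_le {ω : EnvSp d} {κ h : ℝ} {U : Vert d → ℝ} (hU : SubSol d ω κ U)
    (hκ : 0 ≤ κ) {b N : ℕ} (hN : b + 2 ≤ N) {η : Vert d → ℝ} (hη : ∀ x, 0 ≤ η x ∧ η x ≤ 1)
    (hη0 : ∀ x ∉ box d (b : ℝ), η x = 0) (hηh : ∀ x i, |η (x + unitv d i) - η x| ≤ h)
    (hd : 1 ≤ d) :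
    energy d ω N (fun x => η x * U x) ≤
      (κ + h ^ 2) * ∑ x ∈ box d ((b + 1 : ℕ) : ℝ), piOf d ω x * U x ^ 2 := by
  classical
  set S : ℝ := ∑ x ∈ box d ((b + 1 : ℕ) : ℝ), piOf d ω x * U x ^ 2 with hS
  set T : Vert d → ℝ := fun x => if x ∈ box d ((b + 1 : ℕ) : ℝ) then U x ^ 2 else 0 with hT
  have hT0 : ∀ x ∉ box d ((b + 1 : ℕ) : ℝ), T x = 0 := fun x hx => if_neg hx
  have hTn : ∀ x, 0 ≤ T x := fun x => by
    simp only [hT]; split_ifs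
    · positivity
    · exact le_rfl
  set g : Vert d → ℝ := fun x => η x ^ 2 * U x with hg
  have hg0 : ∀ x ∉ box d (b : ℝ), g x = 0 := fun x hx => by simp [hg, hη0 x hx]
  have hgU0 : ∀ x ∉ box d (b : ℝ), g x * U x = 0 := fun x hx => by rw [hg0 x hx, zero_mul]
  have hparts : ∑ x ∈ box d (N : ℝ), ∑ i, ω.1 (x, i) *
      ((U (x + unitv d i) - U x) * (g (x + unitv d i) - g x)) =
      ∑ x ∈ box d (b : ℝ), g x * (piOf d ω x * U x - csum d ω x U) := by
    have h1 := sum_mul_csum ω (show b + 1 ≤ N by omega) U hg0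
    have h2 := sum_mul_piOf ω (show b + 1 ≤ N by omega) hgU0
    have h3 : ∑ x ∈ box d (b : ℝ), g x * (piOf d ω x * U x - csum d ω x U) =
        ∑ x ∈ box d (b : ℝ), g x * U x * piOf d ω x -
          ∑ x ∈ box d (b : ℝ), g x * csum d ω x U := by
      rw [← Finset.sum_sub_distrib]; exact Finset.sum_congr rfl fun x _ => by ring
    rw [h3, h1, h2, ← Finset.sum_sub_distrib]
    refine Finset.sum_congr rfl fun x _ => ?_
    rw [← Finset.sum_sub_distrib]
    exact Finset.sum_congr rfl fun i _ => by ring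
  have hfirst : ∑ x ∈ box d (b : ℝ), g x * (piOf d ω x * U x - csum d ω x U) ≤ κ * S := by
    rw [hS, Finset.mul_sum]
    calc _ ≤ ∑ x ∈ box d (b : ℝ), κ * (piOf d ω x * U x ^ 2) := by
          refine Finset.sum_le_sum fun x _ => ?_
          have hg1 : 0 ≤ g x := mul_nonneg (sq_nonneg _) (hU.1 x)
          have hg2 : g x ≤ U x := by
            have := mul_le_mul_of_nonneg_right (pow_le_one₀ (n := 2) (hη x).1 (hη x).2) (hU.1 x)
            simpa [hg] using this
          have hp := (piOf_pos hd ω x).le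
          calc _ ≤ g x * (κ * (piOf d ω x * U x)) := by gcongr; exact hU.2 x
            _ ≤ U x * (κ * (piOf d ω x * U x)) :=
              mul_le_mul_of_nonneg_right hg2 (mul_nonneg hκ (mul_nonneg hp (hU.1 x)))
            _ = _ := by ring
      _ ≤ _ := Finset.sum_le_sum_of_subset_of_nonneg (box_mono (by omega)) fun x _ _ =>
          mul_nonneg hκ (mul_nonneg (piOf_pos hd ω x).le (sq_nonneg _))
  have hsecond : ∑ x ∈ box d (N : ℝ), ∑ i, ω.1 (x, i) * (T x + T (x + unitv d i)) = S := by
    rw [← sum_mul_piOf ω (show b + 1 + 1 ≤ N by omega) hT0]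
    exact Finset.sum_congr rfl fun x hx => by simp only [hT, if_pos hx]; ring
  have hpt : ∀ x i, ω.1 (x, i) * (η (x + unitv d i) * U (x + unitv d i) - η x * U x) ^ 2 ≤
      ω.1 (x, i) * ((U (x + unitv d i) - U x) * (g (x + unitv d i) - g x)) +
        h ^ 2 * (ω.1 (x, i) * (T x + T (x + unitv d i))) := by
    intro x i
    set y := x + unitv d i with hy
    have hc := (ω.2 (x, i)).le
    have key : (η y - η x) ^ 2 * (U x * U y) ≤ h ^ 2 * (T x + T y) := by
      by_cases hbox : x ∈ box d (b : ℝ) ∨ y ∈ box d (b : ℝ)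
      · have hx : x ∈ box d ((b + 1 : ℕ) : ℝ) := by
          rcases hbox with h' | h'
          · exact box_mono (by omega) h'
          · simpa [hy] using sub_unitv_mem_box h' i
        have hy' : y ∈ box d ((b + 1 : ℕ) : ℝ) := by
          rcases hbox with h' | h'
          · exact add_unitv_mem_box h' i
          · exact box_mono (by omega) h'
        simp only [hT, if_pos hx, if_pos hy']
        have h1 : (η y - η x) ^ 2 ≤ h ^ 2 := by
          rw [← sq_abs]; exact pow_le_pow_left₀ (abs_nonneg _) (hηh x i) 2
        have h2 : U x * U y ≤ U x ^ 2 + U y ^ 2 := by nlinarith [sq_nonneg (U x - U y)]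
        exact mul_le_mul h1 h2 (mul_nonneg (hU.1 _) (hU.1 _)) (sq_nonneg _)
      · push Not at hbox
        rw [hη0 x hbox.1, hη0 y hbox.2]
        have := mul_nonneg (sq_nonneg h) (add_nonneg (hTn x) (hTn y))
        simpa using this
    have := mul_le_mul_of_nonneg_left key hc
    simp only [hg]
    nlinarith
  calc energy d ω N (fun x => η x * U x)
      ≤ ∑ x ∈ box d (N : ℝ), ∑ i,
        (ω.1 (x, i) * ((U (x + unitv d i) - U x) * (g (x + unitv d i) - g x)) +
          h ^ 2 * (ω.1 (x, i) * (T x + T (x + unitv d i)))) :=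
        Finset.sum_le_sum fun x _ => Finset.sum_le_sum fun i _ => hpt x i
    _ ≤ (κ + h ^ 2) * S := by
        simp only [Finset.sum_add_distrib, ← Finset.mul_sum]
        rw [hparts, hsecond, add_mul]
        exact add_le_add hfirst le_rfl

lemma box_average_piOf_mul_le {ω : EnvSp d} {p q C : ℝ} (hd : 1 ≤ d) (hp : 1 < p)
    (hC : BoxMoments d p q ω C) {r b : ℕ} (hr : 1 ≤ r) (hb : b ≤ 2 * r) {g : Vert d → ℝ}
    (hg : ∀ x, 0 ≤ g x) :
    (∑ x ∈ box d (b : ℝ), piOf d ω x * g x) / (r : ℝ) ^ d ≤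
      (C * 2 ^ d) ^ (1 / p) *
        ((∑ x ∈ box d (b : ℝ), g x ^ (p / (p - 1))) / (r : ℝ) ^ d) ^ (1 - 1 / p) := by
  have hc : p.HolderConjugate (p / (p - 1)) := Real.HolderConjugate.conjExponent hp
  have hp' : 1 / (p / (p - 1)) = 1 - 1 / p := by
    have : p ≠ 0 := by linarith
    have : p - 1 ≠ 0 := by linarith
    field_simp
  have hr0 : (0 : ℝ) < r := by exact_mod_cast hr
  have hC0 := hC.1
  have h1 := Real.inner_le_Lp_mul_Lq_of_nonneg (box d (b : ℝ)) hc
    (f := piOf d ω) (g := g) (fun x _ => (piOf_pos hd ω x).le) (fun x _ => hg x)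
  rw [hp'] at h1
  have h2 : ∑ x ∈ box d (b : ℝ), piOf d ω x ^ p ≤ C * 2 ^ d * (r : ℝ) ^ d := by
    calc _ ≤ ∑ x ∈ box d ((2 * r : ℕ) : ℝ), piOf d ω x ^ p :=
          Finset.sum_le_sum_of_subset_of_nonneg (box_mono hb) fun x _ _ =>
            Real.rpow_nonneg (piOf_pos hd ω x).le _
      _ ≤ _ := hC.2.1 (2 * r) (by omega)
      _ = _ := by push_cast; rw [mul_pow]; ring
  have hs : 0 ≤ ∑ x ∈ box d (b : ℝ), g x ^ (p / (p - 1)) :=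
    Finset.sum_nonneg fun x _ => Real.rpow_nonneg (hg x) _
  have hs1 : 0 ≤ ∑ x ∈ box d (b : ℝ), piOf d ω x ^ p :=
    Finset.sum_nonneg fun x _ => Real.rpow_nonneg (piOf_pos hd ω x).le _
  set R : ℝ := (r : ℝ) ^ d with hR
  have hR0 : 0 < R := by positivity
  have hRR : R = R ^ (1 / p) * R ^ (1 - 1 / p) := by rw [← Real.rpow_add hR0]; simp
  rw [Real.div_rpow hs hR0.le, div_le_iff₀ hR0]
  calc _ ≤ _ := h1
    _ ≤ (C * 2 ^ d * R) ^ (1 / p) *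
        (∑ x ∈ box d (b : ℝ), g x ^ (p / (p - 1))) ^ (1 - 1 / p) := by
        refine mul_le_mul_of_nonneg_right (Real.rpow_le_rpow hs1 h2 (by positivity))
          (Real.rpow_nonneg hs _)
    _ = (C * 2 ^ d) ^ (1 / p) * ((∑ x ∈ box d (b : ℝ), g x ^ (p / (p - 1))) ^ (1 - 1 / p) /
          R ^ (1 - 1 / p)) * (R ^ (1 / p) * R ^ (1 - 1 / p)) := by
        rw [Real.mul_rpow (by positivity) hR0.le]
        have : R ^ (1 - 1 / p) ≠ 0 := (Real.rpow_pos_of_pos hR0 _).ne'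
        field_simp
    _ = _ := by rw [← hRR]

end

section

/-! ### Moser iteration -/

variable {d : ℕ}

/-- A cutoff function equal to `1` on `Λ_a` and vanishing off `Λ_{b-1}`. -/
lemma exists_cutoff {a b : ℕ} (hab : a < b) :
    ∃ η : Vert d → ℝ, (∀ x, 0 ≤ η x ∧ η x ≤ 1) ∧ (∀ x ∈ box d (a : ℝ), η x = 1) ∧
      (∀ x ∉ box d ((b - 1 : ℕ) : ℝ), η x = 0) ∧
      ∀ x i, |η (x + unitv d i) - η x| ≤ 1 / ((b : ℝ) - a) := by
  have hab' : (0 : ℝ) < (b : ℝ) - a := by rw [sub_pos]; exact_mod_cast hab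
  refine ⟨fun x => max 0 (min 1 (((b : ℝ) - supN d x) / (b - a))), fun x => ⟨le_max_left _ _,
    max_le zero_le_one (min_le_left _ _)⟩, fun x hx => ?_, fun x hx => ?_, fun x i => ?_⟩
  · have h : (supN d x : ℝ) ≤ a := by exact_mod_cast supN_le_iff.2 hx
    beta_reduce
    rw [min_eq_left ((one_le_div hab').2 (by linarith)), max_eq_right zero_le_one]
  · have h : (b : ℝ) ≤ supN d x := by
      rw [← supN_le_iff] at hx; exact_mod_cast (by omega : b ≤ supN d x)
    exact max_eq_left ((min_le_right _ _).trans (div_nonpos_of_nonpos_of_nonneg (by linarith)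
      hab'.le))
  · refine (abs_max_sub_max_le_max _ _ _ _).trans ?_
    rw [sub_self, abs_zero, max_eq_right (abs_nonneg _)]
    refine (abs_min_sub_min_le_max _ _ _ _).trans ?_
    rw [sub_self, abs_zero, max_eq_right (abs_nonneg _), ← sub_div, abs_div, abs_of_pos hab']
    gcongr
    have h1 : (supN d (x + unitv d i) : ℝ) ≤ supN d x + 1 := by
      exact_mod_cast supN_add_unitv_le x i
    have h2 : (supN d x : ℝ) ≤ supN d (x + unitv d i) + 1 := by
      exact_mod_cast supN_le_add_unitv x i
    rw [abs_le]; constructor <;> linarith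

/-- One step of the Moser iteration. -/
lemma SubSol.moser_step (hd : 1 ≤ d) {ω : EnvSp d} {p q C ρ K κ : ℝ} (hp : 1 < p)
    (hC : BoxMoments d p q ω C) (hρ : 0 < ρ) (hK : 0 < K) (hS : SobolevOn d ω ρ K)
    {r a b : ℕ} (hr : 1 ≤ r) (hab : a < b) (hb : b ≤ 2 * r) {U : Vert d → ℝ}
    (hU : SubSol d ω κ U) (hκ : 0 ≤ κ) :
    ((∑ x ∈ box d (a : ℝ), U x ^ ρ) / (r : ℝ) ^ d) ^ (2 / ρ) ≤
      K * (C * 2 ^ d) ^ (1 / p) * ((r : ℝ) ^ 2 * (κ + (1 / ((b : ℝ) - a)) ^ 2)) *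
        ((∑ x ∈ box d (b : ℝ), U x ^ (2 * (p / (p - 1)))) / (r : ℝ) ^ d) ^ (1 - 1 / p) := by
  obtain ⟨η, hη, hη1, hη0, hηh⟩ := exists_cutoff (d := d) hab
  have hr0 : (0 : ℝ) < r := by exact_mod_cast hr
  have hb1 : b - 1 + 1 = b := by omega
  have hE := hU.energy_le hκ (N := 2 * r + 1) (by omega) hη hη0 hηh hd
  rw [hb1] at hE
  have hF0 : ∀ x, 0 ≤ η x * U x := fun x => mul_nonneg (hη x).1 (hU.1 x)
  have hsob := hS r hr (fun x => η x * U x) hF0 (fun x hx => by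
    rw [hη0 x fun h => hx (box_mono (by omega) h), zero_mul])
  have hav := box_average_piOf_mul_le hd hp hC hr hb (g := fun x => U x ^ 2)
    (fun x => sq_nonneg _)
  have hpow : ∀ x, (U x ^ 2) ^ (p / (p - 1)) = U x ^ (2 * (p / (p - 1))) := fun x => by
    rw [← Real.rpow_natCast, ← Real.rpow_mul (hU.1 x)]; norm_num
  simp only [hpow] at hav
  calc _ ≤ ((∑ x ∈ box d ((2 * r : ℕ) : ℝ), (η x * U x) ^ ρ) / (r : ℝ) ^ d) ^ (2 / ρ) := by
        refine Real.rpow_le_rpow (div_nonneg (Finset.sum_nonneg fun x _ =>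
          Real.rpow_nonneg (hU.1 x) _) (by positivity)) ?_ (by positivity)
        gcongr ?_ / _
        calc _ = ∑ x ∈ box d (a : ℝ), (η x * U x) ^ ρ :=
              Finset.sum_congr rfl fun x hx => by rw [hη1 x hx, one_mul]
          _ ≤ _ := Finset.sum_le_sum_of_subset_of_nonneg (box_mono (by omega)) fun x _ _ =>
              Real.rpow_nonneg (hF0 x) _
    _ ≤ _ := hsob
    _ ≤ K * ((r : ℝ) ^ 2 / (r : ℝ) ^ d) * ((κ + (1 / ((b : ℝ) - a)) ^ 2) *
          ∑ x ∈ box d (b : ℝ), piOf d ω x * U x ^ 2) := by gcongr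
    _ = K * ((r : ℝ) ^ 2 * (κ + (1 / ((b : ℝ) - a)) ^ 2)) *
          ((∑ x ∈ box d (b : ℝ), piOf d ω x * U x ^ 2) / (r : ℝ) ^ d) := by ring
    _ ≤ _ := mul_le_mul_of_nonneg_left hav (by positivity)
    _ = _ := by ring

/-- Local maximum principle for approximate subsolutions at dyadic scales. -/
lemma exists_moser_bound (hd : 1 ≤ d) {p q : ℝ} (hp : 1 < p) (hq : 1 < q)
    (hpq : 2 ≤ d → 1 / p + 1 / q < 2 / (d : ℝ)) {ω : EnvSp d} {C : ℝ}
    (hC : BoxMoments d p q ω C) :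
    ∃ L, 0 < L ∧ ∀ (k : ℕ) (V : Vert d → ℝ), SubSol d ω (2 / ((4 ^ k : ℕ) : ℝ) ^ 2) V →
      V 0 ≤ L * ((∑ x ∈ box d ((2 * 4 ^ k : ℕ) : ℝ), V x ^ (2 * (p / (p - 1)))) /
        ((4 ^ k : ℕ) : ℝ) ^ d) ^ (1 / (2 * (p / (p - 1)))) := by
  obtain ⟨ρ, K, hρs, hK, hS⟩ := exists_sobolevOn hd hp hq hpq hC
  have hC0 := hC.1
  set s : ℝ := 2 * (p / (p - 1)) with hs
  have hs0 : 0 < s := mul_pos two_pos (div_pos (by linarith) (by linarith))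
  have hs' : 1 - 1 / p = 2 / s := by
    have : p ≠ 0 := by linarith
    have : p - 1 ≠ 0 := by linarith
    rw [hs]; field_simp
  have hρ0 : 0 < ρ := hs0.trans hρs
  set χ : ℝ := ρ / s with hχ
  have hχ1 : 1 < χ := (one_lt_div hs0).2 hρs
  have hχ0 : 0 < χ := by linarith
  set D : ℝ := max 1 (K * (C * 2 ^ d) ^ (1 / p) * 6) with hD
  set B : ℝ := 4 + χ with hB
  have hD1 : 1 ≤ D := le_max_left _ _
  have hB1 : 1 ≤ B := by linarith
  have hgeom : Summable fun j : ℕ => (1 / χ) ^ j :=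
    summable_geometric_of_lt_one (by positivity) ((div_lt_one hχ0).2 hχ1)
  have hgeom1 : Summable fun j : ℕ => (j : ℝ) * (1 / χ) ^ j := by
    have := summable_pow_mul_geometric_of_norm_lt_one (R := ℝ) 1 (r := 1 / χ) (by
      rw [Real.norm_of_nonneg (by positivity)]; exact (div_lt_one hχ0).2 hχ1)
    simpa using this
  set u : ℕ → ℝ := fun j => (Real.log D + j * Real.log B) / (2 * χ ^ j) with hu
  have hlD : 0 ≤ Real.log D := Real.log_nonneg hD1
  have hlB : 0 ≤ Real.log B := Real.log_nonneg hB1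
  have hu0 : ∀ j, 0 ≤ u j := fun j => by positivity
  have hus : Summable u := by
    have := (hgeom.mul_left (Real.log D / 2)).add (hgeom1.mul_left (Real.log B / 2))
    refine this.congr fun j => ?_
    simp only [hu, one_div, inv_pow]
    field_simp
  set L1 := Real.exp (∑' j, u j) with hL1
  set L2 := Real.exp (Real.log 4 * d / s * ∑' j : ℕ, (j : ℝ) * (1 / χ) ^ j) with hL2
  refine ⟨L2 * L1, by positivity, fun k V hV => ?_⟩
  set r : ℕ := 4 ^ k with hr
  have hr1 : 1 ≤ r := Nat.one_le_pow _ _ (by norm_num)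
  have hr0 : (0 : ℝ) < r := by exact_mod_cast hr1
  have hrp : (r : ℝ) = 2 ^ (2 * k) := by rw [hr, pow_mul]; norm_num
  set R : ℕ → ℕ := fun j => 2 ^ (2 * k) + 2 ^ (2 * k - j) with hR
  set A : ℕ → ℝ := fun j => (∑ x ∈ box d (R j : ℝ), V x ^ (s * χ ^ j)) / (r : ℝ) ^ d with hA
  set N : ℕ → ℝ := fun j => A j ^ (1 / (s * χ ^ j)) with hN
  have hA0 : ∀ j, 0 ≤ A j := fun j => div_nonneg (Finset.sum_nonneg fun x _ =>
    Real.rpow_nonneg (hV.1 x) _) (by positivity)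
  have hstep : ∀ j < k, N (j + 1) ≤ Real.exp (u j) * N j := by
    intro j hj
    have hα : 1 ≤ χ ^ j := one_le_pow₀ hχ1.le
    have hα0 : 0 < χ ^ j := by positivity
    have hsub : 2 * k - j = (2 * k - (j + 1)) + 1 := by omega
    have hRlt : R (j + 1) < R j := by
      simp only [hR, hsub, pow_succ]
      have : 0 < 2 ^ (2 * k - (j + 1)) := by positivity
      omega
    have hRle : R j ≤ 2 * r := by
      have h1 : (2 : ℕ) ^ (2 * k - j) ≤ 2 ^ (2 * k) := Nat.pow_le_pow_right (by norm_num) (by omega)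
      have h2 : (r : ℕ) = 2 ^ (2 * k) := by rw [hr, pow_mul]; norm_num
      simp only [hR]; omega
    have hRd : (R j : ℝ) - R (j + 1) = 2 ^ (2 * k) / 2 ^ (j + 1) := by
      simp only [hR, hsub, pow_succ]
      push_cast
      have : (2 : ℝ) ^ (2 * k) = 2 ^ (2 * k - (j + 1)) * 2 ^ (j + 1) := by
        rw [← pow_add]; congr 1; omega
      rw [this, pow_succ]; field_simp; ring
    have h := (hV.rpow hα).moser_step hd hp hC hρ0 hK hS hr1 hRlt hRle (by positivity)
    have e1 : ∀ x, (V x ^ χ ^ j) ^ ρ = V x ^ (s * χ ^ (j + 1)) := fun x => by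
      rw [← Real.rpow_mul (hV.1 x)]; congr 1; rw [pow_succ, hχ]; field_simp
    have e2 : ∀ x, (V x ^ χ ^ j) ^ s = V x ^ (s * χ ^ j) := fun x => by
      rw [← Real.rpow_mul (hV.1 x), mul_comm]
    simp only [← hs, e1, e2] at h
    rw [hs', hRd, hrp] at h
    have e3 : ((2 : ℝ) ^ (2 * k)) ^ 2 * (χ ^ j * (2 / (2 ^ (2 * k)) ^ 2) +
        (1 / (2 ^ (2 * k) / 2 ^ (j + 1))) ^ 2) = 2 * χ ^ j + 4 * 4 ^ j := by
      have : (4 : ℝ) ^ j = (2 ^ j) ^ 2 := by rw [← pow_mul, mul_comm, pow_mul]; norm_num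
      rw [this, pow_succ]; field_simp; ring
    rw [e3, ← hrp] at h
    have h6 : 2 * χ ^ j + 4 * 4 ^ j ≤ 6 * B ^ j := by
      have h1 : χ ^ j ≤ B ^ j := pow_le_pow_left₀ hχ0.le (by linarith) j
      have h2 : (4 : ℝ) ^ j ≤ B ^ j := pow_le_pow_left₀ (by norm_num) (by linarith) j
      linarith
    have h7 : A (j + 1) ^ (2 / ρ) ≤ D * B ^ j * A j ^ (2 / s) := by
      refine h.trans (mul_le_mul_of_nonneg_right ?_ (Real.rpow_nonneg (hA0 j) _))
      calc _ ≤ K * (C * 2 ^ d) ^ (1 / p) * (6 * B ^ j) := by gcongr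
        _ = K * (C * 2 ^ d) ^ (1 / p) * 6 * B ^ j := by ring
        _ ≤ _ := by gcongr; exact le_max_right _ _
    have h8 := Real.rpow_le_rpow (Real.rpow_nonneg (hA0 _) _) h7
      (show 0 ≤ 1 / (2 * χ ^ j) by positivity)
    rw [Real.mul_rpow (by positivity) (Real.rpow_nonneg (hA0 j) _), ← Real.rpow_mul (hA0 _),
      ← Real.rpow_mul (hA0 _)] at h8
    have e4 : 2 / ρ * (1 / (2 * χ ^ j)) = 1 / (s * χ ^ (j + 1)) := by
      rw [pow_succ, hχ]; field_simp
    have e5 : 2 / s * (1 / (2 * χ ^ j)) = 1 / (s * χ ^ j) := by field_simp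
    have e6 : (D * B ^ j) ^ (1 / (2 * χ ^ j)) = Real.exp (u j) := by
      rw [Real.rpow_def_of_pos (by positivity), Real.log_mul (by positivity) (by positivity),
        Real.log_pow]
      congr 1
      simp only [hu]; ring
    rw [e4, e5, e6] at h8
    exact h8
  have hiter : ∀ j ≤ k, N j ≤ Real.exp (∑ i ∈ Finset.range j, u i) * N 0 := by
    intro j
    induction j with
    | zero => intro _; simp
    | succ j ih =>
      intro hj
      calc N (j + 1) ≤ Real.exp (u j) * N j := hstep j (by omega)
        _ ≤ Real.exp (u j) * (Real.exp (∑ i ∈ Finset.range j, u i) * N 0) := by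
          gcongr; exact ih (by omega)
        _ = _ := by rw [Finset.sum_range_succ, Real.exp_add]; ring
  have hN0 : 0 ≤ N 0 := Real.rpow_nonneg (hA0 0) _
  have hNk : N k ≤ L1 * N 0 := (hiter k le_rfl).trans (by
    rw [hL1]; gcongr; exact hus.sum_le_tsum _ fun i _ => hu0 i)
  have hχk : 0 < s * χ ^ k := by positivity
  have hlast : V 0 ≤ (r : ℝ) ^ (d / (s * χ ^ k)) * N k := by
    have h1 : V 0 ^ (s * χ ^ k) ≤ (r : ℝ) ^ d * A k := by
      simp only [hA]
      rw [mul_div_cancel₀ _ (by positivity)]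
      exact Finset.single_le_sum (f := fun x => V x ^ (s * χ ^ k))
        (fun x _ => Real.rpow_nonneg (hV.1 x) _) (zero_mem_box _)
    have h2 := Real.rpow_le_rpow (Real.rpow_nonneg (hV.1 0) _) h1
      (show 0 ≤ 1 / (s * χ ^ k) by positivity)
    rw [← Real.rpow_mul (hV.1 0), mul_one_div_cancel hχk.ne', Real.rpow_one,
      Real.mul_rpow (by positivity) (hA0 k), ← Real.rpow_natCast, ← Real.rpow_mul hr0.le,
      mul_one_div] at h2
    exact h2
  have hrL : (r : ℝ) ^ (d / (s * χ ^ k)) ≤ L2 := by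
    rw [Real.rpow_def_of_pos hr0, hL2]
    have e : Real.log r = k * Real.log 4 := by rw [hr]; push_cast; exact Real.log_pow _ _
    rw [e]
    apply Real.exp_le_exp.2
    have h1 : (k : ℝ) * (1 / χ) ^ k ≤ ∑' j : ℕ, (j : ℝ) * (1 / χ) ^ j :=
      hgeom1.le_tsum k fun j _ => by positivity
    calc (k : ℝ) * Real.log 4 * (d / (s * χ ^ k)) =
          Real.log 4 * d / s * (k * (1 / χ) ^ k) := by
          rw [one_div, inv_pow]; field_simp
      _ ≤ _ := by
          have : 0 ≤ Real.log 4 := Real.log_nonneg (by norm_num)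
          gcongr
  have hR0 : R 0 = 2 * 4 ^ k := by
    have h2 : (4 : ℕ) ^ k = 2 ^ (2 * k) := by rw [pow_mul]; norm_num
    simp only [hR]; rw [h2, Nat.sub_zero]; ring
  have hN0' : N 0 = ((∑ x ∈ box d ((2 * r : ℕ) : ℝ), V x ^ s) / (r : ℝ) ^ d) ^ (1 / s) := by
    simp only [hN, hA, hR0, pow_zero, mul_one, ← hr]
  rw [← hN0']
  calc V 0 ≤ _ := hlast
    _ ≤ L2 * (L1 * N 0) := by
      have : 0 ≤ N k := Real.rpow_nonneg (hA0 k) _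
      gcongr
    _ = _ := by ring

end

section

/-! ### The Markov operator and resolvent iterates -/

variable {d : ℕ}

/-- The Markov operator as a linear map. -/
def popL (d : ℕ) (ω : EnvSp d) : (Vert d → ℝ) →ₗ[ℝ] (Vert d → ℝ) where
  toFun := Pop d ω
  map_add' g h := by
    funext x; exact (congrArg (· / _) (csum_add ω x g h)).trans (add_div _ _ _)
  map_smul' a g := by
    funext x; exact (congrArg (· / _) (csum_mul_left ω x a g)).trans (mul_div_assoc _ _ _)

@[simp] lemma popL_apply (ω : EnvSp d) (g : Vert d → ℝ) : popL d ω g = Pop d ω g := rfl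

lemma piOf_mul_Pop (hd : 1 ≤ d) (ω : EnvSp d) (g : Vert d → ℝ) (x : Vert d) :
    piOf d ω x * Pop d ω g x = csum d ω x g :=
  mul_div_cancel₀ _ (piOf_pos hd ω x).ne'

lemma Pop_const (hd : 1 ≤ d) (ω : EnvSp d) (a : ℝ) : Pop d ω (fun _ => a) = fun _ => a := by
  funext x
  rw [Pop, csum_const, mul_div_cancel_left₀ _ (piOf_pos hd ω x).ne']

lemma Pop_mono_at (hd : 1 ≤ d) (ω : EnvSp d) {x : Vert d} {g h : Vert d → ℝ}
    (hgh : ∀ i, g (x + unitv d i) ≤ h (x + unitv d i) ∧ g (x - unitv d i) ≤ h (x - unitv d i)) :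
    Pop d ω g x ≤ Pop d ω h x :=
  div_le_div_of_nonneg_right (csum_mono ω x hgh) (piOf_pos hd ω x).le

lemma Pop_mono (hd : 1 ≤ d) (ω : EnvSp d) {g h : Vert d → ℝ} (hgh : ∀ x, g x ≤ h x) (x : Vert d) :
    Pop d ω g x ≤ Pop d ω h x :=
  Pop_mono_at hd ω fun _ => ⟨hgh _, hgh _⟩

lemma Pop_congr_at (hd : 1 ≤ d) (ω : EnvSp d) {x : Vert d} {g h : Vert d → ℝ}
    (hgh : ∀ i, g (x + unitv d i) = h (x + unitv d i) ∧ g (x - unitv d i) = h (x - unitv d i)) :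
    Pop d ω g x = Pop d ω h x :=
  le_antisymm (Pop_mono_at hd ω fun i => ⟨(hgh i).1.le, (hgh i).2.le⟩)
    (Pop_mono_at hd ω fun i => ⟨(hgh i).1.ge, (hgh i).2.ge⟩)

lemma Pop_nonneg (hd : 1 ≤ d) (ω : EnvSp d) {g : Vert d → ℝ} (hg : ∀ x, 0 ≤ g x) (x : Vert d) :
    0 ≤ Pop d ω g x := by
  have := Pop_mono hd ω hg x
  rwa [Pop_const hd] at this

lemma Pop_le (hd : 1 ≤ d) (ω : EnvSp d) {g : Vert d → ℝ} {M : ℝ} (hg : ∀ x, g x ≤ M)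
    (x : Vert d) : Pop d ω g x ≤ M := by
  have := Pop_mono hd ω hg x
  rwa [Pop_const hd] at this

lemma Pop_eq_zero_of_support (hd : 1 ≤ d) (ω : EnvSp d) {b : ℕ} {g : Vert d → ℝ}
    (hg : ∀ x ∉ box d (b : ℝ), g x = 0) (x : Vert d) (hx : x ∉ box d ((b + 1 : ℕ) : ℝ)) :
    Pop d ω g x = 0 := by
  rw [← congrFun (Pop_const hd ω 0) x]
  refine Pop_congr_at hd ω fun i => ⟨hg _ fun h => hx ?_, hg _ fun h => hx ?_⟩
  · simpa using sub_unitv_mem_box h i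
  · simpa using add_unitv_mem_box h i

lemma iterate_Pop_congr (hd : 1 ≤ d) (ω : EnvSp d) {g h : Vert d → ℝ} (k : ℕ) :
    ∀ b : ℕ, (∀ x ∈ box d ((b + k : ℕ) : ℝ), g x = h x) →
      ∀ x ∈ box d (b : ℝ), (Pop d ω)^[k] g x = (Pop d ω)^[k] h x := by
  induction k with
  | zero => intro b hgh x hx; exact hgh x hx
  | succ k ih =>
    intro b hgh x hx
    rw [Function.iterate_succ_apply', Function.iterate_succ_apply']
    have := ih (b + 1) (fun y hy => hgh y (by rwa [show b + (k + 1) = b + 1 + k by omega]))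
    exact Pop_congr_at hd ω fun i =>
      ⟨this _ (add_unitv_mem_box hx i), this _ (sub_unitv_mem_box hx i)⟩

/-- Exponentially weighted `ℓ²` bound for subsolutions of the resolvent equation. -/
lemma weighted_sum_le (hd : 1 ≤ d) (ω : EnvSp d) {lam t : ℝ} (hl0 : 0 < lam) (hl1 : lam ≤ 1)
    (ht : t ^ 2 ≤ lam / 2) {b : ℕ} {v H : Vert d → ℝ} (hv0 : ∀ x, 0 ≤ v x)
    (hvs : ∀ x ∉ box d (b : ℝ), v x = 0)
    (hv : ∀ x, v x ≤ lam * H x + (1 - lam) * Pop d ω v x) :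
    ∑ x ∈ box d (b : ℝ), piOf d ω x * Real.exp (-t * supN d x) ^ 2 * v x ^ 2 ≤
      4 * ∑ x ∈ box d (b : ℝ), piOf d ω x * Real.exp (-t * supN d x) ^ 2 * H x ^ 2 := by
  set w : Vert d → ℝ := fun x => Real.exp (-t * supN d x) with hw
  have hw0 : ∀ x, 0 < w x := fun x => Real.exp_pos _
  have hww : ∀ x i, w x ^ 2 + w (x + unitv d i) ^ 2 ≤
      (2 + lam) * (w x * w (x + unitv d i)) := by
    intro x i
    set D : ℝ := (supN d (x + unitv d i) : ℝ) - supN d x with hD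
    have hD1 : |D| ≤ 1 := by
      have h1 : (supN d (x + unitv d i) : ℝ) ≤ supN d x + 1 := by
        exact_mod_cast supN_add_unitv_le x i
      have h2 : (supN d x : ℝ) ≤ supN d (x + unitv d i) + 1 := by
        exact_mod_cast supN_le_add_unitv x i
      rw [abs_le]; constructor <;> linarith
    have hy : w (x + unitv d i) = w x * Real.exp (-(t * D)) := by
      simp only [hw]; rw [← Real.exp_add]; congr 1; rw [hD]; ring
    have hDt : (t * D) ^ 2 ≤ lam / 2 := by
      rw [mul_pow]
      have : D ^ 2 ≤ 1 := by rw [← sq_abs]; exact pow_le_one₀ (abs_nonneg _) hD1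
      nlinarith [sq_nonneg t]
    have hcosh : Real.cosh (t * D) ≤ 1 + lam / 2 := by
      refine (Real.cosh_le_exp_half_sq _).trans ?_
      have h0 : 0 ≤ (t * D) ^ 2 / 2 := by positivity
      have := Real.abs_exp_sub_one_le (x := (t * D) ^ 2 / 2) (by
        rw [abs_of_nonneg h0]; linarith)
      rw [abs_of_nonneg h0] at this
      linarith [le_abs_self (Real.exp ((t * D) ^ 2 / 2) - 1)]
    rw [Real.cosh_eq] at hcosh
    have he : Real.exp (t * D) * Real.exp (-(t * D)) = 1 := by rw [← Real.exp_add]; simp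
    set e := Real.exp (-(t * D)) with hee
    have he0 : 0 < e := Real.exp_pos _
    have h3 : 1 + e ^ 2 ≤ (2 + lam) * e := by nlinarith
    rw [hy]
    nlinarith [mul_le_mul_of_nonneg_left h3 (sq_nonneg (w x))]
  set A := ∑ x ∈ box d (b : ℝ), piOf d ω x * w x ^ 2 * v x ^ 2 with hA
  set B := ∑ x ∈ box d (b : ℝ), piOf d ω x * w x ^ 2 * H x ^ 2 with hB
  have hsymm : ∑ x ∈ box d (b : ℝ), w x ^ 2 * v x * csum d ω x v ≤ (1 + lam / 2) * A := by
    rw [sum_mul_csum ω le_rfl (g := fun x => w x ^ 2 * v x) v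
      (fun x hx => by rw [hvs x hx, mul_zero])]
    have hAe : A = ∑ x ∈ box d (b : ℝ), (w x * v x) ^ 2 * piOf d ω x :=
      Finset.sum_congr rfl fun x _ => by ring
    rw [hAe, sum_mul_piOf ω le_rfl (g := fun x => (w x * v x) ^ 2)
      (fun x hx => by rw [hvs x hx]; ring), Finset.mul_sum]
    refine Finset.sum_le_sum fun x _ => ?_
    rw [Finset.mul_sum]
    refine Finset.sum_le_sum fun i _ => ?_
    set y := x + unitv d i
    have h1 := mul_le_mul_of_nonneg_right (hww x i) (mul_nonneg (hv0 x) (hv0 y))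
    have h2 : (w x * w y) * (v x * v y) * 2 ≤ (w x * v x) ^ 2 + (w y * v y) ^ 2 := by
      nlinarith [sq_nonneg (w x * v x - w y * v y)]
    have hc := (ω.2 (x, i)).le
    have h3 : w x ^ 2 * v x * v y + w y ^ 2 * v y * v x ≤
        (1 + lam / 2) * ((w x * v x) ^ 2 + (w y * v y) ^ 2) := by
      have := mul_le_mul_of_nonneg_left h2 (show 0 ≤ 1 + lam / 2 by linarith)
      calc _ = (w x ^ 2 + w y ^ 2) * (v x * v y) := by ring
        _ ≤ _ := h1
        _ = (1 + lam / 2) * (w x * w y * (v x * v y) * 2) := by ring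
        _ ≤ _ := this
    calc _ ≤ ω.1 (x, i) * ((1 + lam / 2) * ((w x * v x) ^ 2 + (w y * v y) ^ 2)) := by gcongr
      _ = _ := by ring
  have hA0 : 0 ≤ A := Finset.sum_nonneg fun x _ =>
    mul_nonneg (mul_nonneg (piOf_pos hd ω x).le (sq_nonneg _)) (sq_nonneg _)
  have hmain : A ≤ lam * (A / 4 + B) + (1 - lam) *
      ∑ x ∈ box d (b : ℝ), w x ^ 2 * v x * csum d ω x v := by
    rw [hA, hB, Finset.sum_div, ← Finset.sum_add_distrib, Finset.mul_sum, Finset.mul_sum,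
      ← Finset.sum_add_distrib]
    refine Finset.sum_le_sum fun x _ => ?_
    have hπ := (piOf_pos hd ω x).le
    have h1 : 0 ≤ piOf d ω x * w x ^ 2 * v x := mul_nonneg (mul_nonneg hπ (sq_nonneg _)) (hv0 x)
    have h2 := mul_le_mul_of_nonneg_left (hv x) h1
    have h3 : v x * H x ≤ v x ^ 2 / 4 + H x ^ 2 := by nlinarith [sq_nonneg (v x / 2 - H x)]
    have h4 := mul_le_mul_of_nonneg_left h3 (mul_nonneg hl0.le (mul_nonneg hπ (sq_nonneg (w x))))
    rw [← piOf_mul_Pop hd]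
    nlinarith
  nlinarith [mul_le_mul_of_nonneg_left hsymm (show 0 ≤ 1 - lam by linarith), sq_nonneg lam,
    mul_nonneg hA0 (sq_nonneg lam)]

/-- The truncated resolvent iteration. -/
def resIter (d : ℕ) (ω : EnvSp d) (lam : ℝ) (H : Vert d → ℝ) : ℕ → Vert d → ℝ
  | 0 => fun _ => 0
  | m + 1 => fun x => lam * H x + (1 - lam) * Pop d ω (resIter d ω lam H m) x

section resIter
variable {ω : EnvSp d} {lam M : ℝ} {H : Vert d → ℝ}

lemma resIter_nonneg (hd : 1 ≤ d) (hl0 : 0 ≤ lam) (hl1 : lam ≤ 1) (hH : ∀ x, 0 ≤ H x) (m : ℕ)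
    (x : Vert d) : 0 ≤ resIter d ω lam H m x := by
  induction m generalizing x with
  | zero => exact le_rfl
  | succ m ih =>
    exact add_nonneg (mul_nonneg hl0 (hH x))
      (mul_nonneg (by linarith) (Pop_nonneg hd ω ih x))

lemma resIter_le (hd : 1 ≤ d) (hl0 : 0 ≤ lam) (hl1 : lam ≤ 1) (hM : 0 ≤ M) (hH : ∀ x, H x ≤ M)
    (m : ℕ) (x : Vert d) : resIter d ω lam H m x ≤ M := by
  induction m generalizing x with
  | zero => exact hM
  | succ m ih =>
    have h1 := mul_le_mul_of_nonneg_left (hH x) hl0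
    have h2 := mul_le_mul_of_nonneg_left (Pop_le hd ω ih x) (show 0 ≤ 1 - lam by linarith)
    calc _ ≤ lam * M + (1 - lam) * M := add_le_add h1 h2
      _ = M := by ring

lemma resIter_le_succ (hd : 1 ≤ d) (hl0 : 0 ≤ lam) (hl1 : lam ≤ 1) (hH : ∀ x, 0 ≤ H x) (m : ℕ)
    (x : Vert d) : resIter d ω lam H m x ≤ resIter d ω lam H (m + 1) x := by
  induction m generalizing x with
  | zero => exact resIter_nonneg hd hl0 hl1 hH 1 x
  | succ m ih =>
    exact add_le_add le_rfl (mul_le_mul_of_nonneg_left (Pop_mono hd ω ih x) (by linarith))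

lemma resIter_support (hd : 1 ≤ d) {n : ℕ} (hH : ∀ x ∉ box d (n : ℝ), H x = 0) (m : ℕ) :
    ∀ x ∉ box d ((n + m : ℕ) : ℝ), resIter d ω lam H m x = 0 := by
  induction m with
  | zero => exact fun x _ => rfl
  | succ m ih =>
    intro x hx
    have h1 : H x = 0 := hH x fun h => hx (box_mono (by omega) h)
    simp [resIter, h1, Pop_eq_zero_of_support hd ω ih x hx]

lemma le_resIter (hd : 1 ≤ d) (hl0 : 0 ≤ lam) (hl1 : lam ≤ 1) (hH : ∀ x, 0 ≤ H x) (m : ℕ)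
    (x : Vert d) :
    lam * (1 - lam) ^ m * ∑ k ∈ Finset.range m, (Pop d ω)^[k] H x ≤ resIter d ω lam H m x := by
  induction m generalizing x with
  | zero => simp [resIter]
  | succ m ih =>
    have h1 := Pop_mono hd ω ih x
    have h2 : Pop d ω (fun x => lam * (1 - lam) ^ m *
        ∑ k ∈ Finset.range m, (Pop d ω)^[k] H x) x =
        lam * (1 - lam) ^ m * ∑ k ∈ Finset.range m, (Pop d ω)^[k + 1] H x := by
      have : (fun x => lam * (1 - lam) ^ m * ∑ k ∈ Finset.range m, (Pop d ω)^[k] H x) =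
          (lam * (1 - lam) ^ m) • ∑ k ∈ Finset.range m, (Pop d ω)^[k] H := by
        funext y; simp
      rw [this, ← popL_apply, map_smul, map_sum]
      simp [Function.iterate_succ_apply']
    rw [h2] at h1
    rw [Finset.sum_range_succ', mul_add, Function.iterate_zero_apply]
    have hl : 0 ≤ 1 - lam := by linarith
    have h3 : lam * (1 - lam) ^ (m + 1) * H x ≤ lam * H x := by
      have := mul_le_mul_of_nonneg_right (pow_le_one₀ (n := m + 1) hl (by linarith))
        (mul_nonneg hl0 (hH x))
      linarith
    have h4 := mul_le_mul_of_nonneg_left h1 hl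
    rw [pow_succ] at h3 ⊢
    simp only [resIter]
    linarith

end resIter

end

section

/-! ### Time averages of iterates of the Markov operator -/

variable {d : ℕ}

lemma summable_shell (d : ℕ) {θ : ℝ} (hθ : 0 < θ) :
    Summable fun j : ℕ => Real.exp (-2 * θ) ^ j * ((j : ℝ) + 1) ^ d := by
  have hE : Real.exp (-2 * θ) < 1 := Real.exp_lt_one_iff.2 (by linarith)
  have h := summable_pow_mul_geometric_of_norm_lt_one (R := ℝ) d (r := Real.exp (-2 * θ)) (by
    rwa [Real.norm_of_nonneg (Real.exp_pos _).le])
  have h1 := ((summable_nat_add_iff 1).2 h).mul_left (Real.exp (-2 * θ))⁻¹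
  refine h1.congr fun j => ?_
  have := (Real.exp_pos (-2 * θ)).ne'
  push_cast
  rw [pow_succ]; field_simp

/-- Sums against exponentially decaying weights are controlled by sums over boxes. -/
lemma sum_exp_weight_le {θ a : ℝ} (hθ : 0 < θ) {r N₀ : ℕ} (hr : 1 ≤ r) (hN : N₀ ≤ r)
    {f : Vert d → ℝ} (hf : ∀ x, 0 ≤ f x)
    (ha : ∀ N ≥ N₀, ∑ x ∈ box d (N : ℝ), f x ≤ a * (N : ℝ) ^ d) (b : ℕ) :
    ∑ x ∈ box d (b : ℝ), Real.exp (-(θ / r) * supN d x) ^ 2 * f x ≤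
      (∑' j : ℕ, Real.exp (-2 * θ) ^ j * ((j : ℝ) + 1) ^ d) * a * (r : ℝ) ^ d := by
  classical
  set E := Real.exp (-2 * θ) with hE
  have hE0 : 0 < E := Real.exp_pos _
  have hr0 : (0 : ℝ) < r := by exact_mod_cast hr
  have ha0 : 0 ≤ a := by
    have h1 := ha r hN
    have h2 : 0 ≤ ∑ x ∈ box d (r : ℝ), f x := Finset.sum_nonneg fun x _ => hf x
    exact nonneg_of_mul_nonneg_left (h2.trans h1) (by positivity)
  have hpt : ∀ x ∈ box d (b : ℝ), Real.exp (-(θ / r) * supN d x) ^ 2 * f x ≤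
      ∑ j ∈ Finset.range (b + 1),
        E ^ j * (if x ∈ box d (((j + 1) * r : ℕ) : ℝ) then f x else 0) := by
    intro x hx
    have hxb := supN_le_iff.2 hx
    set j := supN d x / r with hj
    have hjb : j ∈ Finset.range (b + 1) :=
      Finset.mem_range.2 (Nat.lt_succ_of_le ((Nat.div_le_self _ _).trans hxb))
    have hmem : x ∈ box d (((j + 1) * r : ℕ) : ℝ) :=
      supN_le_iff.1 ((Nat.div_lt_iff_lt_mul (by omega)).1 (Nat.lt_succ_self j)).le
    refine le_trans ?_ (Finset.single_le_sum (f := fun j => E ^ j *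
      (if x ∈ box d (((j + 1) * r : ℕ) : ℝ) then f x else 0)) (fun i _ => ?_) hjb)
    · simp only [if_pos hmem]
      refine mul_le_mul_of_nonneg_right ?_ (hf x)
      rw [hE, ← Real.exp_nat_mul, ← Real.exp_nat_mul]
      apply Real.exp_le_exp.2
      have h1 : (j : ℝ) * r ≤ supN d x := by exact_mod_cast Nat.div_mul_le_self _ _
      have h2 : (j : ℝ) * θ ≤ θ / r * supN d x := by
        rw [div_mul_eq_mul_div, le_div_iff₀ hr0]; nlinarith
      push_cast; linarith
    · split_ifs
      · exact mul_nonneg (by positivity) (hf x)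
      · simp
  calc _ ≤ ∑ x ∈ box d (b : ℝ), ∑ j ∈ Finset.range (b + 1),
        E ^ j * (if x ∈ box d (((j + 1) * r : ℕ) : ℝ) then f x else 0) := Finset.sum_le_sum hpt
    _ = ∑ j ∈ Finset.range (b + 1), E ^ j *
        ∑ x ∈ box d (b : ℝ), (if x ∈ box d (((j + 1) * r : ℕ) : ℝ) then f x else 0) := by
        rw [Finset.sum_comm]; simp only [Finset.mul_sum]
    _ ≤ ∑ j ∈ Finset.range (b + 1), E ^ j * ((j : ℝ) + 1) ^ d * (a * (r : ℝ) ^ d) := by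
        refine Finset.sum_le_sum fun j _ => ?_
        rw [mul_assoc]
        refine mul_le_mul_of_nonneg_left ?_ (by positivity)
        rw [Finset.sum_ite_mem]
        calc _ ≤ ∑ x ∈ box d (((j + 1) * r : ℕ) : ℝ), f x :=
              Finset.sum_le_sum_of_subset_of_nonneg Finset.inter_subset_right fun x _ _ => hf x
          _ ≤ _ := ha _ (hN.trans (Nat.le_mul_of_pos_left r (Nat.succ_pos j)))
          _ = _ := by push_cast; rw [mul_pow]; ring
    _ ≤ _ := by
        rw [← Finset.sum_mul, mul_assoc]
        exact mul_le_mul_of_nonneg_right ((summable_shell d hθ).sum_le_tsum _ fun i _ => by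
          positivity) (by positivity)

lemma sum_inv_piOf_le (hd : 1 ≤ d) {ω : EnvSp d} {p q C : ℝ} (hq : 1 < q)
    (hC : BoxMoments d p q ω C) {r : ℕ} (hr : 1 ≤ r) :
    ∑ x ∈ box d ((2 * r : ℕ) : ℝ), (piOf d ω x)⁻¹ ≤ (5 ^ d + C * 2 ^ d) * (r : ℝ) ^ d := by
  have hr0 : (1 : ℝ) ≤ r := by exact_mod_cast hr
  have hcard : ((box d ((2 * r : ℕ) : ℝ)).card : ℝ) ≤ 5 ^ d * (r : ℝ) ^ d := by
    rw [card_box, ← mul_pow]; push_cast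
    gcongr; linarith
  have hpt : ∀ x, (piOf d ω x)⁻¹ ≤ 1 + ∑ i, ω.1 (x, i) ^ (-q) := by
    intro x
    obtain ⟨i⟩ : Nonempty (Fin d) := ⟨⟨0, hd⟩⟩
    have hc := ω.2 (x, i)
    have h1 : (piOf d ω x)⁻¹ ≤ (ω.1 (x, i))⁻¹ := inv_anti₀ hc (cond_le_piOf ω x i)
    have h2 : (ω.1 (x, i))⁻¹ ≤ 1 + ω.1 (x, i) ^ (-q) := by
      rcases le_total 1 (ω.1 (x, i)) with h | h
      · have := Real.rpow_nonneg hc.le (-q)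
        have := inv_le_one_of_one_le₀ h
        linarith
      · rw [← Real.rpow_neg_one]
        have := Real.rpow_le_rpow_of_exponent_ge hc h (show -q ≤ -1 by linarith)
        linarith
    have h3 : ω.1 (x, i) ^ (-q) ≤ ∑ i, ω.1 (x, i) ^ (-q) :=
      Finset.single_le_sum (f := fun i => ω.1 (x, i) ^ (-q))
        (fun j _ => Real.rpow_nonneg (ω.2 _).le _) (Finset.mem_univ i)
    linarith
  calc _ ≤ ∑ x ∈ box d ((2 * r : ℕ) : ℝ), (1 + ∑ i, ω.1 (x, i) ^ (-q)) :=
        Finset.sum_le_sum fun x _ => hpt x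
    _ ≤ 5 ^ d * (r : ℝ) ^ d + C * ((2 * r : ℕ) : ℝ) ^ d := by
        rw [Finset.sum_add_distrib]
        exact add_le_add (by simpa using hcard) (hC.2.2 _ (by omega))
    _ = _ := by push_cast; rw [mul_pow]; ring

lemma add_rpow_le_two_rpow_mul {a b s : ℝ} (ha : 0 ≤ a) (hb : 0 ≤ b) (hs : 0 ≤ s) :
    (a + b) ^ s ≤ 2 ^ s * (a ^ s + b ^ s) := by
  have ha' := Real.rpow_nonneg ha s
  have hb' := Real.rpow_nonneg hb s
  rcases le_total a b with h | h
  · calc (a + b) ^ s ≤ (2 * b) ^ s := Real.rpow_le_rpow (by positivity) (by linarith) hs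
      _ = 2 ^ s * b ^ s := Real.mul_rpow two_pos.le hb
      _ ≤ _ := by gcongr; linarith
  · calc (a + b) ^ s ≤ (2 * a) ^ s := Real.rpow_le_rpow (by positivity) (by linarith) hs
      _ = 2 ^ s * a ^ s := Real.mul_rpow two_pos.le ha
      _ ≤ _ := by gcongr; linarith

/-- Quantitative bound at a single scale: `r ≈ δ √n`. -/
lemma avg_iterate_le_of_scale (hd : 1 ≤ d) {p q : ℝ} (hp : 1 < p) (hq : 1 < q)
    {ω : EnvSp d} {C L : ℝ} (hC : BoxMoments d p q ω C) {s : ℝ} (hs : s = 2 * (p / (p - 1)))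
    (hL : 0 < L)
    (hmoser : ∀ (k : ℕ) (V : Vert d → ℝ), SubSol d ω (2 / ((4 ^ k : ℕ) : ℝ) ^ 2) V →
      V 0 ≤ L * ((∑ x ∈ box d ((2 * 4 ^ k : ℕ) : ℝ), V x ^ s) /
        ((4 ^ k : ℕ) : ℝ) ^ d) ^ (1 / s))
    {M δ a : ℝ} (hM : 0 < M) (hδ : 0 < δ) {H : Vert d → ℝ} (hH : ∀ x, 0 ≤ H x ∧ H x ≤ M)
    {N₀ : ℕ} (ha : ∀ N ≥ N₀, ∑ x ∈ box d (N : ℝ), piOf d ω x * H x ^ 2 ≤ a * (N : ℝ) ^ d)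
    {k n : ℕ} (hkN : N₀ ≤ 4 ^ k) (hn : 1 ≤ n) (hkn : ((4 ^ k : ℕ) : ℝ) ^ 2 ≤ δ ^ 2 * n)
    (hnk : δ ^ 2 * n ≤ 16 * ((4 ^ k : ℕ) : ℝ) ^ 2) {X : ℝ} (hX : 0 ≤ X)
    (haX : 4 * Real.exp (δ / 2) *
      (∑' j : ℕ, Real.exp (-2 * (δ / 8)) ^ j * ((j : ℝ) + 1) ^ d) * a * (5 ^ d + C * 2 ^ d) ≤
      X ^ 2) :
    (∑ m ∈ Finset.range n, (Pop d ω)^[m] H 0) / n ≤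
      4 * (L * (2 ^ s * (5 ^ d * (M * δ ^ 2) ^ s + M ^ (s - 1) * X)) ^ (1 / s)) := by
  classical
  have hs2 : 2 ≤ s := by
    rw [hs]
    have : 1 ≤ p / (p - 1) := (one_le_div (by linarith)).2 (by linarith)
    linarith
  have hC0 := hC.1
  set r : ℕ := 4 ^ k with hr
  have hr1 : 1 ≤ r := Nat.one_le_pow _ _ (by norm_num)
  have hr0 : (0 : ℝ) < r := by exact_mod_cast hr1
  have hn0 : (1 : ℝ) ≤ n := by exact_mod_cast hn
  set y : ℝ := M * δ ^ 2 with hy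
  have hy0 : 0 < y := by positivity
  set lam : ℝ := 1 / (2 * n) with hlam
  have hl0 : 0 < lam := by positivity
  have hl1 : lam ≤ 1 / 2 := by
    rw [hlam, div_le_div_iff₀ (by positivity) (by norm_num)]; linarith
  set H' : Vert d → ℝ := fun x => if x ∈ box d (n : ℝ) then H x else 0 with hH'
  have hH'0 : ∀ x, 0 ≤ H' x := fun x => by
    simp only [hH']; split_ifs; exacts [(hH x).1, le_rfl]
  have hH'H : ∀ x, H' x ≤ H x := fun x => by
    simp only [hH']; split_ifs; exacts [le_rfl, (hH x).1]
  have hH's : ∀ x ∉ box d (n : ℝ), H' x = 0 := fun x hx => if_neg hx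
  set v := resIter d ω lam H' n with hv
  have hv0 : ∀ x, 0 ≤ v x := resIter_nonneg hd hl0.le (by linarith) hH'0 n
  have hvM : ∀ x, v x ≤ M :=
    resIter_le hd hl0.le (by linarith) hM.le (fun x => (hH'H x).trans (hH x).2) n
  have hvs : ∀ x ∉ box d ((n + n : ℕ) : ℝ), v x = 0 := resIter_support hd hH's n
  have hvsub : ∀ x, v x ≤ lam * H' x + (1 - lam) * Pop d ω v x :=
    resIter_le_succ hd hl0.le (by linarith) hH'0 n
  set R : ℝ := (r : ℝ) ^ d with hR
  have hR0 : 0 < R := by positivity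
  set S := ∑' j : ℕ, Real.exp (-2 * (δ / 8)) ^ j * ((j : ℝ) + 1) ^ d with hS
  have ht : (δ / 8 / r) ^ 2 ≤ lam / 2 := by
    rw [hlam, div_pow, div_div, div_le_div_iff₀ (by positivity) (by positivity)]
    nlinarith
  have hW := weighted_sum_le hd ω hl0 (by linarith) ht hv0 hvs hvsub
  have hshell := sum_exp_weight_le (θ := δ / 8) (by positivity) hr1 hkN
    (fun x => mul_nonneg (piOf_pos hd ω x).le (sq_nonneg (H x))) ha (n + n)
  have hW2 : ∑ x ∈ box d ((n + n : ℕ) : ℝ),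
      piOf d ω x * Real.exp (-(δ / 8 / r) * supN d x) ^ 2 * v x ^ 2 ≤ 4 * (S * a * R) := by
    refine hW.trans (mul_le_mul_of_nonneg_left (le_trans ?_ hshell) (by norm_num))
    refine Finset.sum_le_sum fun x _ => ?_
    have hπ := (piOf_pos hd ω x).le
    calc _ ≤ piOf d ω x * Real.exp (-(δ / 8 / r) * supN d x) ^ 2 * H x ^ 2 := by
          refine mul_le_mul_of_nonneg_left ?_ (by positivity)
          exact pow_le_pow_left₀ (hH'0 x) (hH'H x) 2
      _ = _ := by ring
  have hW3 : ∑ x ∈ box d ((2 * r : ℕ) : ℝ), piOf d ω x * v x ^ 2 ≤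
      Real.exp (δ / 2) * (4 * (S * a * R)) := by
    refine le_trans ?_ (mul_le_mul_of_nonneg_left hW2 (Real.exp_pos _).le)
    rw [Finset.mul_sum]
    have hterm : ∀ x, 0 ≤ Real.exp (δ / 2) *
        (piOf d ω x * Real.exp (-(δ / 8 / r) * supN d x) ^ 2 * v x ^ 2) := fun x => by
      have hπ := (piOf_pos hd ω x).le
      positivity
    refine le_trans (Finset.sum_le_sum fun x hx => ?_)
      (sum_box_le_of_support (M := 2 * r) hterm fun x hx => by rw [hvs x hx]; ring)
    have hx' : (supN d x : ℝ) ≤ 2 * r := by exact_mod_cast supN_le_iff.2 hx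
    have h1 : 1 ≤ Real.exp (δ / 2) * Real.exp (-(δ / 8 / r) * supN d x) ^ 2 := by
      rw [← Real.exp_nat_mul, ← Real.exp_add]
      apply Real.one_le_exp
      have : δ / 8 / r * supN d x ≤ δ / 4 := by
        rw [div_mul_eq_mul_div, div_le_iff₀ hr0]; nlinarith
      push_cast; linarith
    have h2 : 0 ≤ piOf d ω x * v x ^ 2 := mul_nonneg (piOf_pos hd ω x).le (sq_nonneg _)
    calc _ ≤ (Real.exp (δ / 2) * Real.exp (-(δ / 8 / r) * supN d x) ^ 2) *
          (piOf d ω x * v x ^ 2) := le_mul_of_one_le_left h2 h1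
      _ = _ := by ring
  have hsum : ∑ x ∈ box d ((2 * r : ℕ) : ℝ), v x ≤ X * R := by
    have hcs := Finset.sum_sq_le_sum_mul_sum_of_sq_le_mul (box d ((2 * r : ℕ) : ℝ))
      (r := v) (f := fun x => piOf d ω x * v x ^ 2) (g := fun x => (piOf d ω x)⁻¹)
      (fun x _ => mul_nonneg (piOf_pos hd ω x).le (sq_nonneg _))
      (fun x _ => inv_nonneg.2 (piOf_pos hd ω x).le) (fun x _ => by
        have := (piOf_pos hd ω x).ne'
        apply le_of_eq; field_simp)
    have hinv := sum_inv_piOf_le hd hq hC hr1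
    have h3 : (∑ x ∈ box d ((2 * r : ℕ) : ℝ), v x) ^ 2 ≤ (X * R) ^ 2 := by
      refine hcs.trans ?_
      have hnn : 0 ≤ Real.exp (δ / 2) * (4 * (S * a * R)) :=
        le_trans (Finset.sum_nonneg fun x _ =>
          mul_nonneg (piOf_pos hd ω x).le (sq_nonneg _)) hW3
      calc _ ≤ Real.exp (δ / 2) * (4 * (S * a * R)) * ((5 ^ d + C * 2 ^ d) * R) := by
            refine mul_le_mul hW3 hinv (Finset.sum_nonneg fun x _ =>
              inv_nonneg.2 (piOf_pos hd ω x).le) hnn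
        _ = (4 * Real.exp (δ / 2) * S * a * (5 ^ d + C * 2 ^ d)) * R ^ 2 := by ring
        _ ≤ X ^ 2 * R ^ 2 := by gcongr
        _ = _ := by ring
    exact (pow_le_pow_iff_left₀ (Finset.sum_nonneg fun x _ => hv0 x) (by positivity)
      two_ne_zero).1 h3
  have hV : SubSol d ω (2 / (r : ℝ) ^ 2) fun x => v x + y := by
    refine ⟨fun x => add_nonneg (hv0 x) hy0.le, fun x => ?_⟩
    have hπ := (piOf_pos hd ω x).le
    rw [csum_add, csum_const, ← piOf_mul_Pop hd]
    have hP0 := Pop_nonneg hd ω hv0 x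
    have h1 : v x - Pop d ω v x ≤ lam * M := by
      have := hvsub x
      have h2 := mul_le_mul_of_nonneg_left ((hH'H x).trans (hH x).2) hl0.le
      have h3 := mul_nonneg hl0.le hP0
      linarith
    have h2 : lam * M ≤ 2 / (r : ℝ) ^ 2 * (v x + y) := by
      have h3 : lam * M ≤ 2 / (r : ℝ) ^ 2 * y := by
        rw [hlam, hy, one_div_mul_eq_div, div_mul_eq_mul_div,
          div_le_div_iff₀ (by positivity) (by positivity)]
        have := mul_le_mul_of_nonneg_left hkn hM.le
        nlinarith
      have h4 : 0 ≤ 2 / (r : ℝ) ^ 2 * v x := mul_nonneg (by positivity) (hv0 x)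
      linarith
    have := mul_le_mul_of_nonneg_left (h1.trans h2) hπ
    linarith
  have hmos := hmoser k _ hV
  rw [← hr] at hmos
  have hcard : ((box d ((2 * r : ℕ) : ℝ)).card : ℝ) ≤ 5 ^ d * R := by
    rw [card_box, hR, ← mul_pow]; push_cast
    gcongr
    have : (1 : ℝ) ≤ r := by exact_mod_cast hr1
    linarith
  have hVs : (∑ x ∈ box d ((2 * r : ℕ) : ℝ), (v x + y) ^ s) / R ≤
      2 ^ s * (5 ^ d * y ^ s + M ^ (s - 1) * X) := by
    rw [div_le_iff₀ hR0]
    calc _ ≤ ∑ x ∈ box d ((2 * r : ℕ) : ℝ), 2 ^ s * (M ^ (s - 1) * v x + y ^ s) := by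
          refine Finset.sum_le_sum fun x _ => ?_
          refine (add_rpow_le_two_rpow_mul (hv0 x) hy0.le (by linarith)).trans ?_
          gcongr
          rcases (hv0 x).eq_or_lt with h | h
          · rw [← h, Real.zero_rpow (by linarith), mul_zero]
          · calc v x ^ s = v x ^ (s - 1) * v x := by
                  rw [Real.rpow_sub_one h.ne']; field_simp
              _ ≤ _ := by gcongr; exacts [by linarith, hvM x]
      _ = 2 ^ s * (M ^ (s - 1) * ∑ x ∈ box d ((2 * r : ℕ) : ℝ), v x +
            (box d ((2 * r : ℕ) : ℝ)).card * y ^ s) := by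
          rw [← Finset.mul_sum, Finset.sum_add_distrib, ← Finset.mul_sum, Finset.sum_const,
            nsmul_eq_mul]
      _ ≤ 2 ^ s * (M ^ (s - 1) * (X * R) + 5 ^ d * R * y ^ s) := by gcongr
      _ = _ := by ring
  have hmos2 : v 0 ≤ L * (2 ^ s * (5 ^ d * y ^ s + M ^ (s - 1) * X)) ^ (1 / s) := by
    calc v 0 ≤ v 0 + y := by linarith
      _ ≤ _ := hmos
      _ ≤ _ := by
        refine mul_le_mul_of_nonneg_left (Real.rpow_le_rpow ?_ hVs (by positivity)) hL.le
        exact div_nonneg (Finset.sum_nonneg fun x _ => Real.rpow_nonneg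
          (add_nonneg (hv0 x) hy0.le) _) hR0.le
  have hlow := le_resIter (ω := ω) hd hl0.le (by linarith) hH'0 n 0
  rw [← hv] at hlow
  have hcongr : ∑ m ∈ Finset.range n, (Pop d ω)^[m] H' 0 =
      ∑ m ∈ Finset.range n, (Pop d ω)^[m] H 0 := by
    refine Finset.sum_congr rfl fun m hm => ?_
    refine iterate_Pop_congr hd ω m 0 (fun x hx => ?_) 0 (zero_mem_box 0)
    exact if_pos (box_mono (by have := Finset.mem_range.1 hm; omega) hx)
  rw [hcongr] at hlow
  have hiter0 : ∀ m x, 0 ≤ (Pop d ω)^[m] H x := by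
    intro m
    induction m with
    | zero => exact fun x => (hH x).1
    | succ m ih => intro x; rw [Function.iterate_succ_apply']; exact Pop_nonneg hd ω ih x
  have hT0 : 0 ≤ ∑ m ∈ Finset.range n, (Pop d ω)^[m] H 0 :=
    Finset.sum_nonneg fun m _ => hiter0 m 0
  have hbern : 1 / 2 ≤ (1 - lam) ^ n := by
    have := one_add_mul_le_pow (a := -lam) (by linarith) n
    have h2 : (n : ℝ) * -lam = -(1 / 2) := by rw [hlam]; field_simp
    rw [h2] at this
    rw [sub_eq_add_neg]; linarith
  calc (∑ m ∈ Finset.range n, (Pop d ω)^[m] H 0) / n =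
        4 * (lam * (1 / 2) * ∑ m ∈ Finset.range n, (Pop d ω)^[m] H 0) := by
        rw [hlam]; field_simp; ring
    _ ≤ 4 * (lam * (1 - lam) ^ n * ∑ m ∈ Finset.range n, (Pop d ω)^[m] H 0) := by gcongr
    _ ≤ 4 * v 0 := by gcongr
    _ ≤ _ := by gcongr

/-- If `H` is bounded and small in quadratic mean over large boxes, then so are the Cesàro
averages of its expectation along the walk started at the origin. -/
lemma exists_avg_iterate_le (hd : 1 ≤ d) {p q : ℝ} (hp : 1 < p) (hq : 1 < q)
    (hpq : 2 ≤ d → 1 / p + 1 / q < 2 / (d : ℝ)) {ω : EnvSp d} {C : ℝ}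
    (hC : BoxMoments d p q ω C) {M ε : ℝ} (hM : 0 < M) (hε : 0 < ε) :
    ∃ a, 0 < a ∧ ∀ H : Vert d → ℝ, (∀ x, 0 ≤ H x ∧ H x ≤ M) →
      (∃ N₀ : ℕ, ∀ N ≥ N₀, ∑ x ∈ box d (N : ℝ), piOf d ω x * H x ^ 2 ≤ a * (N : ℝ) ^ d) →
      ∀ᶠ n : ℕ in atTop, (∑ m ∈ Finset.range n, (Pop d ω)^[m] H 0) / n ≤ ε := by
  obtain ⟨L, hL, hmoser⟩ := exists_moser_bound hd hp hq hpq hC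
  have hC0 := hC.1
  set s := 2 * (p / (p - 1)) with hs
  have hs0 : 0 < s := mul_pos two_pos (div_pos (by linarith) (by linarith))
  set ε' := (ε / (4 * L)) ^ s with hε'
  have hε'0 : 0 < ε' := by positivity
  set y := (ε' / (2 * (2 ^ s * 5 ^ d))) ^ (1 / s) with hy
  have hy0 : 0 < y := by positivity
  set δ := Real.sqrt (y / M) with hδ
  have hδ0 : 0 < δ := Real.sqrt_pos.2 (by positivity)
  have hyδ : M * δ ^ 2 = y := by
    rw [hδ, Real.sq_sqrt (by positivity)]; field_simp
  have hys : y ^ s = ε' / (2 * (2 ^ s * 5 ^ d)) := by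
    rw [hy, ← Real.rpow_mul (by positivity), one_div_mul_cancel hs0.ne', Real.rpow_one]
  set X := ε' / (2 * (2 ^ s * M ^ (s - 1))) with hX
  have hX0 : 0 < X := by positivity
  set S := ∑' j : ℕ, Real.exp (-2 * (δ / 8)) ^ j * ((j : ℝ) + 1) ^ d with hS
  have hS0 : 0 ≤ S := tsum_nonneg fun j => by positivity
  have hD : 0 < 4 * Real.exp (δ / 2) * (S + 1) * (5 ^ d + C * 2 ^ d) := by positivity
  refine ⟨X ^ 2 / (4 * Real.exp (δ / 2) * (S + 1) * (5 ^ d + C * 2 ^ d)), by positivity,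
    fun H hH ⟨N₀, hN₀⟩ => ?_⟩
  obtain ⟨n₀, hn₀⟩ := exists_nat_ge ((4 * ((N₀ : ℝ) + 1) / δ) ^ 2)
  filter_upwards [eventually_ge_atTop n₀, eventually_ge_atTop 1] with n hn hn1
  have hnR : (4 * ((N₀ : ℝ) + 1) / δ) ^ 2 ≤ n := hn₀.trans (by exact_mod_cast hn)
  have hsq : 4 * ((N₀ : ℝ) + 1) ≤ δ * Real.sqrt n := by
    have := Real.le_sqrt_of_sq_le hnR
    rwa [div_le_iff₀ hδ0, mul_comm (Real.sqrt _)] at this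
  have hN₀0 : (0 : ℝ) ≤ N₀ := by positivity
  obtain ⟨k, hk1, hk2⟩ := exists_nat_pow_near (show 1 ≤ δ * Real.sqrt n by linarith)
    (show (1 : ℝ) < 4 by norm_num)
  have hsn : (δ * Real.sqrt n) ^ 2 = δ ^ 2 * n := by
    rw [mul_pow, Real.sq_sqrt (Nat.cast_nonneg n)]
  have h := avg_iterate_le_of_scale hd hp hq hC hs hL hmoser hM hδ0 hH hN₀ (k := k) (n := n)
    (by
      have : (N₀ : ℝ) ≤ 4 ^ k := by rw [pow_succ] at hk2; linarith
      exact_mod_cast this) hn1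
    (by rw [← hsn]; push_cast; exact pow_le_pow_left₀ (by positivity) hk1 2)
    (by
      rw [← hsn]; push_cast
      rw [pow_succ] at hk2
      have := pow_le_pow_left₀ (by positivity) hk2.le 2
      linarith [this, mul_pow ((4 : ℝ) ^ k) 4 2]) hX0.le (by
      rw [← hS]
      calc 4 * Real.exp (δ / 2) * S * (X ^ 2 /
            (4 * Real.exp (δ / 2) * (S + 1) * (5 ^ d + C * 2 ^ d))) * (5 ^ d + C * 2 ^ d) =
            X ^ 2 * (S / (S + 1)) := by field_simp
        _ ≤ X ^ 2 * 1 := by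
            gcongr
            rw [div_le_one (by positivity)]; linarith
        _ = _ := mul_one _)
  refine h.trans (le_of_eq ?_)
  have e : 2 ^ s * (5 ^ d * (M * δ ^ 2) ^ s + M ^ (s - 1) * X) = ε' := by
    rw [hyδ, hys, hX]; field_simp; norm_num
  rw [e, hε', ← Real.rpow_mul (by positivity), mul_one_div_cancel hs0.ne', Real.rpow_one]
  field_simp

end

section

/-! ### The environment measure -/

variable {d : ℕ}

instance : SecondCountableTopology (EnvSp d) :=
  TopologicalSpace.Subtype.secondCountableTopology _

lemma shift_shift (x y : Vert d) (ω : EnvSp d) :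
    shift d x (shift d y ω) = shift d (x + y) ω := by
  ext e
  simp only [shift, add_assoc]

@[simp] lemma shift_zero (ω : EnvSp d) : shift d 0 ω = ω := by
  ext e
  simp [shift]

lemma piOf_shift (x y : Vert d) (ω : EnvSp d) :
    piOf d (shift d x ω) y = piOf d ω (y + x) := by
  simp only [piOf, shift]
  refine Finset.sum_congr rfl fun i _ => ?_
  rw [sub_add_eq_add_sub]

lemma continuous_cond (e : EdgeIx d) : Continuous fun ω : EnvSp d => ω.1 e :=
  (continuous_apply e).comp continuous_subtype_val

lemma continuous_shift (x : Vert d) : Continuous (shift d x) :=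
  Continuous.subtype_mk (continuous_pi fun e : EdgeIx d => continuous_cond (e.1 + x, e.2)) _

lemma continuous_piOf (x : Vert d) : Continuous fun ω : EnvSp d => piOf d ω x :=
  continuous_finsetSum _ fun _ _ => (continuous_cond _).add (continuous_cond _)

lemma pow_le_card_box (n : ℕ) : (n : ℝ) ^ d ≤ (box d (n : ℝ)).card := by
  rw [card_box]
  push_cast
  gcongr
  linarith [(Nat.cast_nonneg n : (0 : ℝ) ≤ n)]

lemma tendsto_card_box_add_div (K : ℕ) :
    Tendsto (fun n : ℕ => ((box d ((n + K : ℕ) : ℝ)).card : ℝ) / (box d (n : ℝ)).card)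
      atTop (𝓝 1) := by
  have h1 : Tendsto (fun n : ℕ => (1 + 2 * (K : ℝ) / (2 * n + 1)) ^ d) atTop (𝓝 ((1 + 0) ^ d)) := by
    refine (tendsto_const_nhds.add (tendsto_const_nhds.div_atTop ?_)).pow d
    exact tendsto_atTop_add_const_right _ _
      (tendsto_natCast_atTop_atTop.const_mul_atTop two_pos)
  rw [add_zero, one_pow] at h1
  refine h1.congr fun n => ?_
  rw [card_box, card_box]
  push_cast
  rw [← div_pow]
  congr 1
  have : (2 * (n : ℝ) + 1) ≠ 0 := by positivity
  field_simp
  ring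

lemma add_mem_box {m n : ℕ} {x z : Vert d} (hx : x ∈ box d (m : ℝ)) (hz : z ∈ box d (n : ℝ)) :
    x + z ∈ box d ((m + n : ℕ) : ℝ) := by
  rw [mem_box] at *
  intro i
  push_cast
  exact (abs_add_le _ _).trans (add_le_add (hx i) (hz i))

/-- Box averages of a bounded function are asymptotically invariant under translation. -/
lemma tendsto_box_average_shift_sub {g : Vert d → ℝ} {M : ℝ} (hM : ∀ x, |g x| ≤ M) (z : Vert d) :
    Tendsto (fun n : ℕ => (∑ x ∈ box d (n : ℝ), g (x + z)) / (box d (n : ℝ)).card -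
      (∑ x ∈ box d (n : ℝ), g x) / (box d (n : ℝ)).card) atTop (𝓝 0) := by
  classical
  set K := supN d z
  have hz : z ∈ box d (K : ℝ) := supN_le_iff.1 le_rfl
  have hsub : ∀ (n : ℕ) (S : Finset (Vert d)), S ⊆ box d ((n + K : ℕ) : ℝ) →
      S.card = (box d (n : ℝ)).card → |∑ x ∈ box d ((n + K : ℕ) : ℝ), g x - ∑ x ∈ S, g x| ≤
        M * ((box d ((n + K : ℕ) : ℝ)).card - (box d (n : ℝ)).card) := by
    intro n S hS hc
    rw [← Finset.sum_sdiff hS, add_sub_cancel_right]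
    refine (Finset.abs_sum_le_sum_abs _ _).trans ((Finset.sum_le_card_nsmul _ _ M
      fun x _ => hM x).trans ?_)
    rw [nsmul_eq_mul, Finset.card_sdiff_of_subset hS, Nat.cast_sub (Finset.card_le_card hS), hc,
      mul_comm]
  have hlim : Tendsto (fun n : ℕ => 2 * M * (((box d ((n + K : ℕ) : ℝ)).card : ℝ) /
      (box d (n : ℝ)).card - 1)) atTop (𝓝 0) := by
    simpa using ((tendsto_card_box_add_div (d := d) K).sub_const 1).const_mul (2 * M)
  refine squeeze_zero_norm (fun n => ?_) hlim
  have hc : (0 : ℝ) < (box d (n : ℝ)).card := by exact_mod_cast card_box_pos n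
  have h1 := hsub n (box d (n : ℝ)) (box_mono (by omega)) rfl
  have h2 := hsub n ((box d (n : ℝ)).image fun x => x + z)
    (Finset.image_subset_iff.2 fun x hx => add_mem_box hx hz)
    (Finset.card_image_of_injective _ (add_left_injective z))
  rw [Finset.sum_image (fun x _ y _ h => add_left_injective z h)] at h2
  rw [← sub_div, Real.norm_eq_abs, abs_div, abs_of_pos hc, div_le_iff₀ hc]
  have e : 2 * M * (((box d ((n + K : ℕ) : ℝ)).card : ℝ) / (box d (n : ℝ)).card - 1) *
      (box d (n : ℝ)).card =
      2 * (M * ((box d ((n + K : ℕ) : ℝ)).card - (box d (n : ℝ)).card)) := by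
    field_simp
  rw [e]
  rw [abs_le] at *
  constructor <;> linarith [h1.1, h1.2, h2.1, h2.2]

lemma IsEnvLaw.measurePreserving {ω : EnvSp d} {P : Measure (EnvSp d)} (hP : IsEnvLaw d ω P)
    (z : Vert d) : MeasurePreserving (shift d z) P P := by
  have := hP.1
  have hm := (continuous_shift z).measurable
  refine ⟨hm, ?_⟩
  have : IsProbabilityMeasure (P.map (shift d z)) := Measure.isProbabilityMeasure_map hm.aemeasurable
  let _ := TopologicalSpace.metrizableSpaceMetric (EnvSp d)
  refine ext_of_forall_integral_eq_of_IsFiniteMeasure fun f => ?_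
  rw [integral_map hm.aemeasurable f.continuous.aestronglyMeasurable]
  have hb : ∀ ω, |f ω| ≤ ‖f‖ := fun ω => f.norm_coe_le_norm ω
  have h1 := hP.2 f f.continuous ⟨_, hb⟩
  have h2 := hP.2 (fun ω => f (shift d z ω)) (f.continuous.comp (continuous_shift z))
    ⟨_, fun ω => hb _⟩
  have h3 := tendsto_box_average_shift_sub (g := fun x => f (shift d x ω)) (fun x => hb _) z
  have h4 := tendsto_nhds_unique (h2.sub h1) (h3.congr fun n => by
    simp only [shift_shift, add_comm z])
  linarith

lemma IsEnvLaw.integral_min_le {p q : ℝ} (hp : 1 < p) {ω : EnvSp d} {C : ℝ}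
    (hC : BoxMoments d p q ω C) {P : Measure (EnvSp d)} (hP : IsEnvLaw d ω P) (L : ℝ)
    (hL : 0 ≤ L) (hd : 1 ≤ d) :
    ∫ ω', min (piOf d ω' 0) L ∂P ≤ 1 + C := by
  have h := hP.2 (fun ω' => min (piOf d ω' 0) L) ((continuous_piOf 0).min continuous_const)
    ⟨L, fun ω' => by
      rw [abs_of_nonneg (le_min (piOf_pos hd _ _).le hL)]; exact min_le_right _ _⟩
  refine le_of_tendsto h ((eventually_ge_atTop 1).mono fun n hn => ?_)
  have hc : (0 : ℝ) < (box d (n : ℝ)).card := by exact_mod_cast card_box_pos n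
  rw [div_le_iff₀ hc]
  calc ∑ x ∈ box d (n : ℝ), min (piOf d (shift d x ω) 0) L
      ≤ ∑ x ∈ box d (n : ℝ), (1 + piOf d ω x ^ p) := by
        refine Finset.sum_le_sum fun x _ => (min_le_left _ _).trans ?_
        rw [piOf_shift, zero_add]
        have hpos := piOf_pos hd ω x
        rcases le_total (piOf d ω x) 1 with h | h
        · linarith [Real.rpow_nonneg hpos.le p]
        · linarith [Real.self_le_rpow_of_one_le h hp.le]
    _ = (box d (n : ℝ)).card + ∑ x ∈ box d (n : ℝ), piOf d ω x ^ p := by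
        rw [Finset.sum_add_distrib]; simp
    _ ≤ (box d (n : ℝ)).card + C * (box d (n : ℝ)).card := by
        have := hC.2.1 n hn
        have h2 := mul_le_mul_of_nonneg_left (pow_le_card_box (d := d) n) hC.1.le
        linarith
    _ = _ := by ring

lemma IsEnvLaw.integrable_piOf (hd : 1 ≤ d) {p q : ℝ} (hp : 1 < p) {ω : EnvSp d} {C : ℝ}
    (hC : BoxMoments d p q ω C) {P : Measure (EnvSp d)} (hP : IsEnvLaw d ω P) :
    Integrable (fun ω' => piOf d ω' 0) P := by
  have := hP.1
  have hpos : ∀ ω' : EnvSp d, 0 ≤ piOf d ω' 0 := fun ω' => (piOf_pos hd ω' 0).le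
  refine ⟨(continuous_piOf 0).aestronglyMeasurable, ?_⟩
  rw [hasFiniteIntegral_iff_ofReal (ae_of_all _ hpos)]
  have hcont : ∀ n : ℕ, Continuous fun ω' : EnvSp d => min (piOf d ω' 0) (n : ℝ) := fun n =>
    (continuous_piOf 0).min continuous_const
  have hlim : ∀ ω' : EnvSp d, liminf (fun n : ℕ => ENNReal.ofReal (min (piOf d ω' 0) (n : ℝ)))
      atTop = ENNReal.ofReal (piOf d ω' 0) := by
    intro ω'
    refine Tendsto.liminf_eq (tendsto_const_nhds.congr' ?_)
    obtain ⟨m, hm⟩ := exists_nat_ge (piOf d ω' 0)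
    filter_upwards [eventually_ge_atTop m] with n hn
    rw [min_eq_left (hm.trans (by exact_mod_cast hn))]
  have hbd : ∀ n : ℕ, ∫⁻ ω', ENNReal.ofReal (min (piOf d ω' 0) (n : ℝ)) ∂P ≤
      ENNReal.ofReal (1 + C) := by
    intro n
    have h0 : ∀ ω' : EnvSp d, 0 ≤ min (piOf d ω' 0) (n : ℝ) := fun ω' =>
      le_min (hpos ω') (Nat.cast_nonneg n)
    rw [← ofReal_integral_eq_lintegral_ofReal ?_ (ae_of_all _ h0)]
    · exact ENNReal.ofReal_le_ofReal (hP.integral_min_le hp hC n (Nat.cast_nonneg n) hd)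
    · refine Integrable.of_bound (hcont n).aestronglyMeasurable n (ae_of_all _ fun ω' => ?_)
      rw [Real.norm_of_nonneg (h0 ω')]
      exact min_le_right _ _
  calc ∫⁻ ω', ENNReal.ofReal (piOf d ω' 0) ∂P =
      ∫⁻ ω', liminf (fun n : ℕ => ENNReal.ofReal (min (piOf d ω' 0) (n : ℝ))) atTop ∂P := by
        simp only [hlim]
    _ ≤ liminf (fun n : ℕ => ∫⁻ ω', ENNReal.ofReal (min (piOf d ω' 0) (n : ℝ)) ∂P) atTop :=
        lintegral_liminf_le fun n => ENNReal.measurable_ofReal.comp (hcont n).measurable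
    _ ≤ ENNReal.ofReal (1 + C) := liminf_le_of_frequently_le' (Frequently.of_forall hbd)
    _ < ∞ := ENNReal.ofReal_lt_top

/-- Box averages of `π G` are asymptotically at most their expectation. -/
lemma IsEnvLaw.eventually_sum_piOf_mul_le (hd : 1 ≤ d) {p q : ℝ} (hp : 1 < p) {ω : EnvSp d}
    {C : ℝ} (hC : BoxMoments d p q ω C) {P : Measure (EnvSp d)} (hP : IsEnvLaw d ω P)
    {G : EnvSp d → ℝ} (hG : Continuous G) {K : ℝ} (hG0 : ∀ ω', 0 ≤ G ω') (hGK : ∀ ω', G ω' ≤ K)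
    {a : ℝ} (ha : ∫ ω', piOf d ω' 0 * G ω' ∂P < a) :
    ∀ᶠ N : ℕ in atTop, ∑ x ∈ box d (N : ℝ), piOf d ω x * G (shift d x ω) ≤
      a * (box d (N : ℝ)).card := by
  have := hP.1
  have hK : 0 ≤ K := (hG0 ω).trans (hGK ω)
  have hC0 := hC.1
  have hpos : ∀ ω' : EnvSp d, 0 ≤ piOf d ω' 0 := fun ω' => (piOf_pos hd ω' 0).le
  set I := ∫ ω', piOf d ω' 0 * G ω' ∂P
  have hlimL : Tendsto (fun L : ℝ => K * C * L ^ (-(p - 1))) atTop (𝓝 (K * C * 0)) :=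
    (tendsto_rpow_neg_atTop (by linarith)).const_mul _
  rw [mul_zero] at hlimL
  obtain ⟨L, hL1, hL⟩ := ((hlimL.eventually_lt_const (show 0 < (a - I) / 2 by linarith)).and
    (eventually_gt_atTop 0)).exists
  have h0 : ∀ ω' : EnvSp d, 0 ≤ min (piOf d ω' 0) L := fun ω' => le_min (hpos ω') hL.le
  have hb : ∀ ω' : EnvSp d, |min (piOf d ω' 0) L * G ω'| ≤ L * K := fun ω' => by
    rw [abs_of_nonneg (mul_nonneg (h0 ω') (hG0 ω'))]
    exact mul_le_mul (min_le_right _ _) (hGK ω') (hG0 ω') hL.le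
  have hcont : Continuous fun ω' : EnvSp d => min (piOf d ω' 0) L * G ω' :=
    ((continuous_piOf 0).min continuous_const).mul hG
  have havg := hP.2 _ hcont ⟨_, hb⟩
  have hle : ∫ ω', min (piOf d ω' 0) L * G ω' ∂P ≤ I := by
    refine integral_mono (Integrable.of_bound hcont.aestronglyMeasurable (L * K)
      (ae_of_all _ hb)) ?_ fun ω' => ?_
    · exact (hP.integrable_piOf hd hp hC).mul_bdd (c := K) hG.aestronglyMeasurable
        (ae_of_all _ fun ω' => by rw [Real.norm_of_nonneg (hG0 ω')]; exact hGK ω')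
    · exact mul_le_mul_of_nonneg_right (min_le_left _ _) (hG0 ω')
  filter_upwards [havg.eventually_lt_const (show _ < I + (a - I) / 2 by linarith),
    eventually_ge_atTop 1] with N hN hN1
  have hc : (0 : ℝ) < (box d (N : ℝ)).card := by exact_mod_cast card_box_pos N
  rw [div_lt_iff₀ hc] at hN
  have hpt : ∀ x, piOf d ω x * G (shift d x ω) ≤
      min (piOf d (shift d x ω) 0) L * G (shift d x ω) +
        K * L ^ (-(p - 1)) * piOf d ω x ^ p := by
    intro x
    rw [piOf_shift, zero_add]
    have hx := piOf_pos hd ω x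
    have hr : 0 ≤ K * L ^ (-(p - 1)) * piOf d ω x ^ p := by positivity
    rcases le_total (piOf d ω x) L with h | h
    · rw [min_eq_left h]; linarith
    · have h1 : piOf d ω x ≤ L ^ (-(p - 1)) * piOf d ω x ^ p := by
        calc piOf d ω x = piOf d ω x ^ (-(p - 1)) * piOf d ω x ^ p := by
              rw [← Real.rpow_add hx]; simp
          _ ≤ _ := by
              refine mul_le_mul_of_nonneg_right ?_ (by positivity)
              exact Real.rpow_le_rpow_of_nonpos hL h (by linarith)
      calc piOf d ω x * G (shift d x ω) ≤ L ^ (-(p - 1)) * piOf d ω x ^ p * K :=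
            mul_le_mul h1 (hGK _) (hG0 _) (by positivity)
        _ = K * L ^ (-(p - 1)) * piOf d ω x ^ p := by ring
        _ ≤ _ := le_add_of_nonneg_left (mul_nonneg (le_min hx.le hL.le) (hG0 _))
  calc _ ≤ ∑ x ∈ box d (N : ℝ), (min (piOf d (shift d x ω) 0) L * G (shift d x ω) +
        K * L ^ (-(p - 1)) * piOf d ω x ^ p) := Finset.sum_le_sum fun x _ => hpt x
    _ = ∑ x ∈ box d (N : ℝ), min (piOf d (shift d x ω) 0) L * G (shift d x ω) +
        K * L ^ (-(p - 1)) * ∑ x ∈ box d (N : ℝ), piOf d ω x ^ p := by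
        rw [Finset.sum_add_distrib, Finset.mul_sum]
    _ ≤ (I + (a - I) / 2) * (box d (N : ℝ)).card +
        K * L ^ (-(p - 1)) * (C * (box d (N : ℝ)).card) := by
        refine add_le_add hN.le (mul_le_mul_of_nonneg_left ?_ (by positivity))
        exact (hC.2.1 N hN1).trans (mul_le_mul_of_nonneg_left (pow_le_card_box N) hC0.le)
    _ = (I + (a - I) / 2 + K * C * L ^ (-(p - 1))) * (box d (N : ℝ)).card := by ring
    _ ≤ _ := mul_le_mul_of_nonneg_right (by linarith) hc.le

end

section

/-! ### The environment seen from the walk -/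

variable {d : ℕ}

/-- The Markov operator of the environment seen from the walk. -/
def envP (d : ℕ) (g : EnvSp d → ℝ) (ω : EnvSp d) : ℝ := Pop d ω (fun y => g (shift d y ω)) 0

lemma envP_shift (g : EnvSp d → ℝ) (x : Vert d) (ω : EnvSp d) :
    envP d g (shift d x ω) = Pop d ω (fun y => g (shift d y ω)) x := by
  unfold envP Pop csum
  rw [piOf_shift, zero_add]
  congr 1
  refine Finset.sum_congr rfl fun i _ => ?_
  simp only [shift_shift, zero_add, zero_sub]
  simp only [shift, zero_add, neg_add_eq_sub, add_comm (unitv d i) x]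

lemma iterate_envP_shift (g : EnvSp d → ℝ) (k : ℕ) (x : Vert d) (ω : EnvSp d) :
    (envP d)^[k] g (shift d x ω) = (Pop d ω)^[k] (fun y => g (shift d y ω)) x := by
  induction k generalizing x with
  | zero => rfl
  | succ k ih =>
    rw [Function.iterate_succ_apply', Function.iterate_succ_apply', envP_shift]
    simp only [ih]

lemma piOf_mul_envP (hd : 1 ≤ d) (g : EnvSp d → ℝ) (ω : EnvSp d) :
    piOf d ω 0 * envP d g ω = ∑ i, (ω.1 (0, i) * g (shift d (unitv d i) ω) +
      ω.1 (-unitv d i, i) * g (shift d (-unitv d i) ω)) := by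
  rw [envP, piOf_mul_Pop hd]
  simp [csum]

lemma continuous_envP (hd : 1 ≤ d) {g : EnvSp d → ℝ} (hg : Continuous g) :
    Continuous (envP d g) := by
  refine Continuous.div ?_ (continuous_piOf 0) fun ω => (piOf_pos hd ω 0).ne'
  refine continuous_finsetSum _ fun i _ => ?_
  exact ((continuous_cond _).mul (hg.comp (continuous_shift _))).add
    ((continuous_cond _).mul (hg.comp (continuous_shift _)))

lemma measurable_envP {g : EnvSp d → ℝ} (hg : Measurable g) : Measurable (envP d g) := by
  refine Measurable.div ?_ (continuous_piOf 0).measurable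
  refine Finset.measurable_sum _ fun i _ => ?_
  exact ((continuous_cond _).measurable.mul (hg.comp (continuous_shift _).measurable)).add
    ((continuous_cond _).measurable.mul (hg.comp (continuous_shift _).measurable))

lemma abs_envP_le (hd : 1 ≤ d) {g : EnvSp d → ℝ} {M : ℝ} (hg : ∀ ω, |g ω| ≤ M) (ω : EnvSp d) :
    |envP d g ω| ≤ M := by
  rw [abs_le]
  refine ⟨?_, Pop_le hd ω (fun y => (abs_le.1 (hg _)).2) 0⟩
  have := Pop_mono hd ω (g := fun _ => -M) (fun y => (abs_le.1 (hg (shift d y ω))).1) 0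
  rwa [Pop_const hd] at this

lemma envP_add (g h : EnvSp d → ℝ) (ω : EnvSp d) :
    envP d (fun ω => g ω + h ω) ω = envP d g ω + envP d h ω :=
  (congrArg (· / _) (csum_add ω 0 _ _)).trans (add_div _ _ _)

lemma envP_const_mul (a : ℝ) (g : EnvSp d → ℝ) (ω : EnvSp d) :
    envP d (fun ω => a * g ω) ω = a * envP d g ω :=
  (congrArg (· / _) (csum_mul_left ω 0 _ _)).trans (mul_div_assoc _ _ _)

/-- The carré-du-champ identity for one step of the environment chain. -/
lemma piOf_mul_variance (hd : 1 ≤ d) (g : EnvSp d → ℝ) (a : ℝ) (ω : EnvSp d) :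
    ∑ i, (ω.1 (0, i) * (g (shift d (unitv d i) ω) - a) ^ 2 +
      ω.1 (-unitv d i, i) * (g (shift d (-unitv d i) ω) - a) ^ 2) =
    piOf d ω 0 * (envP d (fun ω => g ω ^ 2) ω - 2 * a * envP d g ω + a ^ 2) := by
  have h1 := piOf_mul_envP hd (fun ω => g ω ^ 2) ω
  have h2 := piOf_mul_envP hd g ω
  have h3 : piOf d ω 0 = ∑ i, (ω.1 (0, i) + ω.1 (-unitv d i, i)) := by simp [piOf]
  calc _ = ∑ i, (ω.1 (0, i) * g (shift d (unitv d i) ω) ^ 2 +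
      ω.1 (-unitv d i, i) * g (shift d (-unitv d i) ω) ^ 2) -
      2 * a * ∑ i, (ω.1 (0, i) * g (shift d (unitv d i) ω) +
      ω.1 (-unitv d i, i) * g (shift d (-unitv d i) ω)) +
      a ^ 2 * ∑ i, (ω.1 (0, i) + ω.1 (-unitv d i, i)) := by
        rw [Finset.mul_sum, Finset.mul_sum, ← Finset.sum_sub_distrib, ← Finset.sum_add_distrib]
        exact Finset.sum_congr rfl fun i _ => by ring
    _ = _ := by rw [← h1, ← h2, ← h3]; ring

lemma envP_sq_le (hd : 1 ≤ d) (g : EnvSp d → ℝ) (ω : EnvSp d) :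
    envP d g ω ^ 2 ≤ envP d (fun ω => g ω ^ 2) ω := by
  have h := piOf_mul_variance hd g (envP d g ω) ω
  have h0 : 0 ≤ ∑ i, (ω.1 (0, i) * (g (shift d (unitv d i) ω) - envP d g ω) ^ 2 +
      ω.1 (-unitv d i, i) * (g (shift d (-unitv d i) ω) - envP d g ω) ^ 2) :=
    Finset.sum_nonneg fun i _ => add_nonneg (mul_nonneg (ω.2 _).le (sq_nonneg _))
      (mul_nonneg (ω.2 _).le (sq_nonneg _))
  rw [h] at h0
  have := nonneg_of_mul_nonneg_right h0 (piOf_pos hd ω 0)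
  nlinarith

lemma cond_neg_le_piOf (ω : EnvSp d) (i : Fin d) : ω.1 (-unitv d i, i) ≤ piOf d ω 0 := by
  unfold piOf
  calc ω.1 (-unitv d i, i) ≤ ω.1 (0, i) + ω.1 (0 - unitv d i, i) := by
        rw [zero_sub]; linarith [ω.2 (0, i)]
    _ ≤ _ := Finset.single_le_sum (f := fun i => ω.1 (0, i) + ω.1 (0 - unitv d i, i))
        (fun j _ => (add_pos (ω.2 _) (ω.2 _)).le) (Finset.mem_univ i)

/-- The measure `π(0) dP` is invariant for the environment chain. -/
lemma integral_piOf_mul_envP {P : Measure (EnvSp d)} (hinv : ∀ z, MeasurePreserving (shift d z) P P)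
    (hd : 1 ≤ d) {g : EnvSp d → ℝ} (hg : Measurable g)
    (hgi : Integrable (fun ω => piOf d ω 0 * g ω) P) :
    Integrable (fun ω => piOf d ω 0 * envP d g ω) P ∧
      ∫ ω, piOf d ω 0 * envP d g ω ∂P = ∫ ω, piOf d ω 0 * g ω ∂P := by
  have hi1 : ∀ i, Integrable (fun ω : EnvSp d => ω.1 (0, i) * g ω) P := fun i => by
    refine hgi.mono ((continuous_cond _).measurable.mul hg).aestronglyMeasurable
      (ae_of_all _ fun ω => ?_)
    rw [norm_mul, norm_mul, Real.norm_of_nonneg (ω.2 _).le,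
      Real.norm_of_nonneg (piOf_pos hd ω 0).le]
    exact mul_le_mul_of_nonneg_right (cond_le_piOf ω 0 i) (norm_nonneg _)
  have hi2 : ∀ i, Integrable (fun ω : EnvSp d => ω.1 (-unitv d i, i) * g ω) P := fun i => by
    refine hgi.mono ((continuous_cond _).measurable.mul hg).aestronglyMeasurable
      (ae_of_all _ fun ω => ?_)
    rw [norm_mul, norm_mul, Real.norm_of_nonneg (ω.2 _).le,
      Real.norm_of_nonneg (piOf_pos hd ω 0).le]
    exact mul_le_mul_of_nonneg_right (cond_neg_le_piOf ω i) (norm_nonneg _)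
  have e1 : ∀ i, (fun ω : EnvSp d => ω.1 (0, i) * g (shift d (unitv d i) ω)) =
      (fun ω : EnvSp d => ω.1 (-unitv d i, i) * g ω) ∘ shift d (unitv d i) := fun i => by
    funext ω; simp [shift]
  have e2 : ∀ i, (fun ω : EnvSp d => ω.1 (-unitv d i, i) * g (shift d (-unitv d i) ω)) =
      (fun ω : EnvSp d => ω.1 (0, i) * g ω) ∘ shift d (-unitv d i) := fun i => by
    funext ω; simp [shift]
  have hj1 : ∀ i, Integrable (fun ω : EnvSp d => ω.1 (0, i) * g (shift d (unitv d i) ω)) P :=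
    fun i => by rw [e1]; exact (hinv _).integrable_comp_of_integrable (hi2 i)
  have hj2 : ∀ i, Integrable
      (fun ω : EnvSp d => ω.1 (-unitv d i, i) * g (shift d (-unitv d i) ω)) P :=
    fun i => by rw [e2]; exact (hinv _).integrable_comp_of_integrable (hi1 i)
  have hcomp : ∀ (z : Vert d) {h : EnvSp d → ℝ}, Measurable h →
      ∫ ω, (h ∘ shift d z) ω ∂P = ∫ ω, h ω ∂P := by
    intro z h hh
    conv_rhs => rw [← (hinv z).map_eq]
    rw [integral_map (hinv z).measurable.aemeasurable hh.aestronglyMeasurable]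
    rfl
  have hj : ∀ i, Integrable (fun ω : EnvSp d => ω.1 (0, i) * g (shift d (unitv d i) ω) +
      ω.1 (-unitv d i, i) * g (shift d (-unitv d i) ω)) P := fun i => (hj1 i).add (hj2 i)
  have hi : ∀ i, Integrable (fun ω : EnvSp d => ω.1 (-unitv d i, i) * g ω +
      ω.1 (0, i) * g ω) P := fun i => (hi2 i).add (hi1 i)
  simp only [piOf_mul_envP hd]
  refine ⟨integrable_finsetSum _ fun i _ => hj i, ?_⟩
  rw [integral_finsetSum _ fun i _ => hj i]
  have e3 : ∀ ω : EnvSp d, piOf d ω 0 * g ω =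
      ∑ i, (ω.1 (-unitv d i, i) * g ω + ω.1 (0, i) * g ω) := fun ω => by
    simp only [piOf, Finset.sum_mul, zero_sub]
    exact Finset.sum_congr rfl fun i _ => by ring
  simp only [e3]
  rw [integral_finsetSum _ fun i _ => hi i]
  refine Finset.sum_congr rfl fun i _ => ?_
  rw [integral_add (hj1 i) (hj2 i), integral_add (hi2 i) (hi1 i), e1, e2]
  exact congrArg₂ (· + ·) (hcomp _ ((continuous_cond _).measurable.mul hg))
    (hcomp _ ((continuous_cond _).measurable.mul hg))

lemma envP_congr_ae {P : Measure (EnvSp d)} (hinv : ∀ z, MeasurePreserving (shift d z) P P)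
    {g h : EnvSp d → ℝ} (hgh : g =ᵐ[P] h) : envP d g =ᵐ[P] envP d h := by
  have : ∀ᵐ ω ∂P, ∀ z, g (shift d z ω) = h (shift d z ω) :=
    ae_all_iff.2 fun z => (hinv z).quasiMeasurePreserving.ae hgh
  filter_upwards [this] with ω hω
  simp only [envP, hω]

/-- A measurable function which is almost surely invariant under the translations is almost
surely constant, if the measure is ergodic. -/
lemma exists_ae_eq_const {P : Measure (EnvSp d)} (hinv : ∀ z, MeasurePreserving (shift d z) P P)
    [IsProbabilityMeasure P] (herg : ErgodicEnv d P) {g : EnvSp d → ℝ}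
    (hg : Measurable g) (hgi : ∀ i, (fun ω => g (shift d (unitv d i) ω)) =ᵐ[P] g) :
    ∃ c, ∀ᵐ ω ∂P, g ω = c := by
  let S : AddSubgroup (Vert d) :=
    { carrier := {z | (fun ω => g (shift d z ω)) =ᵐ[P] g}
      zero_mem' := by simp
      add_mem' := by
        intro a b ha hb
        have := (hinv b).quasiMeasurePreserving.ae ha
        change (fun ω => g (shift d (a + b) ω)) =ᵐ[P] g
        filter_upwards [this, hb] with ω h1 h2
        rw [← shift_shift, h1, h2]
      neg_mem' := by
        intro a ha
        have := (hinv (-a)).quasiMeasurePreserving.ae ha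
        change (fun ω => g (shift d (-a) ω)) =ᵐ[P] g
        filter_upwards [this] with ω h1
        rw [shift_shift, add_neg_cancel, shift_zero] at h1
        exact h1.symm }
  have hS : ∀ z : Vert d, (fun ω => g (shift d z ω)) =ᵐ[P] g := by
    intro z
    have hz : z = ∑ i, z i • unitv d i := by
      funext j
      simp [unitv, Finset.sum_apply]
    have : z ∈ S := by
      rw [hz]
      exact S.sum_mem fun i _ => S.zsmul_mem (hgi i) _
    exact this
  have h := Filter.exists_eventuallyEq_const_of_forall_separating (l := ae P) (f := g)
    MeasurableSet (fun U hU => ?_)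
  · obtain ⟨c, hc⟩ := h
    exact ⟨c, hc⟩
  set B := ⋂ z : Vert d, shift d z ⁻¹' (g ⁻¹' U) with hB
  have hBm : MeasurableSet B := MeasurableSet.iInter fun z => (hinv z).measurable (hg hU)
  have hBe : ∀ᵐ ω ∂P, ω ∈ B ↔ g ω ∈ U := by
    filter_upwards [ae_all_iff.2 hS] with ω hω
    simp only [hB, Set.mem_iInter, Set.mem_preimage, hω, forall_const]
  have hBi : ∀ x, shift d x ⁻¹' B = B := by
    intro x
    ext ω
    simp only [hB, Set.mem_preimage, Set.mem_iInter, shift_shift]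
    exact ⟨fun h z => by simpa using h (z - x), fun h z => h (z + x)⟩
  rcases herg B hBm hBi with h0 | h1
  · right
    have : ∀ᵐ ω ∂P, ω ∉ B := measure_eq_zero_iff_ae_notMem.1 h0
    filter_upwards [this, hBe] with ω h1 h2
    rwa [← h2]
  · left
    have : ∀ᵐ ω ∂P, ω ∈ B := (mem_ae_iff_prob_eq_one hBm).2 h1
    filter_upwards [this, hBe] with ω h1 h2
    rwa [← h2]

end

section

/-! ### The environment operator on square-integrable functions -/

variable {d : ℕ}

lemma integral_piOf_pos (hd : 1 ≤ d) {P : Measure (EnvSp d)} [IsProbabilityMeasure P]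
    (hint : Integrable (fun ω => piOf d ω 0) P) : 0 < ∫ ω, piOf d ω 0 ∂P := by
  rw [integral_pos_iff_support_of_nonneg (fun ω => (piOf_pos hd ω 0).le) hint]
  have : Function.support (fun ω : EnvSp d => piOf d ω 0) = Set.univ :=
    Set.eq_univ_of_forall fun ω => (piOf_pos hd ω 0).ne'
  simp [this]

lemma measurable_density (P : Measure (EnvSp d)) : Measurable fun ω' : EnvSp d =>
    ENNReal.ofReal (piOf d ω' 0 / ∫ ω'', piOf d ω'' 0 ∂P) :=
  ENNReal.measurable_ofReal.comp ((continuous_piOf 0).measurable.div_const _)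

section

variable {P : Measure (EnvSp d)} [IsProbabilityMeasure P]

lemma integrable_Qmeas_iff (hd : 1 ≤ d) (hint : Integrable (fun ω => piOf d ω 0) P)
    {g : EnvSp d → ℝ} :
    Integrable g (Qmeas d P) ↔ Integrable (fun ω => piOf d ω 0 * g ω) P := by
  have hZ := integral_piOf_pos hd hint
  rw [Qmeas, integrable_withDensity_iff (measurable_density P)
    (ae_of_all _ fun _ => ENNReal.ofReal_lt_top)]
  have e : (fun ω : EnvSp d => g ω *
      (ENNReal.ofReal (piOf d ω 0 / ∫ ω'', piOf d ω'' 0 ∂P)).toReal) =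
      fun ω => piOf d ω 0 * g ω / ∫ ω'', piOf d ω'' 0 ∂P := by
    funext ω
    rw [ENNReal.toReal_ofReal (div_nonneg (piOf_pos hd ω 0).le hZ.le)]
    ring
  rw [e]
  refine ⟨fun h => ?_, fun h => h.div_const _⟩
  refine (h.mul_const (∫ ω'', piOf d ω'' 0 ∂P)).congr (ae_of_all _ fun ω => ?_)
  exact div_mul_cancel₀ _ hZ.ne'

lemma integral_Qmeas (hd : 1 ≤ d) (hint : Integrable (fun ω => piOf d ω 0) P)
    (g : EnvSp d → ℝ) :
    ∫ ω, g ω ∂(Qmeas d P) = (∫ ω, piOf d ω 0 * g ω ∂P) / ∫ ω, piOf d ω 0 ∂P := by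
  have hZ := integral_piOf_pos hd hint
  rw [Qmeas, integral_withDensity_eq_integral_toReal_smul (measurable_density P)
    (ae_of_all _ fun _ => ENNReal.ofReal_lt_top), ← integral_div]
  congr 1
  funext ω
  rw [ENNReal.toReal_ofReal (div_nonneg (piOf_pos hd ω 0).le hZ.le), smul_eq_mul]
  ring

lemma isProbabilityMeasure_Qmeas (hd : 1 ≤ d) (hint : Integrable (fun ω => piOf d ω 0) P) :
    IsProbabilityMeasure (Qmeas d P) := by
  have hZ := integral_piOf_pos hd hint
  refine ⟨?_⟩
  rw [Qmeas, withDensity_apply _ MeasurableSet.univ, Measure.restrict_univ,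
    ← ofReal_integral_eq_lintegral_ofReal (hint.div_const _)
      (ae_of_all _ fun ω => div_nonneg (piOf_pos hd ω 0).le hZ.le), integral_div,
    div_self hZ.ne', ENNReal.ofReal_one]

lemma Qmeas_absolutelyContinuous (P : Measure (EnvSp d)) : Qmeas d P ≪ P :=
  withDensity_absolutelyContinuous _ _

lemma absolutelyContinuous_Qmeas (hd : 1 ≤ d) (hint : Integrable (fun ω => piOf d ω 0) P) :
    P ≪ Qmeas d P := by
  refine withDensity_absolutelyContinuous' (measurable_density P).aemeasurable
    (ae_of_all _ fun ω => ?_)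
  rw [ne_eq, ENNReal.ofReal_eq_zero, not_le]
  exact div_pos (piOf_pos hd ω 0) (integral_piOf_pos hd hint)

lemma integral_envP_Qmeas (hd : 1 ≤ d) (hinv : ∀ z, MeasurePreserving (shift d z) P P)
    (hint : Integrable (fun ω => piOf d ω 0) P) {g : EnvSp d → ℝ} (hg : Measurable g)
    (hgi : Integrable g (Qmeas d P)) :
    Integrable (envP d g) (Qmeas d P) ∧
      ∫ ω, envP d g ω ∂(Qmeas d P) = ∫ ω, g ω ∂(Qmeas d P) := by
  have h := integral_piOf_mul_envP hinv hd hg ((integrable_Qmeas_iff hd hint).1 hgi)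
  exact ⟨(integrable_Qmeas_iff hd hint).2 h.1, by
    rw [integral_Qmeas hd hint, integral_Qmeas hd hint, h.2]⟩

lemma envP_congr_ae_Qmeas (hd : 1 ≤ d) (hinv : ∀ z, MeasurePreserving (shift d z) P P)
    (hint : Integrable (fun ω => piOf d ω 0) P) {g h : EnvSp d → ℝ}
    (hgh : g =ᵐ[Qmeas d P] h) : envP d g =ᵐ[Qmeas d P] envP d h :=
  (Qmeas_absolutelyContinuous P).ae_le
    (envP_congr_ae hinv ((absolutelyContinuous_Qmeas hd hint).ae_le hgh))

lemma memLp_envP (hd : 1 ≤ d) (hinv : ∀ z, MeasurePreserving (shift d z) P P)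
    (hint : Integrable (fun ω => piOf d ω 0) P) {g : EnvSp d → ℝ} (hg : Measurable g)
    (hg2 : MemLp g 2 (Qmeas d P)) :
    MemLp (envP d g) 2 (Qmeas d P) ∧
      ∫ ω, envP d g ω ^ 2 ∂(Qmeas d P) ≤ ∫ ω, g ω ^ 2 ∂(Qmeas d P) := by
  have hm := measurable_envP hg
  have h := integral_envP_Qmeas hd hinv hint (hg.pow_const 2) hg2.integrable_sq
  have hi : Integrable (fun ω => envP d g ω ^ 2) (Qmeas d P) := by
    refine h.1.mono' (hm.pow_const 2).aestronglyMeasurable (ae_of_all _ fun ω => ?_)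
    rw [Real.norm_of_nonneg (sq_nonneg _)]
    exact envP_sq_le hd g ω
  refine ⟨(memLp_two_iff_integrable_sq hm.aestronglyMeasurable).2 hi, ?_⟩
  rw [← h.2]
  exact integral_mono hi h.1 fun ω => envP_sq_le hd g ω

lemma norm_sq_eq_integral {Q : Measure (EnvSp d)} (u : Lp ℝ 2 Q) :
    ‖u‖ ^ 2 = ∫ ω, u ω ^ 2 ∂Q := by
  rw [← real_inner_self_eq_norm_sq, L2.inner_def]
  simp [sq]

/-- The environment Markov operator on `L²(ℚ)`. -/
def envLp (hd : 1 ≤ d) (hinv : ∀ z, MeasurePreserving (shift d z) P P)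
    (hint : Integrable (fun ω => piOf d ω 0) P) :
    Lp ℝ 2 (Qmeas d P) →L[ℝ] Lp ℝ 2 (Qmeas d P) :=
  LinearMap.mkContinuous
    { toFun := fun u => (memLp_envP hd hinv hint (Lp.stronglyMeasurable u).measurable
        (Lp.memLp u)).1.toLp (envP d u)
      map_add' := fun u v => by
        refine Lp.ext ?_
        refine (MemLp.coeFn_toLp _).trans ?_
        refine (envP_congr_ae_Qmeas hd hinv hint (Lp.coeFn_add u v)).trans ?_
        refine EventuallyEq.trans ?_ (Lp.coeFn_add _ _).symm
        filter_upwards [MemLp.coeFn_toLp (memLp_envP hd hinv hint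
          (Lp.stronglyMeasurable u).measurable (Lp.memLp u)).1, MemLp.coeFn_toLp
          (memLp_envP hd hinv hint (Lp.stronglyMeasurable v).measurable (Lp.memLp v)).1]
          with ω h1 h2
        rw [Pi.add_apply, h1, h2]
        exact envP_add u v ω
      map_smul' := fun a u => by
        refine Lp.ext ?_
        refine (MemLp.coeFn_toLp _).trans ?_
        refine (envP_congr_ae_Qmeas hd hinv hint (Lp.coeFn_smul a u)).trans ?_
        refine EventuallyEq.trans ?_ (Lp.coeFn_smul _ _).symm
        filter_upwards [MemLp.coeFn_toLp (memLp_envP hd hinv hint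
          (Lp.stronglyMeasurable u).measurable (Lp.memLp u)).1] with ω h1
        rw [Pi.smul_apply, RingHom.id_apply, h1]
        exact envP_const_mul a u ω } 1 (fun u => by
    rw [one_mul]
    refine (sq_le_sq₀ (norm_nonneg _) (norm_nonneg _)).1 ?_
    rw [norm_sq_eq_integral, norm_sq_eq_integral]
    refine le_trans (le_of_eq (integral_congr_ae ?_)) (memLp_envP hd hinv hint
      (Lp.stronglyMeasurable u).measurable (Lp.memLp u)).2
    filter_upwards [MemLp.coeFn_toLp (memLp_envP hd hinv hint
          (Lp.stronglyMeasurable u).measurable (Lp.memLp u)).1] with ω h1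
    exact congrArg (· ^ 2) h1)

lemma coeFn_envLp (hd : 1 ≤ d) (hinv : ∀ z, MeasurePreserving (shift d z) P P)
    (hint : Integrable (fun ω => piOf d ω 0) P) (u : Lp ℝ 2 (Qmeas d P)) :
    envLp hd hinv hint u =ᵐ[Qmeas d P] envP d u :=
  MemLp.coeFn_toLp (memLp_envP hd hinv hint (Lp.stronglyMeasurable u).measurable (Lp.memLp u)).1

lemma norm_envLp_le (hd : 1 ≤ d) (hinv : ∀ z, MeasurePreserving (shift d z) P P)
    (hint : Integrable (fun ω => piOf d ω 0) P) : ‖envLp hd hinv hint‖ ≤ 1 :=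
  LinearMap.mkContinuous_norm_le _ zero_le_one _

/-- Square-integrable harmonic functions of an ergodic environment are constant. -/
lemma exists_ae_eq_const_of_envP_eq (hd : 1 ≤ d)
    (hinv : ∀ z, MeasurePreserving (shift d z) P P)
    (hint : Integrable (fun ω => piOf d ω 0) P) (herg : ErgodicEnv d P) {g : EnvSp d → ℝ}
    (hg : Measurable g) (hg2 : MemLp g 2 (Qmeas d P)) (hh : envP d g =ᵐ[Qmeas d P] g) :
    ∃ c, ∀ᵐ ω ∂(Qmeas d P), g ω = c := by
  have h := integral_envP_Qmeas hd hinv hint (hg.pow_const 2) hg2.integrable_sq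
  set V : EnvSp d → ℝ := fun ω => envP d (fun ω => g ω ^ 2) ω - 2 * g ω * envP d g ω + g ω ^ 2
    with hV
  have hVe : V =ᵐ[Qmeas d P] fun ω => envP d (fun ω => g ω ^ 2) ω - g ω ^ 2 := by
    filter_upwards [hh] with ω h1
    rw [hV]; simp only [h1]; ring
  have hvar := fun ω => piOf_mul_variance hd g (g ω) ω
  have hV0 : ∀ ω, 0 ≤ V ω := fun ω => by
    have h0 : 0 ≤ piOf d ω 0 * V ω := by
      refine le_of_le_of_eq ?_ (hvar ω)
      exact Finset.sum_nonneg fun i _ => add_nonneg (mul_nonneg (ω.2 _).le (sq_nonneg _))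
        (mul_nonneg (ω.2 _).le (sq_nonneg _))
    exact nonneg_of_mul_nonneg_right h0 (piOf_pos hd ω 0)
  have hVi : Integrable V (Qmeas d P) := (h.1.sub hg2.integrable_sq).congr hVe.symm
  have hVz : ∫ ω, V ω ∂(Qmeas d P) = 0 := by
    rw [integral_congr_ae hVe, integral_sub h.1 hg2.integrable_sq, h.2, sub_self]
  have hVae := (integral_eq_zero_iff_of_nonneg hV0 hVi).1 hVz
  have hinvar : ∀ i, (fun ω => g (shift d (unitv d i) ω)) =ᵐ[P] g := by
    intro i
    filter_upwards [(absolutelyContinuous_Qmeas hd hint).ae_le hVae] with ω h1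
    have h2 := hvar ω
    rw [show envP d (fun ω => g ω ^ 2) ω - 2 * g ω * envP d g ω + g ω ^ 2 = 0 from h1,
      mul_zero, Finset.sum_eq_zero_iff_of_nonneg (fun i _ => add_nonneg
        (mul_nonneg (ω.2 _).le (sq_nonneg _)) (mul_nonneg (ω.2 _).le (sq_nonneg _)))] at h2
    have h3 := h2 i (Finset.mem_univ i)
    rw [add_eq_zero_iff_of_nonneg (mul_nonneg (ω.2 _).le (sq_nonneg _))
      (mul_nonneg (ω.2 _).le (sq_nonneg _))] at h3
    rcases mul_eq_zero.1 h3.1 with h4 | h4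
    · exact absurd h4 (ω.2 _).ne'
    · exact sub_eq_zero.1 (pow_eq_zero_iff two_ne_zero |>.1 h4)
  obtain ⟨c, hc⟩ := exists_ae_eq_const hinv herg hg hinvar
  exact ⟨c, (Qmeas_absolutelyContinuous P).ae_le hc⟩

/-- Mean ergodic theorem for the environment seen from the walk. -/
lemma tendsto_integral_sq_average (hd : 1 ≤ d)
    (hinv : ∀ z, MeasurePreserving (shift d z) P P)
    (hint : Integrable (fun ω => piOf d ω 0) P) (herg : ErgodicEnv d P) {g : EnvSp d → ℝ}
    (hg2 : MemLp g 2 (Qmeas d P)) (hg0 : ∫ ω, g ω ∂(Qmeas d P) = 0) :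
    Tendsto (fun n : ℕ => ∫ ω, ((∑ k ∈ Finset.range n, (envP d)^[k] g ω) / (n : ℝ)) ^ 2
      ∂(Qmeas d P)) atTop (𝓝 0) := by
  have hQ := isProbabilityMeasure_Qmeas hd hint
  set T := envLp hd hinv hint with hT
  set u : Lp ℝ 2 (Qmeas d P) := hg2.toLp g with hu
  have hproj := T.tendsto_birkhoffAverage_orthogonalProjection (norm_envLp_le hd hinv hint) u
  set F := T.eqLocus (1 : Lp ℝ 2 (Qmeas d P) →L[ℝ] Lp ℝ 2 (Qmeas d P)) with hF
  have hzero : F.orthogonalProjectionOnto u = 0 := by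
    rw [Submodule.orthogonalProjectionOnto_eq_zero_iff, Submodule.mem_orthogonal]
    intro v hv
    have hv' : T v = v := hv
    obtain ⟨c, hc⟩ := exists_ae_eq_const_of_envP_eq hd hinv hint herg
      (Lp.stronglyMeasurable v).measurable (Lp.memLp v) (by
        have := coeFn_envLp hd hinv hint v
        rw [← hT, hv'] at this
        exact this.symm)
    rw [L2.inner_def]
    calc _ = ∫ ω, c * g ω ∂(Qmeas d P) := by
          refine integral_congr_ae ?_
          filter_upwards [hc, hg2.coeFn_toLp] with ω h1 h2
          simp only [hu, h1, h2, RCLike.inner_apply, conj_trivial]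
          ring
      _ = 0 := by rw [integral_const_mul, hg0, mul_zero]
  rw [hzero] at hproj
  have hiter : ∀ k : ℕ, (T^[k] u : Lp ℝ 2 (Qmeas d P)) =ᵐ[Qmeas d P] (envP d)^[k] g := by
    intro k
    induction k with
    | zero => exact hg2.coeFn_toLp
    | succ k ih =>
      rw [Function.iterate_succ_apply', Function.iterate_succ_apply']
      exact (coeFn_envLp hd hinv hint _).trans (envP_congr_ae_Qmeas hd hinv hint ih)
  have hsum : ∀ n : ℕ, (birkhoffAverage ℝ T _root_.id n u : Lp ℝ 2 (Qmeas d P)) =ᵐ[Qmeas d P]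
      fun ω => (∑ k ∈ Finset.range n, (envP d)^[k] g ω) / (n : ℝ) := by
    intro n
    rw [birkhoffAverage, birkhoffSum]
    refine (Lp.coeFn_smul _ _).trans ?_
    have h1 := Lp.coeFn_finsetSum (Finset.range n) fun k => T^[k] u
    filter_upwards [h1, ae_all_iff.2 hiter] with ω h2 h3
    rw [Pi.smul_apply, smul_eq_mul, div_eq_inv_mul]
    congr 1
    refine h2.trans ?_
    rw [Finset.sum_apply]
    exact Finset.sum_congr rfl fun k _ => h3 k
  have hnorm := (hproj.norm).pow 2
  simp only [ZeroMemClass.coe_zero, norm_zero, ne_eq, OfNat.ofNat_ne_zero, not_false_eq_true,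
    zero_pow] at hnorm
  refine hnorm.congr fun n => ?_
  rw [norm_sq_eq_integral]
  refine integral_congr_ae ?_
  filter_upwards [hsum n] with ω h1
  rw [h1]

end

end

section

/-! ### The random walk -/

variable {d : ℕ}

lemma Pop_eq_sum_transP (ω : EnvSp d) (g : Vert d → ℝ) (x : Vert d) :
    Pop d ω g x = ∑ y ∈ nbrs d x, transP d ω x y * g y := by
  rw [Pop, ← sum_cnd ω (nbrs d x) x g fun i => by simp [nbrs], Finset.sum_div]
  exact Finset.sum_congr rfl fun y _ => (div_mul_eq_mul_div _ _ _).symm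

lemma transP_nonneg (hd : 1 ≤ d) (ω : EnvSp d) (x y : Vert d) : 0 ≤ transP d ω x y :=
  div_nonneg (cnd_nonneg ω x y) (piOf_pos hd ω x).le

lemma transP_eq_zero (ω : EnvSp d) {x y : Vert d} (h : y ∉ nbrs d x) : transP d ω x y = 0 := by
  rw [transP, cnd_eq_zero, zero_div]
  intro i
  constructor <;> rintro rfl <;> simp [nbrs] at h

lemma abs_Pop_le (hd : 1 ≤ d) (ω : EnvSp d) {g : Vert d → ℝ} {B : ℝ} (hg : ∀ x, |g x| ≤ B)
    (x : Vert d) : |Pop d ω g x| ≤ B := by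
  refine abs_le.2 ⟨?_, Pop_le hd ω (fun y => (abs_le.1 (hg y)).2) x⟩
  have h := Pop_mono hd ω (g := fun _ => -B) (fun y => (abs_le.1 (hg y)).1) x
  rwa [Pop_const hd] at h

/-- Paths agreeing with `γ` up to time `n`. -/
def cyl (n : ℕ) (γ : Path d) : Set (Path d) := {w | ∀ k ≤ n, w k = γ k}

lemma measurableSet_cyl (n : ℕ) (γ : Path d) : MeasurableSet (cyl n γ) := by
  have : cyl n γ = ⋂ k ∈ Set.Iic n, (fun w : Path d => w k) ⁻¹' {γ k} := by
    ext w; simp [cyl]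
  rw [this]
  exact MeasurableSet.biInter (Set.to_countable _) fun k _ =>
    measurable_pi_apply k (measurableSet_singleton _)

/-- Integrals decompose along the fibres of a countably-valued measurable map. -/
lemma integral_eq_tsum_fiber {α ι : Type*} [MeasurableSpace α] [MeasurableSpace ι] [Countable ι]
    [MeasurableSingletonClass ι] {μ : Measure α} {r : α → ι} (hr : Measurable r) {f : α → ℝ}
    (hf : Integrable f μ) : ∫ w, f w ∂μ = ∑' a, ∫ w in r ⁻¹' {a}, f w ∂μ := by
  have hU : ⋃ a, r ⁻¹' {a} = Set.univ := by ext w; simp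
  rw [← setIntegral_univ, ← hU]
  refine integral_iUnion (fun a => hr (measurableSet_singleton a)) ?_ (by simpa [hU] using hf)
  intro a b hab
  exact Disjoint.preimage r (by simpa using hab)

variable {ω : EnvSp d} {x₀ : Vert d} {μ : Measure (Path d)}

lemma measurable_eval (k : ℕ) : Measurable fun w : Path d => w k := measurable_pi_apply k

lemma measurable_comp_eval (φ : Vert d → ℝ) (k : ℕ) : Measurable fun w : Path d => φ (w k) :=
  (Measurable.of_discrete (f := φ)).comp (measurable_eval k)

lemma integrable_comp_eval [IsFiniteMeasure μ] {φ : Vert d → ℝ} {B : ℝ} (hφ : ∀ x, |φ x| ≤ B)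
    (k : ℕ) : Integrable (fun w : Path d => φ (w k)) μ :=
  Integrable.of_bound (measurable_comp_eval φ k).aestronglyMeasurable B
    (ae_of_all _ fun _ => hφ _)

lemma IsWalkLaw.measure_cyl_inter (h : IsWalkLaw d ω x₀ μ) (n : ℕ) (γ : Path d) (z : Vert d) :
    μ (cyl n γ ∩ {w | w (n + 1) = z}) = μ (cyl n γ) * ENNReal.ofReal (transP d ω (γ n) z) := by
  set γ' : Path d := fun k => if k ≤ n then γ k else z with hγ
  have h1 : cyl n γ ∩ {w | w (n + 1) = z} = cyl (n + 1) γ' := by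
    ext w
    constructor
    · rintro ⟨h2, h3⟩ k hk
      rcases Nat.lt_or_ge n k with h4 | h4
      · obtain rfl : k = n + 1 := by omega
        simpa [hγ] using h3
      · simpa [hγ, h4] using h2 k h4
    · intro h2
      refine ⟨fun k hk => ?_, ?_⟩
      · simpa [hγ, hk] using h2 k (by omega)
      · simpa [hγ] using h2 (n + 1) le_rfl
  rw [h1, cyl, cyl, h.2 (n + 1) γ', h.2 n γ, Finset.prod_range_succ, mul_assoc]
  have h2 : transP d ω (γ' n) (γ' (n + 1)) = transP d ω (γ n) z := by simp [hγ]
  have h3 : γ' 0 = γ 0 := by simp [hγ]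
  rw [h2, h3]
  refine congrArg (_ * ·) (congrArg (· * _) (Finset.prod_congr rfl fun k hk => ?_))
  have := Finset.mem_range.1 hk
  simp [hγ, show k ≤ n by omega, show k < n by omega]

lemma IsWalkLaw.setIntegral_cyl (h : IsWalkLaw d ω x₀ μ) (hd : 1 ≤ d) {g : Vert d → ℝ} {B : ℝ}
    (hg : ∀ x, |g x| ≤ B) (n : ℕ) (γ : Path d) :
    ∫ w in cyl n γ, g (w (n + 1)) ∂μ = μ.real (cyl n γ) * Pop d ω g (γ n) := by
  have hμ := h.1
  rw [integral_eq_tsum_fiber (measurable_eval (n + 1)) (integrable_comp_eval hg _)]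
  have hz : ∀ z, ∫ w in (fun w : Path d => w (n + 1)) ⁻¹' {z}, g (w (n + 1))
      ∂(μ.restrict (cyl n γ)) = μ.real (cyl n γ) * (transP d ω (γ n) z * g z) := by
    intro z
    have hm : MeasurableSet ((fun w : Path d => w (n + 1)) ⁻¹' {z}) :=
      measurable_eval (n + 1) (measurableSet_singleton z)
    rw [setIntegral_congr_fun (g := fun _ => g z) hm fun w hw => congrArg g hw,
      setIntegral_const, measureReal_restrict_apply hm, Set.inter_comm, measureReal_def]
    rw [show μ (cyl n γ ∩ (fun w : Path d => w (n + 1)) ⁻¹' {z}) = _ from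
      h.measure_cyl_inter n γ z, ENNReal.toReal_mul,
      ENNReal.toReal_ofReal (transP_nonneg hd ω _ _), smul_eq_mul, mul_assoc, measureReal_def]
  simp_rw [hz]
  rw [tsum_mul_left, Pop_eq_sum_transP]
  congr 1
  exact tsum_eq_sum fun y hy => by rw [transP_eq_zero ω hy, zero_mul]

/-- `Φ` depends only on the path up to time `n`. -/
def Adapted (n : ℕ) (Φ : Path d → ℝ) : Prop := ∀ w, ∀ v ∈ cyl n w, Φ v = Φ w

lemma adapted_measurable {n : ℕ} {Φ : Path d → ℝ} (hΦ : Adapted n Φ) : Measurable Φ := by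
  let r : Path d → (Fin (n + 1) → Vert d) := fun w k => w k
  let e : (Fin (n + 1) → Vert d) → Path d := fun a k => if h : k < n + 1 then a ⟨k, h⟩ else 0
  have hr : Measurable r := measurable_pi_lambda _ fun k => measurable_pi_apply _
  have : Φ = (Φ ∘ e) ∘ r := by
    funext w
    refine hΦ (e (r w)) w fun k hk => ?_
    have h1 : e (r w) k = w k := dif_pos (Nat.lt_succ_of_le hk)
    exact h1.symm
  rw [this]
  exact Measurable.of_discrete.comp hr

/-- The Markov property, tested against bounded functions of the past. -/
lemma IsWalkLaw.integral_mul_sub_Pop (h : IsWalkLaw d ω x₀ μ) (hd : 1 ≤ d) {g : Vert d → ℝ}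
    {B : ℝ} (hg : ∀ x, |g x| ≤ B) {n : ℕ} {Φ : Path d → ℝ} (hΦ : Adapted n Φ) {K : ℝ}
    (hK : ∀ w, |Φ w| ≤ K) :
    ∫ w, Φ w * (g (w (n + 1)) - Pop d ω g (w n)) ∂μ = 0 := by
  have hμ := h.1
  have hgi : Integrable (fun w : Path d => g (w (n + 1))) μ := integrable_comp_eval hg _
  have hpi : Integrable (fun w : Path d => Pop d ω g (w n)) μ :=
    integrable_comp_eval (abs_Pop_le hd ω hg) _
  have hi : Integrable (fun w => Φ w * (g (w (n + 1)) - Pop d ω g (w n))) μ :=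
    (hgi.sub hpi).bdd_mul (adapted_measurable hΦ).aestronglyMeasurable
      (ae_of_all _ fun w => hK w)
  let r : Path d → (Fin (n + 1) → Vert d) := fun w k => w k
  have hr : Measurable r := measurable_pi_lambda _ fun k => measurable_pi_apply _
  rw [integral_eq_tsum_fiber hr hi]
  refine (tsum_congr fun a => ?_).trans tsum_zero
  let γ : Path d := fun k => if h : k < n + 1 then a ⟨k, h⟩ else 0
  have hfib : r ⁻¹' {a} = cyl n γ := by
    ext w
    constructor
    · intro h1 k hk
      have h2 : γ k = a ⟨k, Nat.lt_succ_of_le hk⟩ := dif_pos (Nat.lt_succ_of_le hk)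
      exact (congrFun h1 ⟨k, Nat.lt_succ_of_le hk⟩).trans h2.symm
    · intro h1
      funext k
      exact (h1 k (Nat.le_of_lt_succ k.2)).trans (dif_pos k.2)
  rw [hfib, setIntegral_congr_fun (g := fun w => Φ γ * (g (w (n + 1)) - Pop d ω g (γ n)))
    (measurableSet_cyl n γ) fun w hw => by
      simp only [hΦ γ w hw, show w n = γ n from hw n le_rfl], integral_const_mul,
    integral_sub hgi.integrableOn (integrable_const _), h.setIntegral_cyl hd hg,
    setIntegral_const, smul_eq_mul, sub_self, mul_zero]

lemma IsWalkLaw.ae_start (h : IsWalkLaw d ω x₀ μ) : ∀ᵐ w ∂μ, w 0 = x₀ := by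
  have hμ := h.1
  have h1 := h.2 0 fun _ => x₀
  simp only [nonpos_iff_eq_zero, forall_eq, if_true, Finset.range_zero, Finset.prod_empty,
    mul_one] at h1
  exact (prob_compl_eq_zero_iff (measurable_eval 0 (measurableSet_singleton x₀))).2 h1

lemma IsWalkLaw.integral_eval (h : IsWalkLaw d ω x₀ μ) (hd : 1 ≤ d) (k : ℕ) :
    ∀ {φ : Vert d → ℝ} {B : ℝ}, (∀ x, |φ x| ≤ B) →
      ∫ w, φ (w k) ∂μ = (Pop d ω)^[k] φ x₀ := by
  have hμ := h.1
  induction k with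
  | zero =>
    intro φ B hφ
    have : (fun w : Path d => φ (w 0)) =ᵐ[μ] fun _ => φ x₀ := by
      filter_upwards [h.ae_start] with w hw
      rw [hw]
    rw [integral_congr_ae this]
    simp
  | succ k ih =>
    intro φ B hφ
    have h1 := h.integral_mul_sub_Pop hd hφ (n := k) (Φ := fun _ => 1) (fun _ _ _ => rfl)
      (K := 1) (by simp)
    simp only [one_mul] at h1
    rw [integral_sub (integrable_comp_eval hφ _)
      (integrable_comp_eval (abs_Pop_le hd ω hφ) _), sub_eq_zero] at h1
    rw [h1, ih (abs_Pop_le hd ω hφ), Function.iterate_succ_apply]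

/-- The martingale part of the additive functional with corrector `g`. -/
def mart (d : ℕ) (ω : EnvSp d) (g : Vert d → ℝ) (n : ℕ) (w : Path d) : ℝ :=
  ∑ k ∈ Finset.range n, (g (w (k + 1)) - Pop d ω g (w k))

lemma adapted_mart (g : Vert d → ℝ) (n : ℕ) : Adapted n (mart d ω g n) := by
  intro w v hv
  refine Finset.sum_congr rfl fun k hk => ?_
  have := Finset.mem_range.1 hk
  rw [hv k (by omega), hv (k + 1) (by omega)]

lemma abs_step_le (hd : 1 ≤ d) {g : Vert d → ℝ} {B : ℝ} (hg : ∀ x, |g x| ≤ B) (x y : Vert d) :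
    |g y - Pop d ω g x| ≤ 2 * B := by
  refine (abs_sub _ _).trans ?_
  linarith [hg y, abs_Pop_le hd ω hg x]

lemma abs_mart_le (hd : 1 ≤ d) {g : Vert d → ℝ} {B : ℝ} (hg : ∀ x, |g x| ≤ B) (n : ℕ)
    (w : Path d) : |mart d ω g n w| ≤ n * (2 * B) := by
  refine (Finset.abs_sum_le_sum_abs _ _).trans ?_
  refine (Finset.sum_le_sum fun k _ => abs_step_le hd hg _ _).trans (le_of_eq ?_)
  simp

lemma IsWalkLaw.integral_mart_sq_le (h : IsWalkLaw d ω x₀ μ) (hd : 1 ≤ d) {g : Vert d → ℝ}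
    {B : ℝ} (hg : ∀ x, |g x| ≤ B) (n : ℕ) :
    ∫ w, mart d ω g n w ^ 2 ∂μ ≤ n * (2 * B) ^ 2 := by
  have hμ := h.1
  induction n with
  | zero => simp [mart]
  | succ n ih =>
    have hm := adapted_measurable (adapted_mart (ω := ω) g n)
    have hD : Measurable fun w : Path d => g (w (n + 1)) - Pop d ω g (w n) :=
      (measurable_comp_eval g _).sub (measurable_comp_eval _ _)
    have hi1 : Integrable (fun w => mart d ω g n w ^ 2) μ :=
      Integrable.of_bound (hm.pow_const 2).aestronglyMeasurable ((n * (2 * B)) ^ 2)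
        (ae_of_all _ fun w => by
          rw [norm_pow]; exact pow_le_pow_left₀ (norm_nonneg _) (abs_mart_le hd hg n w) 2)
    have hi2 : Integrable (fun w => mart d ω g n w * (g (w (n + 1)) - Pop d ω g (w n))) μ :=
      Integrable.of_bound (hm.mul hD).aestronglyMeasurable ((n * (2 * B)) * (2 * B))
        (ae_of_all _ fun w => by
          rw [norm_mul]
          exact mul_le_mul (abs_mart_le hd hg n w) (abs_step_le hd hg _ _) (norm_nonneg _)
            ((abs_nonneg _).trans (abs_mart_le (ω := ω) hd hg n w)))
    have hD2 : ∀ w : Path d, (g (w (n + 1)) - Pop d ω g (w n)) ^ 2 ≤ (2 * B) ^ 2 := fun w =>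
      sq_le_sq' (abs_le.1 (abs_step_le hd hg _ _)).1 (abs_le.1 (abs_step_le hd hg _ _)).2
    have hi3 : Integrable (fun w : Path d => (g (w (n + 1)) - Pop d ω g (w n)) ^ 2) μ :=
      Integrable.of_bound (hD.pow_const 2).aestronglyMeasurable ((2 * B) ^ 2)
        (ae_of_all _ fun w => by
          rw [Real.norm_of_nonneg (sq_nonneg _)]; exact hD2 w)
    have hsplit : ∀ w, mart d ω g (n + 1) w ^ 2 = mart d ω g n w ^ 2 +
        2 * (mart d ω g n w * (g (w (n + 1)) - Pop d ω g (w n))) +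
        (g (w (n + 1)) - Pop d ω g (w n)) ^ 2 := fun w => by
      rw [mart, Finset.sum_range_succ, ← mart]; ring
    simp_rw [hsplit]
    have hi12 : Integrable (fun w => mart d ω g n w ^ 2 +
        2 * (mart d ω g n w * (g (w (n + 1)) - Pop d ω g (w n)))) μ := hi1.add (hi2.const_mul 2)
    rw [integral_add hi12 hi3, integral_add hi1 (hi2.const_mul 2),
      integral_const_mul, h.integral_mul_sub_Pop hd hg (adapted_mart g n) (abs_mart_le hd hg n)]
    have h3 : ∫ w, (g (w (n + 1)) - Pop d ω g (w n)) ^ 2 ∂μ ≤ (2 * B) ^ 2 := by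
      simpa using integral_mono hi3 (integrable_const ((2 * B) ^ 2)) hD2
    push_cast
    linarith

lemma IsWalkLaw.integral_abs_mart_le (h : IsWalkLaw d ω x₀ μ) (hd : 1 ≤ d) {g : Vert d → ℝ}
    {B : ℝ} (hg : ∀ x, |g x| ≤ B) {n : ℕ} (hn : 1 ≤ n) :
    ∫ w, |mart d ω g n w| ∂μ ≤ ((2 * B) ^ 2 + 1) * √n := by
  have hμ := h.1
  have hn' : (0 : ℝ) < n := by exact_mod_cast hn
  have hs : 0 < √(n : ℝ) := Real.sqrt_pos.2 hn'
  have hss : √(n : ℝ) * √n = n := Real.mul_self_sqrt hn'.le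
  have hm := adapted_measurable (adapted_mart (ω := ω) g n)
  have hi1 : Integrable (fun w => mart d ω g n w ^ 2) μ :=
    Integrable.of_bound (hm.pow_const 2).aestronglyMeasurable ((n * (2 * B)) ^ 2)
      (ae_of_all _ fun w => by
        rw [norm_pow]; exact pow_le_pow_left₀ (norm_nonneg _) (abs_mart_le hd hg n w) 2)
  have hi0 : Integrable (fun w => |mart d ω g n w|) μ :=
    (Integrable.of_bound hm.aestronglyMeasurable _
      (ae_of_all _ fun w => abs_mart_le hd hg n w)).abs
  have hpt : ∀ w, |mart d ω g n w| ≤ mart d ω g n w ^ 2 / √n + √n := fun w => by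
    rw [← sq_abs, div_add' _ _ _ hs.ne', le_div_iff₀ hs]
    nlinarith [sq_nonneg (|mart d ω g n w| - √n), abs_nonneg (mart d ω g n w)]
  refine (integral_mono hi0 ((hi1.div_const _).add (integrable_const _)) hpt).trans ?_
  simp only [Pi.add_apply]
  rw [integral_add (hi1.div_const _) (integrable_const _), integral_div, integral_const,
    probReal_univ, one_smul]
  have h2 : (∫ w, mart d ω g n w ^ 2 ∂μ) / √n ≤ (2 * B) ^ 2 * √n := by
    rw [div_le_iff₀ hs, mul_assoc, hss]
    linarith [h.integral_mart_sq_le hd hg n]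
  linarith

/-- Additive functionals are controlled by a corrector and the error of the Poisson equation. -/
lemma IsWalkLaw.integral_abs_sum_le (h : IsWalkLaw d ω x₀ μ) (hd : 1 ≤ d)
    {F g A : Vert d → ℝ} {B K : ℝ} (hg : ∀ x, |g x| ≤ B) (hA : ∀ x, |A x| ≤ K)
    (hF : ∀ x, F x = g x - Pop d ω g x + A x) {n : ℕ} (hn : 1 ≤ n) :
    ∫ w, |∑ k ∈ Finset.range n, F (w k)| ∂μ ≤ 2 * B + ((2 * B) ^ 2 + 1) * √n +
      ∑ k ∈ Finset.range n, (Pop d ω)^[k] (fun x => |A x|) x₀ := by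
  have hμ := h.1
  have hdec : ∀ w : Path d, ∑ k ∈ Finset.range n, F (w k) =
      g (w 0) - g (w n) + mart d ω g n w + ∑ k ∈ Finset.range n, A (w k) := fun w => by
    rw [← neg_sub (g (w n)), ← Finset.sum_range_sub (fun k => g (w k)), mart,
      ← Finset.sum_neg_distrib, ← Finset.sum_add_distrib, ← Finset.sum_add_distrib]
    exact Finset.sum_congr rfl fun k _ => by rw [hF]; ring
  have hm := adapted_measurable (adapted_mart (ω := ω) g n)
  have hi0 : Integrable (fun w => |mart d ω g n w|) μ :=
    (Integrable.of_bound hm.aestronglyMeasurable _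
      (ae_of_all _ fun w => abs_mart_le hd hg n w)).abs
  have hiA : ∀ k ∈ Finset.range n, Integrable (fun w : Path d => |A (w k)|) μ := fun k _ =>
    integrable_comp_eval (φ := fun x => |A x|) (B := K) (by simpa using hA) k
  have hFi : Integrable (fun w : Path d => |∑ k ∈ Finset.range n, F (w k)|) μ := by
    refine (integrable_finsetSum _ fun k _ => integrable_comp_eval (B := 2 * B + K)
      (fun x => ?_) k).abs
    rw [hF]
    exact (abs_add_le _ _).trans (add_le_add (abs_step_le hd hg x x) (hA x))
  have hpt : ∀ w : Path d, |∑ k ∈ Finset.range n, F (w k)| ≤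
      2 * B + |mart d ω g n w| + ∑ k ∈ Finset.range n, |A (w k)| := fun w => by
    rw [hdec]
    refine (abs_add_le _ _).trans (add_le_add ((abs_add_le _ _).trans (add_le_add ?_ le_rfl))
      (Finset.abs_sum_le_sum_abs _ _))
    exact (abs_sub _ _).trans (by linarith [hg (w 0), hg (w n)])
  have hiS := integrable_finsetSum _ hiA
  have hi1 : Integrable (fun w => 2 * B + |mart d ω g n w|) μ := (integrable_const _).add hi0
  refine (integral_mono hFi (hi1.add hiS) hpt).trans ?_
  simp only [Pi.add_apply]
  rw [integral_add hi1 hiS, integral_finsetSum _ hiA, integral_add (integrable_const _) hi0,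
    integral_const, probReal_univ, one_smul]
  refine add_le_add (add_le_add le_rfl (h.integral_abs_mart_le hd hg hn)) (le_of_eq ?_)
  exact Finset.sum_congr rfl fun k _ =>
    h.integral_eval hd k (φ := fun x => |A x|) (B := K) (by simpa using hA)

end

section

/-! ### Averaging -/

variable {d : ℕ}

lemma abs_iterate_Pop_le (hd : 1 ≤ d) (ω : EnvSp d) {F : Vert d → ℝ} {K : ℝ}
    (hF : ∀ x, |F x| ≤ K) (k : ℕ) (x : Vert d) : |(Pop d ω)^[k] F x| ≤ K := by
  induction k generalizing x with
  | zero => exact hF x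
  | succ k ih =>
    rw [Function.iterate_succ_apply']
    exact abs_Pop_le hd ω ih x

/-- Bounded solution of the Poisson equation up to a time-averaged error. -/
lemma exists_corrector (hd : 1 ≤ d) (ω : EnvSp d) {F : Vert d → ℝ} {K : ℝ}
    (hF : ∀ x, |F x| ≤ K) {m : ℕ} (hm : 1 ≤ m) :
    ∃ (g : Vert d → ℝ) (B : ℝ), (∀ x, |g x| ≤ B) ∧
      ∀ x, F x = g x - Pop d ω g x + (∑ i ∈ Finset.range m, (Pop d ω)^[i] F x) / m := by
  set G : ℕ → Vert d → ℝ := fun i => ∑ j ∈ Finset.range i, (Pop d ω)^[j] F with hG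
  have hm' : (m : ℝ) ≠ 0 := by exact_mod_cast (by omega : m ≠ 0)
  have hstep : ∀ i, G i - popL d ω (G i) = F - (Pop d ω)^[i] F := fun i => by
    rw [hG]
    simp only [map_sum, popL_apply, ← Function.iterate_succ_apply' (Pop d ω),
      ← Finset.sum_sub_distrib]
    exact Finset.sum_range_sub' (fun j => (Pop d ω)^[j] F) i
  refine ⟨(m : ℝ)⁻¹ • ∑ i ∈ Finset.range m, G i,
    (m : ℝ)⁻¹ * ∑ i ∈ Finset.range m, ∑ j ∈ Finset.range i, K, fun x => ?_, fun x => ?_⟩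
  · rw [Pi.smul_apply, smul_eq_mul, abs_mul, abs_of_nonneg (by positivity : 0 ≤ (m : ℝ)⁻¹)]
    refine mul_le_mul_of_nonneg_left ?_ (by positivity)
    simp only [hG, Finset.sum_apply]
    refine (Finset.abs_sum_le_sum_abs _ _).trans (Finset.sum_le_sum fun i _ => ?_)
    exact (Finset.abs_sum_le_sum_abs _ _).trans
      (Finset.sum_le_sum fun j _ => abs_iterate_Pop_le hd ω hF j x)
  · have h : (m : ℝ)⁻¹ • ∑ i ∈ Finset.range m, G i -
        popL d ω ((m : ℝ)⁻¹ • ∑ i ∈ Finset.range m, G i) =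
        F - (m : ℝ)⁻¹ • ∑ i ∈ Finset.range m, (Pop d ω)^[i] F := by
      rw [map_smul, map_sum, ← smul_sub, ← Finset.sum_sub_distrib,
        Finset.sum_congr rfl fun i _ => hstep i, Finset.sum_sub_distrib, smul_sub,
        Finset.sum_const, Finset.card_range, ← Nat.cast_smul_eq_nsmul ℝ, inv_smul_smul₀ hm']
    have hx := congrFun h x
    simp only [Pi.sub_apply, Pi.smul_apply, Finset.sum_apply, smul_eq_mul, popL_apply] at hx ⊢
    rw [div_eq_inv_mul, hx]
    ring

lemma continuous_iterate_envP (hd : 1 ≤ d) {g : EnvSp d → ℝ} (hg : Continuous g) (k : ℕ) :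
    Continuous ((envP d)^[k] g) := by
  induction k with
  | zero => exact hg
  | succ k ih =>
    rw [Function.iterate_succ_apply']
    exact continuous_envP hd ih

lemma abs_iterate_envP_le (hd : 1 ≤ d) {g : EnvSp d → ℝ} {M : ℝ} (hg : ∀ ω, |g ω| ≤ M) (k : ℕ)
    (ω : EnvSp d) : |(envP d)^[k] g ω| ≤ M := by
  induction k generalizing ω with
  | zero => exact hg ω
  | succ k ih =>
    rw [Function.iterate_succ_apply']
    exact abs_envP_le hd ih ω

lemma abs_average_le {M : ℝ} (hM : 0 ≤ M) {u : ℕ → ℝ} (hu : ∀ k, |u k| ≤ M) (n : ℕ) :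
    |(∑ k ∈ Finset.range n, u k) / n| ≤ M := by
  rw [abs_div, Nat.abs_cast]
  refine div_le_of_le_mul₀ (Nat.cast_nonneg n) hM ?_
  refine (Finset.abs_sum_le_sum_abs _ _).trans ?_
  refine (Finset.sum_le_sum fun k _ => hu k).trans (le_of_eq ?_)
  rw [Finset.sum_const, Finset.card_range, nsmul_eq_mul, mul_comm]

/-- Averaging for centred observables of the environment seen from the walk. -/
lemma tendsto_integral_abs_average (hd : 1 ≤ d) {p q : ℝ} (hp : 1 < p) (hq : 1 < q)
    (hpq : 2 ≤ d → 1 / p + 1 / q < 2 / (d : ℝ)) {ω : EnvSp d} {C : ℝ}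
    (hC : BoxMoments d p q ω C) {P : Measure (EnvSp d)} (hP : IsEnvLaw d ω P)
    (herg : ErgodicEnv d P) {μ : Measure (Path d)} (hμ : IsWalkLaw d ω 0 μ)
    {f : EnvSp d → ℝ} (hf : Continuous f) {M : ℝ} (hM : 0 < M) (hfM : ∀ ω, |f ω| ≤ M)
    (hf0 : ∫ ω, f ω ∂(Qmeas d P) = 0) :
    Tendsto (fun n : ℕ => ∫ w, |(∑ k ∈ Finset.range n, f (shift d (w k) ω)) / (n : ℝ)| ∂μ)
      atTop (𝓝 0) := by
  have hPp := hP.1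
  have hint := hP.integrable_piOf hd hp hC
  have hQ := isProbabilityMeasure_Qmeas hd hint
  set Z := ∫ ω', piOf d ω' 0 ∂P with hZ
  have hZ0 : 0 < Z := integral_piOf_pos hd hint
  have hf2 : MemLp f 2 (Qmeas d P) :=
    MemLp.of_bound hf.aestronglyMeasurable M (ae_of_all _ hfM)
  have hmean := tendsto_integral_sq_average hd hP.measurePreserving hint herg hf2 hf0
  refine Metric.tendsto_atTop'.2 fun ε hε => ?_
  obtain ⟨a, ha, hmoser⟩ := exists_avg_iterate_le hd hp hq hpq hC hM (half_pos hε)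
  have ha3 : 0 < a / 3 ^ d / Z := by positivity
  obtain ⟨m, hm1, hm⟩ := ((hmean.eventually_lt_const ha3).and (eventually_ge_atTop 1)).exists
  set A : EnvSp d → ℝ := fun ω' => (∑ k ∈ Finset.range m, (envP d)^[k] f ω') / (m : ℝ) with hA
  have hAc : Continuous A :=
    (continuous_finsetSum _ fun k _ => continuous_iterate_envP hd hf k).div_const _
  have hAM : ∀ ω', |A ω'| ≤ M := fun ω' =>
    abs_average_le hM.le (fun k => abs_iterate_envP_le hd hfM k ω') m
  have hAint : ∫ ω', piOf d ω' 0 * A ω' ^ 2 ∂P < a / 3 ^ d := by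
    have h := integral_Qmeas hd hint fun ω' => A ω' ^ 2
    rw [eq_div_iff hZ0.ne'] at h
    rw [← h, ← lt_div_iff₀ hZ0]
    exact hm1
  have hbox := IsEnvLaw.eventually_sum_piOf_mul_le hd hp hC hP (hAc.pow 2)
    (fun ω' => sq_nonneg (A ω')) (K := M ^ 2)
    (fun ω' => sq_le_sq' (abs_le.1 (hAM ω')).1 (abs_le.1 (hAM ω')).2) hAint
  obtain ⟨N₀, hN₀⟩ := eventually_atTop.1 (hbox.and (eventually_ge_atTop 1))
  set F : Vert d → ℝ := fun x => f (shift d x ω) with hF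
  have hAF : ∀ x, A (shift d x ω) = (∑ i ∈ Finset.range m, (Pop d ω)^[i] F x) / m := fun x => by
    simp only [hA, iterate_envP_shift, hF]
  have hev := hmoser (fun x => |A (shift d x ω)|) (fun x => ⟨abs_nonneg _, hAM _⟩)
    ⟨N₀, fun N hN => by
      obtain ⟨h1, h2⟩ := hN₀ N hN
      simp only [sq_abs]
      refine h1.trans ?_
      rw [div_mul_eq_mul_div, div_le_iff₀ (by positivity), mul_assoc, mul_comm ((N : ℝ) ^ d)]
      exact mul_le_mul_of_nonneg_left (card_box_le h2) ha.le⟩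
  obtain ⟨g, B, hgB, hgF⟩ := exists_corrector hd ω (F := F) (fun x => hfM _) hm
  have hsmall : Tendsto (fun n : ℕ => 2 * B * (n : ℝ)⁻¹ + ((2 * B) ^ 2 + 1) * (√(n : ℝ))⁻¹)
      atTop (𝓝 0) := by
    have h1 : Tendsto (fun n : ℕ => (n : ℝ)⁻¹) atTop (𝓝 0) := tendsto_inv_atTop_nhds_zero_nat
    have h2 : Tendsto (fun n : ℕ => (√(n : ℝ))⁻¹) atTop (𝓝 0) :=
      tendsto_inv_atTop_zero.comp (Real.tendsto_sqrt_atTop.comp tendsto_natCast_atTop_atTop)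
    simpa using (h1.const_mul (2 * B)).add (h2.const_mul ((2 * B) ^ 2 + 1))
  obtain ⟨N₁, hN₁⟩ := eventually_atTop.1
    ((hsmall.eventually_lt_const (half_pos hε)).and (hev.and (eventually_ge_atTop 1)))
  refine ⟨N₁, fun n hn => ?_⟩
  obtain ⟨h1, h2, h3⟩ := hN₁ n hn.le
  have hn' : (0 : ℝ) < n := by exact_mod_cast h3
  have hwalk := hμ.integral_abs_sum_le hd hgB (K := M) (fun x => hAM (shift d x ω))
    (fun x => (hgF x).trans (by rw [hAF])) h3
  simp only [abs_div, Nat.abs_cast]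
  rw [integral_div, Real.dist_0_eq_abs, abs_of_nonneg
    (div_nonneg (integral_nonneg fun w => abs_nonneg _) hn'.le)]
  refine (div_le_div_of_nonneg_right hwalk hn'.le).trans_lt ?_
  rw [add_div, add_div]
  have h4 : ((2 * B) ^ 2 + 1) * √(n : ℝ) / n = ((2 * B) ^ 2 + 1) * (√(n : ℝ))⁻¹ := by
    rw [mul_div_assoc, Real.sqrt_div_self]
  rw [h4, div_eq_mul_inv (2 * B)]
  linarith

end

/-- STATEMENT 9 (Theorem 4.1): averaging for the environment seen from the particle. -/
theorem statement9 (d : ℕ) (hd : 1 ≤ d) (p q : ℝ) (hp : 1 < p) (hq : 1 < q)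
    (hpq : 2 ≤ d → 1 / p + 1 / q < 2 / (d : ℝ))
    (ω : EnvSp d) (hstar : InOmegaStar d ω) (hmom : InOmegaPQ d p q ω)
    (P : Measure (EnvSp d)) (hP : IsEnvLaw d ω P)
    (μ : Measure (Path d)) (hμ : IsWalkLaw d ω 0 μ) :
    Integrable (fun ω' => piOf d ω' 0) P ∧
    ∀ f : EnvSp d → ℝ, Continuous f → IsBdd d f →
      Tendsto (fun n : ℕ =>
          ∫ w, |(∑ k ∈ Finset.range n, f (shift d (w k) ω)) / (n : ℝ) -
                ∫ ω', f ω' ∂(Qmeas d P)| ∂μ) atTop (𝓝 0) := by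
  obtain ⟨C, hC⟩ := hmom.boxMoments hp.le
  have hPp := hP.1
  have hint := hP.integrable_piOf hd hp hC
  have hQ := isProbabilityMeasure_Qmeas hd hint
  refine ⟨hint, fun f hf ⟨M, hM⟩ => ?_⟩
  set c := ∫ ω', f ω' ∂(Qmeas d P) with hc
  have hM0 : 0 ≤ M := (abs_nonneg _).trans (hM ω)
  have hfi : Integrable f (Qmeas d P) :=
    Integrable.of_bound hf.aestronglyMeasurable M (ae_of_all _ hM)
  have hcentre : ∫ ω', (f ω' - c) ∂(Qmeas d P) = 0 := by
    rw [integral_sub hfi (integrable_const c), integral_const, probReal_univ, one_smul, sub_self]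
  refine (tendsto_integral_abs_average hd hp hq hpq hC hP (hstar.2.2 P hP) hμ
    (f := fun ω' => f ω' - c) (hf.sub continuous_const) (M := M + |c| + 1) (by positivity)
    (fun ω' => (abs_sub _ _).trans (by linarith [hM ω'])) hcentre).congr' ?_
  filter_upwards [eventually_ge_atTop 1] with n hn
  have hn' : (n : ℝ) ≠ 0 := by exact_mod_cast (by omega : n ≠ 0)
  refine integral_congr_ae (ae_of_all _ fun w => congrArg abs ?_)
  rw [Finset.sum_sub_distrib, Finset.sum_const, Finset.card_range, nsmul_eq_mul, sub_div,
    mul_div_cancel_left₀ _ hn']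


end DetCond
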